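/- arXiv:1607.05197 — 4 statements merged into one kernel-verified Lean document; each statement's English description precedes it below -/
import Mathlib

section
/- If a finite simple graph G admits a k-prime product distance labeling, then G is 2^(k+1)-colorable, i.e., the chromatic number of G is at most 2^(k+1). -/
/-- `L` is a `k`-prime product distance labeling of `G`: `L` is injective,
labels of distinct vertices differ by more than 1, and for every edge the
absolute difference of labels has at most `k` prime factors counted with
multiplicity. -/
def IsPrimeProductLabeling {V : Type*} (G : SimpleGraph V) (k : ℕ) (L : V → ℤ) : Prop :=
  Function.Injective L ∧
  (∀ u v : V, u ≠ v → 1 < |L u - L v|) ∧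
  (∀ u v : V, G.Adj u v → (L u - L v).natAbs.primeFactorsList.length ≤ k)

/-- `G` is a `k`-prime product graph. -/
def IsPrimeProductGraph {V : Type*} (G : SimpleGraph V) (k : ℕ) : Prop :=
  ∃ L : V → ℤ, IsPrimeProductLabeling G k L

/-- The prime product number of `G`: the least positive `k` such that `G` is a
`k`-prime product graph. -/
noncomputable def ppn {V : Type*} (G : SimpleGraph V) : ℕ :=
  sInf {k : ℕ | 0 < k ∧ IsPrimeProductGraph G k}

/-- A prime power dividing a nonzero `n` has exponent at most the number of prime factors of `n`
counted with multiplicity. -/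
theorem le_length_primeFactorsList_of_pow_dvd {p m n : ℕ} (hp : p.Prime) (hn : n ≠ 0)
    (h : p ^ m ∣ n) : m ≤ n.primeFactorsList.length := by
  have hlen := (Nat.primeFactorsList_sublist_of_dvd h hn).length_le
  rwa [hp.primeFactorsList_pow, List.length_replicate] at hlen

/-- If a finite simple graph `G` admits a `k`-prime product distance labeling,
then `G` is `2 ^ (k + 1)`-colorable. -/
theorem colorable_of_primeProductLabeling {V : Type*} [Fintype V] (G : SimpleGraph V)
    (k : ℕ) (hk : 0 < k) (L : V → ℤ) (hL : IsPrimeProductLabeling G k L) :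
    G.Colorable (2 ^ (k + 1)) := by
  obtain ⟨hinj, -, hadj⟩ := hL
  let C : G.Coloring (ZMod (2 ^ (k + 1))) :=
    SimpleGraph.Coloring.mk (fun v => (L v : ZMod (2 ^ (k + 1)))) fun {u v} huv heq => by
      have hdvd : 2 ^ (k + 1) ∣ (L u - L v).natAbs := by
        rw [← Int.natCast_dvd, ← ZMod.intCast_zmod_eq_zero_iff_dvd, Int.cast_sub, sub_eq_zero]
        exact heq
      have hne : (L u - L v).natAbs ≠ 0 :=
        Int.natAbs_ne_zero.mpr (sub_ne_zero.mpr (hinj.ne huv.ne))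
      have hle := le_length_primeFactorsList_of_pow_dvd Nat.prime_two hne hdvd
      have := hadj u v huv
      omega
  simpa only [ZMod.card] using C.colorable
end

section
/- For every integer n ≥ 3, the prime product number of the complete graph K_n equals ⌈log₂(n)⌉ − 1. -/
/-- If every prime factor of `m` is at least `p`, then `p ^ Ω(m) ≤ m`. -/
theorem pow_length_primeFactorsList_le {m p : ℕ} (hm : m ≠ 0)
    (h : ∀ q ∈ m.primeFactorsList, p ≤ q) : p ^ m.primeFactorsList.length ≤ m := by
  calc p ^ m.primeFactorsList.length ≤ m.primeFactorsList.prod := List.pow_card_le_prod _ _ h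
    _ = m := Nat.prod_primeFactorsList hm

theorem length_primeFactorsList_le_of_lt_two_pow {m k : ℕ} (hm : m ≠ 0) (h : m < 2 ^ (k + 1)) :
    m.primeFactorsList.length ≤ k := by
  have h2 : 2 ^ m.primeFactorsList.length ≤ m :=
    pow_length_primeFactorsList_le hm fun q hq => (Nat.prime_of_mem_primeFactorsList hq).two_le
  exact Nat.lt_succ_iff.mp ((Nat.pow_lt_pow_iff_right (by norm_num)).mp (h2.trans_lt h))

theorem length_primeFactorsList_le_of_odd_of_lt_three_pow {m k : ℕ} (hm : Odd m)
    (h : m < 3 ^ (k + 1)) : m.primeFactorsList.length ≤ k := by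
  have h3 : 3 ^ m.primeFactorsList.length ≤ m := by
    refine pow_length_primeFactorsList_le hm.pos.ne' fun q hq => ?_
    have hq2 := (Nat.prime_of_mem_primeFactorsList hq).two_le
    have hodd : Odd q := hm.of_dvd_nat (Nat.dvd_of_mem_primeFactorsList hq)
    obtain ⟨r, rfl⟩ := hodd
    lia
  exact Nat.lt_succ_iff.mp ((Nat.pow_lt_pow_iff_right (by norm_num)).mp (h3.trans_lt h))

theorem le_length_primeFactorsList_of_prime_pow_dvd {m p k : ℕ} (hp : p.Prime) (hm : m ≠ 0)
    (h : p ^ k ∣ m) : k ≤ m.primeFactorsList.length := by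
  have hl := (Nat.primeFactorsList_sublist_of_dvd h hm).length_le
  rwa [hp.primeFactorsList_pow, List.length_replicate] at hl

theorem two_pow_add_two_le_three_pow {k : ℕ} (hk : 0 < k) : 2 ^ (k + 2) ≤ 3 ^ (k + 1) := by
  induction k, hk using Nat.le_induction with
  | base => norm_num
  | succ k _ ih =>
    rw [pow_succ 2 (k + 2), pow_succ 3 (k + 1)]
    lia

/-- Among more than `2 ^ (k + 1)` labels two are congruent modulo `2 ^ (k + 1)`. -/
theorem le_two_pow_of_isPrimeProductGraph_top {n k : ℕ}
    (h : IsPrimeProductGraph (⊤ : SimpleGraph (Fin n)) k) : n ≤ 2 ^ (k + 1) := by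
  obtain ⟨L, hinj, -, hL⟩ := h
  by_contra! hlt
  obtain ⟨u, v, huv, heq⟩ := Fintype.exists_ne_map_eq_of_card_lt
    (fun i : Fin n => ((L i : ℤ) : ZMod (2 ^ (k + 1)))) (by simpa [ZMod.card] using hlt)
  have hdvd : ((2 ^ (k + 1) : ℕ) : ℤ) ∣ L u - L v := by
    rw [← ZMod.intCast_zmod_eq_zero_iff_dvd, Int.cast_sub, sub_eq_zero]
    exact heq
  have hne : (L u - L v).natAbs ≠ 0 := by
    rw [Int.natAbs_ne_zero, sub_ne_zero]
    exact hinj.ne huv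
  have hle := le_length_primeFactorsList_of_prime_pow_dvd Nat.prime_two hne
    (Int.natCast_dvd.mp hdvd)
  have := hL u v huv
  lia

/-- The labels `0, 2, …, 2 ^ (k + 1) - 2` followed by their translates by `2 ^ (k + 1) + 1`:
even differences are less than `2 ^ (k + 1)`, odd ones lie strictly between `1` and
`3 ^ (k + 1)`. -/
theorem isPrimeProductGraph_top_of_le_two_pow {n k : ℕ} (hk : 0 < k) (hn : n ≤ 2 ^ (k + 1)) :
    IsPrimeProductGraph (⊤ : SimpleGraph (Fin n)) k := by
  have h3 := two_pow_add_two_le_three_pow hk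
  have e1 : 2 ^ (k + 1) = 2 * 2 ^ k := by ring
  have e2 : 2 ^ (k + 2) = 4 * 2 ^ k := by ring
  let L : Fin n → ℤ := fun i => if i.val < 2 ^ k then 2 * (i.val : ℤ) else 2 * (i.val : ℤ) + 1
  have hgap : ∀ u v : Fin n, u ≠ v → 1 < |L u - L v| := by
    intro u v huv
    have huv' : u.val ≠ v.val := Fin.val_ne_of_ne huv
    rw [lt_abs]
    simp only [L]
    split_ifs <;> lia
  refine ⟨L, fun u v huv => ?_, hgap, fun u v huv => ?_⟩
  · by_contra hne
    have := hgap u v hne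
    simp [huv] at this
  · have huv' : u.val ≠ v.val := Fin.val_ne_of_ne huv
    have hu := u.isLt
    have hv := v.isLt
    by_cases hclass : u.val < 2 ^ k ↔ v.val < 2 ^ k
    · refine length_primeFactorsList_le_of_lt_two_pow ?_ ?_ <;>
        simp only [L] <;> split_ifs <;> lia
    · refine length_primeFactorsList_le_of_odd_of_lt_three_pow ?_ ?_
      · rw [Nat.odd_iff]
        simp only [L]
        split_ifs <;> lia
      · simp only [L]
        split_ifs <;> lia

/-- For `n ≥ 3`, the prime product number of the complete graph `K_n` is
`⌈log₂ n⌉ - 1`. -/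
theorem ppn_completeGraph (n : ℕ) (hn : 3 ≤ n) :
    ppn (⊤ : SimpleGraph (Fin n)) = Nat.clog 2 n - 1 := by
  have hset : {k : ℕ | 0 < k ∧ IsPrimeProductGraph (⊤ : SimpleGraph (Fin n)) k} =
      Set.Ici (Nat.clog 2 n - 1) := by
    have hclog : 1 < Nat.clog 2 n := (Nat.lt_clog_iff_pow_lt (by norm_num)).mpr (by lia)
    ext k
    have hiff : n ≤ 2 ^ (k + 1) ↔ Nat.clog 2 n ≤ k + 1 :=
      (Nat.clog_le_iff_le_pow (by norm_num)).symm
    rw [Set.mem_ofPred_eq, Set.mem_Ici]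
    constructor
    · rintro ⟨-, h⟩
      have := hiff.mp (le_two_pow_of_isPrimeProductGraph_top h)
      lia
    · intro h
      have hk : 0 < k := by lia
      exact ⟨hk, isPrimeProductGraph_top_of_le_two_pow hk (hiff.mpr (by lia))⟩
  rw [ppn, hset, csInf_Ici]
end

section
/- The prime product number of the complete 3-partite graph K_{1,2,2} equals 1. -/
/-- The complete 3-partite graph `K_{a,b,c}`. -/
def K3p (a b c : ℕ) : SimpleGraph ((i : Fin 3) × (![Fin a, Fin b, Fin c] i)) :=
  SimpleGraph.completeMultipartiteGraph ![Fin a, Fin b, Fin c]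

/-- The labeling of `K_{1,2,2}` with parts `{0}`, `{2, -2}` and `{5, -5}`. -/
def labelK122 : ((i : Fin 3) × (![Fin 1, Fin 2, Fin 2] i)) → ℤ
  | ⟨0, _⟩ => 0
  | ⟨1, x⟩ => ![2, -2] (show Fin 2 from x)
  | ⟨2, x⟩ => ![5, -5] (show Fin 2 from x)

theorem forall_K122_vertex {P : ((i : Fin 3) × (![Fin 1, Fin 2, Fin 2] i)) → Prop}
    (h0 : P ⟨0, (0 : Fin 1)⟩)
    (h1 : ∀ x : Fin 2, P ⟨1, x⟩) (h2 : ∀ x : Fin 2, P ⟨2, x⟩) : ∀ v, P v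
  | ⟨0, x⟩ => by
    have hx : x = (0 : Fin 1) := Subsingleton.elim (α := Fin 1) x 0
    rw [hx]
    exact h0
  | ⟨1, x⟩ => h1 x
  | ⟨2, x⟩ => h2 x

theorem one_lt_abs_labelK122_sub (u v : (i : Fin 3) × (![Fin 1, Fin 2, Fin 2] i))
    (huv : u ≠ v) : 1 < |labelK122 u - labelK122 v| := by
  revert u v
  refine forall_K122_vertex ?_ (fun x => ?_) (fun x => ?_) <;>
    refine forall_K122_vertex ?_ (fun y => ?_) (fun y => ?_) <;>
    intro h <;> try fin_cases x
  all_goals try fin_cases y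
  all_goals first
    | exact absurd rfl h
    | decide

theorem prime_labelK122_sub (u v : (i : Fin 3) × (![Fin 1, Fin 2, Fin 2] i))
    (huv : u.1 ≠ v.1) : (labelK122 u - labelK122 v).natAbs.Prime := by
  revert u v
  refine forall_K122_vertex ?_ (fun x => ?_) (fun x => ?_) <;>
    refine forall_K122_vertex ?_ (fun y => ?_) (fun y => ?_) <;>
    intro h <;> try fin_cases x
  all_goals try fin_cases y
  all_goals first
    | exact absurd rfl h
    | simp [labelK122]; try norm_num

theorem isPrimeProductLabeling_labelK122 :
    IsPrimeProductLabeling (K3p 1 2 2) 1 labelK122 := by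
  refine ⟨fun u v huv => ?_, one_lt_abs_labelK122_sub, fun u v huv => ?_⟩
  · by_contra hne
    have h := one_lt_abs_labelK122_sub u v hne
    simp [huv] at h
  · simp [Nat.primeFactorsList_prime (prime_labelK122_sub u v huv)]

/-- `ppn (K_{1,2,2}) = 1`. -/
theorem ppn_K122 : ppn (K3p 1 2 2) = 1 := by
  have hmem : 1 ∈ {k : ℕ | 0 < k ∧ IsPrimeProductGraph (K3p 1 2 2) k} :=
    ⟨one_pos, labelK122, isPrimeProductLabeling_labelK122⟩
  exact le_antisymm (Nat.sInf_le hmem) (Nat.sInf_mem ⟨1, hmem⟩).1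
end

section
/- For positive integers a ≤ b ≤ c, if it is not the case that a = b = 1 and it is not the case that (a, b, c) = (1, 2, 2), then the prime product number of the complete 3-partite graph K_{a,b,c} equals 2. -/
/-- Divisibility constraints by 2 and 3 satisfied by an integer of prime absolute value. -/
def PrimeLike (x : ℤ) : Prop :=
  (x % 2 = 0 → x = 2 ∨ x = -2) ∧ (x % 3 = 0 → x = 3 ∨ x = -3) ∧ x ≠ 1 ∧ x ≠ -1

lemma primeLike_of_prime {x : ℤ} (h : x.natAbs.Prime) : PrimeLike x := by
  refine ⟨fun h2 => ?_, fun h3 => ?_, ?_, ?_⟩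
  · have : 2 ∣ x.natAbs := by omega
    rw [Nat.prime_dvd_prime_iff_eq Nat.prime_two h] at this
    omega
  · have : 3 ∣ x.natAbs := by omega
    rw [Nat.prime_dvd_prime_iff_eq Nat.prime_three h] at this
    omega
  · rintro rfl; exact absurd h (by norm_num)
  · rintro rfl; exact absurd h (by norm_num)

lemma not_primeLike_five {d : ℤ} (h0 : PrimeLike d) (h1 : PrimeLike (d + 2))
    (h2 : PrimeLike (d - 2)) (h3 : PrimeLike (d + 4)) (h4 : PrimeLike (d - 4)) : False := by
  unfold PrimeLike at *
  rcases (by omega : d % 3 = 0 ∨ d % 3 = 1 ∨ d % 3 = 2) with h | h | h <;> omega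

lemma eq_five_of_primeLike_three {d : ℤ} (h0 : PrimeLike d)
    (h1 : PrimeLike (d + 2)) (h2 : PrimeLike (d - 2)) : d = 5 ∨ d = -5 := by
  obtain ⟨-, a0, b0, c0⟩ := h0
  obtain ⟨-, a1, b1, c1⟩ := h1
  obtain ⟨-, a2, b2, c2⟩ := h2
  rcases (by omega : d % 3 = 0 ∨ d % 3 = 1 ∨ d % 3 = 2) with h | h | h
  · have := a0 h
    omega
  · have := a1 (by omega)
    omega
  · have := a2 (by omega)
    omega

lemma PrimeLike.neg {x : ℤ} (h : PrimeLike x) : PrimeLike (-x) := by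
  unfold PrimeLike at *
  omega

lemma primeLike_comm {x y : ℤ} : PrimeLike (x - y) ↔ PrimeLike (y - x) :=
  ⟨fun h => by simpa using h.neg, fun h => by simpa using h.neg⟩

lemma PrimeLike.even {x : ℤ} (h : PrimeLike x) (h2 : x % 2 = 0) : x = 2 ∨ x = -2 := h.1 h2

/-- Two distinct integers at distance 2 from two distinct integers cannot exist. -/
lemma square_false {a b x y : ℤ} (hab : a ≠ b) (hxy : x ≠ y)
    (h1 : PrimeLike (a - x)) (h2 : PrimeLike (a - y)) (h3 : PrimeLike (b - x))
    (h4 : PrimeLike (b - y)) (p1 : (a - b) % 2 = 0) (p2 : (a - x) % 2 = 0)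
    (p3 : (a - y) % 2 = 0) : False := by
  have := h1.even (by omega)
  have := h2.even (by omega)
  have := h3.even (by omega)
  have := h4.even (by omega)
  omega

lemma triangle_parity {a b c : ℤ} (h1 : PrimeLike (a - b)) (h2 : PrimeLike (a - c))
    (h3 : PrimeLike (b - c)) (p1 : (a - b) % 2 = 0) (p2 : (a - c) % 2 = 0) : False := by
  have := h1.even (by omega)
  have := h2.even (by omega)
  have := h3.even (by omega)
  omega

/-- Two points at distance 2 from `r` and two points at distance 2 from `s` cannot be
joined completely. -/
lemma mixed_false {r s p p' q q' : ℤ} (hp : p ≠ p') (hq : q ≠ q')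
    (h1 : PrimeLike (r - p)) (h2 : PrimeLike (r - p'))
    (h3 : PrimeLike (s - q)) (h4 : PrimeLike (s - q'))
    (p1 : (r - p) % 2 = 0) (p2 : (r - p') % 2 = 0) (p3 : (s - q) % 2 = 0)
    (p4 : (s - q') % 2 = 0)
    (a2 : PrimeLike (r - q)) (a3 : PrimeLike (r - q'))
    (c1 : PrimeLike (p - q)) (c2 : PrimeLike (p - q'))
    (c3 : PrimeLike (p' - q)) (c4 : PrimeLike (p' - q')) : False := by
  have e1 := h1.even p1
  have e2 := h2.even p2
  have e3 := h3.even p3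
  have e4 := h4.even p4
  have key : ∀ P P' Q Q' : ℤ, P = r + 2 → P' = r - 2 → Q = s + 2 → Q' = s - 2 →
      PrimeLike (r - Q) → PrimeLike (r - Q') → PrimeLike (P - Q) → PrimeLike (P - Q') →
      PrimeLike (P' - Q) → False := by
    rintro P P' Q Q' rfl rfl rfl rfl f1 f2 f3 f4 f5
    refine not_primeLike_five (d := r - s) ?_ ?_ ?_ ?_ ?_
    · convert f3 using 1; ring
    · convert f2 using 1; ring
    · convert f1 using 1; ring
    · convert f4 using 1; ring
    · convert f5 using 1; ring
  rcases (by omega : (p = r + 2 ∧ p' = r - 2) ∨ (p = r - 2 ∧ p' = r + 2)) with ⟨u, u'⟩ | ⟨u, u'⟩ <;>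
  rcases (by omega : (q = s + 2 ∧ q' = s - 2) ∨ (q = s - 2 ∧ q' = s + 2)) with ⟨v, v'⟩ | ⟨v, v'⟩
  · exact key p p' q q' u u' v v' a2 a3 c1 c2 c3
  · exact key p p' q' q u u' v' v a3 a2 c2 c1 c4
  · exact key p' p q q' u' u v v' a2 a3 c3 c4 c1
  · exact key p' p q' q u' u v' v a3 a2 c4 c3 c2

/-- `K_{2,2,2}` has no labeling with prime differences. -/
lemma not_K222_aux {r r' p p' q q' : ℤ} (hr : r ≠ r') (hp : p ≠ p') (hq : q ≠ q')
    (rp : PrimeLike (r - p)) (rp' : PrimeLike (r - p')) (r'p : PrimeLike (r' - p))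
    (r'p' : PrimeLike (r' - p'))
    (rq : PrimeLike (r - q)) (rq' : PrimeLike (r - q')) (r'q : PrimeLike (r' - q))
    (r'q' : PrimeLike (r' - q'))
    (pq : PrimeLike (p - q)) (pq' : PrimeLike (p - q')) (p'q : PrimeLike (p' - q))
    (p'q' : PrimeLike (p' - q')) (hpp : (p - p') % 2 = 0) (hqq : (q - q') % 2 = 0)
    (hpq : (p - q) % 2 ≠ 0) : False := by
  rcases Int.emod_two_eq (r - p) with h | h <;> rcases Int.emod_two_eq (r' - p) with h' | h'
  · exact square_false hr hp rp rp' r'p r'p' (by omega) (by omega) (by omega)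
  · exact mixed_false hp hq rp rp' r'q r'q' (by omega) (by omega) (by omega) (by omega)
      rq rq' pq pq' p'q p'q'
  · exact mixed_false hp hq r'p r'p' rq rq' (by omega) (by omega) (by omega) (by omega)
      r'q r'q' pq pq' p'q p'q'
  · exact square_false hr hq rq rq' r'q r'q' (by omega) (by omega) (by omega)

lemma not_K222 {r r' p p' q q' : ℤ} (hr : r ≠ r') (hp : p ≠ p') (hq : q ≠ q')
    (rp : PrimeLike (r - p)) (rp' : PrimeLike (r - p')) (r'p : PrimeLike (r' - p))
    (r'p' : PrimeLike (r' - p'))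
    (rq : PrimeLike (r - q)) (rq' : PrimeLike (r - q')) (r'q : PrimeLike (r' - q))
    (r'q' : PrimeLike (r' - q'))
    (pq : PrimeLike (p - q)) (pq' : PrimeLike (p - q')) (p'q : PrimeLike (p' - q))
    (p'q' : PrimeLike (p' - q')) : False := by
  have T := fun {x y z : ℤ} => @triangle_parity x y z
  by_cases hR : (r - r') % 2 = 0
  · by_cases hP : (p - p') % 2 = 0
    · by_cases hrp : (r - p) % 2 = 0
      · exact square_false hr hp rp rp' r'p r'p' (by omega) (by omega) (by omega)
      · exact not_K222_aux (r := q) (r' := q') (p := r) (p' := r') (q := p) (q' := p')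
          hq hr hp (primeLike_comm.1 rq) (primeLike_comm.1 r'q) (primeLike_comm.1 rq')
          (primeLike_comm.1 r'q') (primeLike_comm.1 pq) (primeLike_comm.1 p'q)
          (primeLike_comm.1 pq') (primeLike_comm.1 p'q') rp rp' r'p r'p' hR hP hrp
    · by_cases hQ : (q - q') % 2 = 0
      · by_cases hrq : (r - q) % 2 = 0
        · exact square_false hr hq rq rq' r'q r'q' (by omega) (by omega) (by omega)
        · exact not_K222_aux (r := p) (r' := p') (p := r) (p' := r') (q := q) (q' := q')
            hp hr hq (primeLike_comm.1 rp) (primeLike_comm.1 r'p) (primeLike_comm.1 rp')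
            (primeLike_comm.1 r'p') pq pq' p'q p'q' rq rq' r'q r'q' hR hQ hrq
      · rcases Int.emod_two_eq (r - p) with h | h <;>
        rcases Int.emod_two_eq (r - q) with h' | h'
        · exact T rp rq pq (by omega) (by omega)
        · exact T rp rq' pq' (by omega) (by omega)
        · exact T rp' rq p'q (by omega) (by omega)
        · exact T rp' rq' p'q' (by omega) (by omega)
  · by_cases hP : (p - p') % 2 = 0
    · by_cases hQ : (q - q') % 2 = 0
      · by_cases hpq : (p - q) % 2 = 0
        · exact square_false hp hq pq pq' p'q p'q' (by omega) (by omega) (by omega)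
        · exact not_K222_aux hr hp hq rp rp' r'p r'p' rq rq' r'q r'q' pq pq' p'q p'q' hP hQ hpq
      · rcases Int.emod_two_eq (r - p) with h | h <;>
        rcases Int.emod_two_eq (p - q) with h' | h'
        · exact T rp rq pq (by omega) (by omega)
        · exact T rp rq' pq' (by omega) (by omega)
        · exact T r'p r'q pq (by omega) (by omega)
        · exact T r'p r'q' pq' (by omega) (by omega)
    · rcases Int.emod_two_eq (r - q) with h | h <;>
      rcases Int.emod_two_eq (p - q) with h' | h'
      · exact T rp rq pq (by omega) (by omega)
      · exact T rp' rq p'q (by omega) (by omega)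
      · exact T r'p r'q pq (by omega) (by omega)
      · exact T r'p' r'q p'q (by omega) (by omega)

/-- `K_{1,2,3}` has no labeling with prime differences. -/
lemma not_K123 {a p p' : ℤ} {q : Fin 3 → ℤ} (hp : p ≠ p') (hq : Function.Injective q)
    (ap : PrimeLike (a - p)) (ap' : PrimeLike (a - p')) (aq : ∀ i, PrimeLike (a - q i))
    (pq : ∀ i, PrimeLike (p - q i)) (p'q : ∀ i, PrimeLike (p' - q i)) : False := by
  have T := fun {x y z : ℤ} => @triangle_parity x y z
  have q01 : q 0 ≠ q 1 := hq.ne (by decide)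
  have q02 : q 0 ≠ q 2 := hq.ne (by decide)
  have q12 : q 1 ≠ q 2 := hq.ne (by decide)
  by_cases hpp : (p - p') % 2 = 0
  · by_cases hap : (a - p) % 2 = 0
    · -- all `q i` have the opposite parity
      have hodd : ∀ i, (a - q i) % 2 ≠ 0 := fun i h => T ap (aq i) (pq i) hap h
      have e1 := ap.even hap
      have e2 := ap'.even (by omega)
      have h5 : ∀ i, q i = a + 5 ∨ q i = a - 5 := by
        intro i
        have key : ∀ P P', P = a + 2 → P' = a - 2 → PrimeLike (P - q i) →
            PrimeLike (P' - q i) → q i = a + 5 ∨ q i = a - 5 := by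
          rintro P P' rfl rfl h1 h2
          have := eq_five_of_primeLike_three (aq i) (by convert h1 using 1; ring)
            (by convert h2 using 1; ring)
          omega
        rcases (by omega : (p = a + 2 ∧ p' = a - 2) ∨ (p = a - 2 ∧ p' = a + 2)) with
          ⟨u, u'⟩ | ⟨u, u'⟩
        · exact key p p' u u' (pq i) (p'q i)
        · exact key p' p u' u (p'q i) (pq i)
      have := h5 0
      have := h5 1
      have := h5 2
      omega
    · have two : ∀ i j, i ≠ j → (p - q i) % 2 = 0 → (p - q j) % 2 = 0 → False := by
        intro i j hij hi hj
        exact square_false hp (hq.ne hij) (pq i) (pq j) (p'q i) (p'q j) hpp hi hj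
      -- a pair `q i, q j` with the parity of `a`
      have pair : ∀ i j k, i ≠ j → (a - q i) % 2 = 0 → (a - q j) % 2 = 0 →
          (a - q k) % 2 ≠ 0 → False := by
        intro i j k hij hi hj hk
        exact mixed_false (hq.ne hij) hp (aq i) (aq j) (primeLike_comm.1 (pq k))
          (primeLike_comm.1 (p'q k)) hi hj (by omega) (by omega) ap ap'
          (primeLike_comm.1 (pq i)) (primeLike_comm.1 (p'q i)) (primeLike_comm.1 (pq j))
          (primeLike_comm.1 (p'q j))
      have e0 := (aq 0).even
      have e1 := (aq 1).even
      have e2 := (aq 2).even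
      rcases Int.emod_two_eq (a - q 0) with h | h <;> rcases Int.emod_two_eq (a - q 1) with h' | h' <;>
      rcases Int.emod_two_eq (a - q 2) with h'' | h''
      · have := e0 h
        have := e1 h'
        have := e2 h''
        omega
      · exact pair 0 1 2 (by decide) h h' (by omega)
      · exact pair 0 2 1 (by decide) h h'' (by omega)
      · exact two 1 2 (by decide) (by omega) (by omega)
      · exact pair 1 2 0 (by decide) h' h'' (by omega)
      · exact two 0 2 (by decide) (by omega) (by omega)
      · exact two 0 1 (by decide) (by omega) (by omega)
      · exact two 0 1 (by decide) (by omega) (by omega)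
  · -- all `q i` have the parity opposite to `a`
    have hodd : ∀ i, (a - q i) % 2 ≠ 0 := by
      intro i h
      rcases Int.emod_two_eq (a - p) with h' | h'
      · exact T ap (aq i) (pq i) h' h
      · exact T ap' (aq i) (p'q i) (by omega) h
    have main : ∀ x, (x - a) % 2 ≠ 0 → (∀ i, PrimeLike (x - q i)) → False := by
      intro x hx hxq
      have := (hxq 0).even (by have := hodd 0; omega)
      have := (hxq 1).even (by have := hodd 1; omega)
      have := (hxq 2).even (by have := hodd 2; omega)
      omega
    by_cases hap : (p - a) % 2 = 0
    · exact main p' (by omega) p'q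
    · exact main p hap pq

lemma primeLike_of_label {V : Type*} {G : SimpleGraph V} {L : V → ℤ}
    (hL : IsPrimeProductLabeling G 1 L) {u v : V} (huv : G.Adj u v) : PrimeLike (L u - L v) := by
  apply primeLike_of_prime
  have h1 := hL.2.2 u v huv
  have h2 := hL.2.1 u v huv.ne
  have h3 : 1 < (L u - L v).natAbs := by rw [Int.abs_eq_natAbs] at h2; exact_mod_cast h2
  set n := (L u - L v).natAbs with hn
  obtain ⟨p, hp⟩ : ∃ p, n.primeFactorsList = [p] := by
    match hl : n.primeFactorsList with
    | [] =>
      rw [Nat.primeFactorsList_eq_nil] at hl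
      omega
    | [p] => exact ⟨p, rfl⟩
    | p :: q :: l => simp [hl] at h1
  have h4 : n.primeFactorsList.prod = n := Nat.prod_primeFactorsList (by omega)
  have h5 : p.Prime := Nat.prime_of_mem_primeFactorsList (n := n) (by simp [hp])
  rw [hp] at h4
  simpa [← h4] using h5

lemma not_isPrimeProductGraph_one (a b c : ℕ) (ha : 0 < a) (hab : a ≤ b) (hbc : b ≤ c)
    (h1 : ¬(a = 1 ∧ b = 1)) (h2 : ¬(a = 1 ∧ b = 2 ∧ c = 2)) :
    ¬ IsPrimeProductGraph (K3p a b c) 1 := by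
  rintro ⟨L, hL⟩
  let A : Fin a → ℤ := fun i => L ⟨0, i⟩
  let B : Fin b → ℤ := fun i => L ⟨1, i⟩
  let C : Fin c → ℤ := fun i => L ⟨2, i⟩
  have hA : Function.Injective A := fun i j h => eq_of_heq (Sigma.mk.inj (hL.1 h)).2
  have hB : Function.Injective B := fun i j h => eq_of_heq (Sigma.mk.inj (hL.1 h)).2
  have hC : Function.Injective C := fun i j h => eq_of_heq (Sigma.mk.inj (hL.1 h)).2
  have hAB : ∀ i j, PrimeLike (A i - B j) := fun i j =>
    primeLike_of_label hL (by simp [K3p])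
  have hAC : ∀ i j, PrimeLike (A i - C j) := fun i j =>
    primeLike_of_label hL (by simp [K3p])
  have hBC : ∀ i j, PrimeLike (B i - C j) := fun i j =>
    primeLike_of_label hL (by simp [K3p])
  have hb : 1 < b := by omega
  have B01 : B ⟨0, by omega⟩ ≠ B ⟨1, hb⟩ := hB.ne (by simp)
  by_cases hA2 : 1 < a
  · have A01 : A ⟨0, ha⟩ ≠ A ⟨1, hA2⟩ := hA.ne (by simp)
    have C01 : C ⟨0, by omega⟩ ≠ C ⟨1, by omega⟩ := hC.ne (by simp)
    exact not_K222 A01 B01 C01 (hAB _ _) (hAB _ _) (hAB _ _) (hAB _ _) (hAC _ _) (hAC _ _)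
      (hAC _ _) (hAC _ _) (hBC _ _) (hBC _ _) (hBC _ _) (hBC _ _)
  · have hc : 3 ≤ c := by omega
    exact not_K123 (q := C ∘ Fin.castLE hc) B01 (hC.comp (Fin.castLE_injective hc))
      (hAB ⟨0, ha⟩ _) (hAB _ _) (fun i => hAC _ _) (fun i => hBC _ _) (fun i => hBC _ _)

open Finset in
/-- Kővári–Sós–Turán counting: a dense bipartite relation has `t` distinct points on the left
with many common neighbours. -/
lemma exists_injective_many_common {X V : Type*} [Fintype X] [Fintype V]
    (F : X → V → Prop) [∀ x v, Decidable (F x v)] {t : ℕ} (ht : 0 < t) {α : ℝ} (hα : 0 < α)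
    (hX : 0 < Fintype.card X) (hV : 0 < Fintype.card V)
    (hF : α * Fintype.card X * Fintype.card V ≤ #{p : X × V | F p.1 p.2})
    (hn : 2 * (t : ℝ) ^ 2 < α ^ t * Fintype.card X) :
    ∃ x : Fin t → X, Function.Injective x ∧
      α ^ t / 2 * Fintype.card V ≤ #{v : V | ∀ i, F (x i) v} := by
  classical
  by_contra! hcon
  set n : ℝ := (Fintype.card X : ℝ) with hn_def
  set m : ℝ := (Fintype.card V : ℝ) with hm_def
  have hn0 : 0 < n := Nat.cast_pos.2 hX
  have hm0 : 0 < m := Nat.cast_pos.2 hV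
  let N : (Fin t → X) → ℝ := fun x => #{v : V | ∀ i, F (x i) v}
  let d : V → ℝ := fun v => #{x : X | F x v}
  have hsum : ∑ v, d v ^ t = ∑ x, N x := by
    have h1 : ∀ v, d v ^ t = ∑ x : Fin t → X, if ∀ i, F (x i) v then (1 : ℝ) else 0 := by
      intro v
      have : #{x : Fin t → X | ∀ i, F (x i) v} = #{x : X | F x v} ^ t := by
        have := Fintype.card_piFinset_const ({x : X | F x v} : Finset X) t
        rw [← this]
        congr 1
        ext x
        simp
      rw [Finset.sum_ite, Finset.sum_const_zero, add_zero, Finset.sum_const, nsmul_one, this]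
      simp [d]
    have h2 : ∀ x, N x = ∑ v : V, if ∀ i, F (x i) v then (1 : ℝ) else 0 := by
      intro x
      simp [N]
    simp_rw [h1, h2]
    exact Finset.sum_comm
  have hdsum : ∑ v, d v = #{p : X × V | F p.1 p.2} := by
    rw [Finset.card_filter, Nat.cast_sum, Fintype.sum_prod_type_right]
    simp [d]
  have hlow : n ^ t * α ^ t * m ≤ ∑ v, d v ^ t := by
    obtain ⟨k, rfl⟩ : ∃ k, t = k + 1 := ⟨t - 1, by omega⟩
    have h := pow_sum_div_card_le_sum_pow (s := univ) (f := d) (fun v _ => by positivity) k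
    refine le_trans ?_ h
    rw [hdsum, Finset.card_univ, ← hm_def, le_div_iff₀ (by positivity)]
    calc n ^ (k + 1) * α ^ (k + 1) * m * m ^ k = (α * n * m) ^ (k + 1) := by ring
      _ ≤ _ := by gcongr
  have hcount : (#{x : Fin t → X | ¬ Function.Injective x} : ℝ) ≤ t ^ 2 * n ^ t / n := by
    rw [le_div_iff₀ hn0]
    have htot : #{x : Fin t → X | Function.Injective x} + #{x : Fin t → X | ¬ Function.Injective x}
        = Fintype.card X ^ t := by
      rw [Finset.card_filter_add_card_filter_not, Finset.card_univ, Fintype.card_fun,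
        Fintype.card_fin]
    have hinj : #{x : Fin t → X | Function.Injective x} = (Fintype.card X).descFactorial t := by
      rw [← Fintype.card_subtype]
      rw [Fintype.card_congr (Equiv.subtypeInjectiveEquivEmbedding (Fin t) X),
        Fintype.card_embedding_eq, Fintype.card_fin]
    have htot' : (#{x : Fin t → X | Function.Injective x} : ℝ) +
        #{x : Fin t → X | ¬ Function.Injective x} = n ^ t := by
      rw [hn_def]
      exact_mod_cast htot
    have hpos : (0 : ℝ) ≤ #{x : Fin t → X | Function.Injective x} := by positivity
    rcases le_total n (t ^ 2) with hnt | hnt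
    · have : (#{x : Fin t → X | ¬ Function.Injective x} : ℝ) ≤ n ^ t := by linarith
      rw [mul_comm]
      gcongr
    · have ht1 : (1 : ℝ) ≤ t := by exact_mod_cast ht
      have hnt' : (t : ℝ) ≤ n := le_trans (by nlinarith) hnt
      have hle : t ≤ Fintype.card X := by rw [hn_def] at hnt'; exact_mod_cast hnt'
      have h1 : (n + 1 - t) ^ t ≤ (#{x : Fin t → X | Function.Injective x} : ℝ) := by
        rw [hinj]
        have := Nat.pow_sub_le_descFactorial (Fintype.card X) t
        have h2 : (((Fintype.card X + 1 - t : ℕ) : ℝ)) = n + 1 - t := by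
          rw [Nat.cast_sub (by omega)]
          push_cast
          rfl
        rw [← h2]
        exact_mod_cast this
      have h2 := one_add_mul_le_pow (a := (1 - t) / n) (by
        rw [le_div_iff₀ hn0]
        linarith) t
      have h3 : (n + 1 - t) ^ t = n ^ t * (1 + (1 - t) / n) ^ t := by
        rw [← mul_pow]
        congr 1
        field_simp
        ring
      have h4 : n ^ t * (1 + t * ((1 - t) / n)) ≤ (n + 1 - t) ^ t := by
        rw [h3]
        gcongr
      have h5 : n ^ t * (1 + t * ((1 - t) / n)) * n = n ^ t * n - n ^ t * (t * (t - 1)) := by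
        field_simp
        ring
      have h6 : (#{x : Fin t → X | ¬ Function.Injective x} : ℝ) * n ≤
          n ^ t * n - n ^ t * (1 + t * ((1 - t) / n)) * n := by
        rw [← sub_mul]
        gcongr
        linarith
      have h7 : 0 ≤ n ^ t * t := by positivity
      nlinarith
  have hup : ∑ x, N x ≤ n ^ t * (α ^ t / 2 * m) + t ^ 2 * n ^ t / n * m := by
    rw [← Finset.sum_filter_add_sum_filter_not univ (fun x : Fin t → X => Function.Injective x)]
    apply add_le_add
    · calc ∑ x : Fin t → X with Function.Injective x, N x
          ≤ ∑ x : Fin t → X with Function.Injective x, α ^ t / 2 * m :=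
            Finset.sum_le_sum fun x hx => (hcon x (by simpa using hx)).le
        _ ≤ ∑ x : Fin t → X, α ^ t / 2 * m := Finset.sum_le_sum_of_subset_of_nonneg
            (Finset.filter_subset _ _) fun _ _ _ => by positivity
        _ = n ^ t * (α ^ t / 2 * m) := by simp [hn_def]
    · calc ∑ x : Fin t → X with ¬ Function.Injective x, N x
          ≤ ∑ x : Fin t → X with ¬ Function.Injective x, m := Finset.sum_le_sum fun x _ => by
            simp only [N, hm_def]
            exact_mod_cast Finset.card_le_univ _
        _ = #{x : Fin t → X | ¬ Function.Injective x} * m := by simp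
        _ ≤ _ := by gcongr
  have : n ^ t * α ^ t * m ≤ n ^ t * (α ^ t / 2 * m) + t ^ 2 * n ^ t / n * m := by linarith
  have h3 : n ^ t * (α ^ t / 2 * m) + t ^ 2 * n ^ t / n * m < n ^ t * α ^ t * m := by
    have : t ^ 2 * n ^ t / n * m = n ^ t * m * (t ^ 2 / n) := by ring
    rw [this]
    have h4 : (t : ℝ) ^ 2 / n < α ^ t / 2 := by
      rw [div_lt_div_iff₀ hn0 two_pos]
      linarith
    have h5 : n ^ t * m * (t ^ 2 / n) < n ^ t * m * (α ^ t / 2) := by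
      gcongr
    linarith
  linarith

open Finset in
/-- A dense tripartite 3-uniform hypergraph contains a complete tripartite sub-hypergraph. -/
lemma exists_complete_tripartite {X Y Z : Type*} [Fintype X] [Fintype Y] [Fintype Z]
    (R : X → Y → Z → Prop) [∀ x y z, Decidable (R x y z)] {t : ℕ} (ht : 0 < t) {α β γ : ℝ}
    (hα : 0 < α) (hβ : β = α ^ t / 2) (hγ : γ = β ^ t / 2)
    (hX : 2 * (t : ℝ) ^ 2 < α ^ t * Fintype.card X)
    (hY : 2 * (t : ℝ) ^ 2 < β ^ t * Fintype.card Y)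
    (hZ : (t : ℝ) ≤ γ * Fintype.card Z)
    (hR : α * Fintype.card X * Fintype.card (Y × Z) ≤ #{p : X × (Y × Z) | R p.1 p.2.1 p.2.2}) :
    ∃ (x : Fin t → X) (y : Fin t → Y) (z : Fin t → Z), Function.Injective x ∧
      Function.Injective y ∧ Function.Injective z ∧ ∀ i j k, R (x i) (y j) (z k) := by
  have ht0 : (0 : ℝ) < t := by exact_mod_cast ht
  have hβ0 : 0 < β := by rw [hβ]; positivity
  have hγ0 : 0 < γ := by rw [hγ]; positivity
  have hX0 : 0 < Fintype.card X := by
    by_contra! h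
    simp only [nonpos_iff_eq_zero.1 h, Nat.cast_zero, mul_zero] at hX
    nlinarith
  have hY0 : 0 < Fintype.card Y := by
    by_contra! h
    simp only [nonpos_iff_eq_zero.1 h, Nat.cast_zero, mul_zero] at hY
    nlinarith
  have hZ0 : 0 < Fintype.card Z := by
    by_contra! h
    simp only [nonpos_iff_eq_zero.1 h, Nat.cast_zero, mul_zero] at hZ
    linarith
  obtain ⟨x, hx, hxc⟩ := exists_injective_many_common (fun (x : X) (v : Y × Z) => R x v.1 v.2) ht hα
    hX0 (by rw [Fintype.card_prod]; positivity) hR hX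
  obtain ⟨y, hy, hyc⟩ := exists_injective_many_common (fun (y : Y) (z : Z) => ∀ i, R (x i) y z) ht
    hβ0 hY0 hZ0 (by rw [← hβ, Fintype.card_prod, Nat.cast_mul, ← mul_assoc] at hxc; exact hxc) hY
  rw [← hγ] at hyc
  have hcard : t ≤ #{z : Z | ∀ j i, R (x i) (y j) z} := by exact_mod_cast hZ.trans hyc
  obtain ⟨s, hs, hst⟩ := Finset.exists_subset_card_eq hcard
  refine ⟨x, y, fun k => (s.equivFinOfCardEq hst).symm k, hx, hy, ?_, fun i j k => ?_⟩
  · exact Subtype.val_injective.comp (Equiv.injective _)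
  · have := hs ((s.equivFinOfCardEq hst).symm k).2
    rw [Finset.mem_filter] at this
    exact this.2 j i

section Roth

open Finset SimpleGraph TripartiteFromTriangles
open Function hiding graph

variable {G : Type*} [AddCommGroup G] [DecidableEq G]

/-- Triangle indices `(a, b, a + b)` with `a + 2b` in `S`. -/
def apTriangles [Fintype G] (S : Finset G) : Finset (G × G × G) :=
  univ.filter fun p => p.2.2 = p.1 + p.2.1 ∧ p.1 + p.2.1 + p.2.1 ∈ S

lemma mem_apTriangles [Fintype G] {S : Finset G} {a b c : G} :
    (a, b, c) ∈ apTriangles S ↔ c = a + b ∧ a + b + b ∈ S := by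
  simp [apTriangles]

lemma card_apTriangles [Fintype G] (S : Finset G) :
    #(apTriangles S) = #S * Fintype.card G := by
  rw [← Finset.card_univ, ← Finset.card_product]
  refine Finset.card_bij' (fun p _ => (p.1 + p.2.1 + p.2.1, p.2.1))
    (fun q _ => (q.1 - q.2 - q.2, q.2, q.1 - q.2)) ?_ ?_ ?_ ?_
  · rintro ⟨a, b, c⟩ h
    rw [mem_apTriangles] at h
    simpa using h.2
  · rintro ⟨s, b⟩ h
    rw [mem_apTriangles]
    simpa using h
  · rintro ⟨a, b, c⟩ h
    rw [mem_apTriangles] at h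
    simp [h.1]
  · rintro ⟨s, b⟩ h
    simp

instance apTriangles_explicitDisjoint [Fintype G] (S : Finset G) :
    ExplicitDisjoint (apTriangles S) := by
  constructor <;> simp +contextual [mem_apTriangles]

/-- Varnavides' form of Roth's theorem for dense sets in a finite abelian group. -/
lemma roth_count_set [Fintype G] [Nonempty G] {ε : ℝ} (S : Finset G)
    (hS : ε * Fintype.card G ≤ #S) :
    27 * triangleRemovalBound (ε / 9) * (Fintype.card G : ℝ) ^ 2 ≤
      #{p : G × G | p.1 ∈ S ∧ p.1 + p.2 ∈ S ∧ p.1 + p.2 + p.2 ∈ S} := by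
  have hfar : (graph (apTriangles S)).FarFromTriangleFree (ε / 9) := by
    refine farFromTriangleFree _ ?_
    rw [card_apTriangles]
    push_cast
    have : (0 : ℝ) ≤ Fintype.card G := by positivity
    nlinarith
  have h1 := hfar.le_card_cliqueFinset
  have h2 : #((graph (apTriangles S)).cliqueFinset 3) ≤
      #{p : G × G | p.1 ∈ S ∧ p.1 + p.2 ∈ S ∧ p.1 + p.2 + p.2 ∈ S} * Fintype.card G := by
    have hsub : (graph (apTriangles S)).cliqueFinset 3 ⊆
        (univ.filter fun p : G × G × G => p.1 + p.2.1 + p.2.1 ∈ S ∧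
          p.2.2 + p.2.1 ∈ S ∧ p.2.2 + p.2.2 - p.1 ∈ S).map toTriangle := by
      intro s hs
      rw [mem_cliqueFinset_iff, is3Clique_iff] at hs
      obtain ⟨x, y, z, hxy, hxz, hyz, rfl⟩ := hs
      obtain ⟨a, b, c, habc, hab, hac, hbc⟩ := graph_triple hxy hxz hyz
      rw [Finset.mem_map]
      refine ⟨(a, b, c), ?_, habc⟩
      obtain ⟨c', hc'⟩ := Graph.in₀₁_iff.1 hab
      obtain ⟨b', hb'⟩ := Graph.in₀₂_iff.1 hac
      obtain ⟨a', ha'⟩ := Graph.in₁₂_iff.1 hbc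
      rw [mem_apTriangles] at hc' hb' ha'
      rw [Finset.mem_filter]
      refine ⟨mem_univ _, hc'.2, ?_, ?_⟩
      · rw [ha'.1]
        exact ha'.2
      · convert hb'.2 using 1
        dsimp only
        rw [hb'.1]
        abel
    refine (Finset.card_le_card hsub).trans ?_
    rw [Finset.card_map, ← Finset.card_univ, ← Finset.card_product]
    refine Finset.card_le_card_of_injOn
      (fun p => ((p.1 + p.2.1 + p.2.1, p.2.2 - p.1 - p.2.1), p.2.1)) ?_ ?_
    · rintro ⟨a, b, c⟩ h
      simp only [coe_filter, mem_univ, true_and, Set.mem_ofPred_eq] at h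
      simp only [coe_product, Set.mem_prod, coe_filter, mem_univ, true_and, Set.mem_ofPred_eq,
        coe_univ, Set.mem_univ, and_true]
      refine ⟨h.1, ?_, ?_⟩
      · convert h.2.1 using 1
        abel
      · convert h.2.2 using 1
        abel
    · rintro ⟨a, b, c⟩ _ ⟨a', b', c'⟩ _ h
      simp only [Prod.mk.injEq] at h
      obtain ⟨⟨h1, h2⟩, rfl⟩ := h
      have : a = a' := by simpa using h1
      subst this
      simp only [Prod.mk.injEq, true_and]
      simpa using h2
  have h3 : (0 : ℝ) < Fintype.card G := by exact_mod_cast Fintype.card_pos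
  refine le_of_mul_le_mul_right ?_ h3
  calc _ = triangleRemovalBound (ε / 9) * (Fintype.card (G ⊕ G ⊕ G) : ℝ) ^ 3 := by
        simp only [Fintype.card_sum]
        push_cast
        ring
    _ ≤ _ := h1
    _ ≤ _ := by exact_mod_cast h2

/-- Varnavides' form of Roth's theorem for bounded functions. -/
lemma roth_count {δ : ℝ} (hδ : 0 < δ) : ∃ c : ℝ, 0 < c ∧
    ∀ (G : Type) [AddCommGroup G] [Fintype G] (g : G → ℝ), (∀ x, 0 ≤ g x) → (∀ x, g x ≤ 2) →
      δ * Fintype.card G ≤ ∑ x, g x →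
      c * (Fintype.card G : ℝ) ^ 2 ≤ ∑ x, ∑ d, g x * g (x + d) * g (x + d + d) := by
  refine ⟨(δ / 2) ^ 3 * (27 * triangleRemovalBound (δ / 4 / 9)), ?_, ?_⟩
  · have := triangleRemovalBound_pos (ε := δ / 4 / 9) (by positivity)
    positivity
  intro G _ _ g hg0 hg2 hsum
  classical
  let S : Finset G := univ.filter fun x => δ / 2 ≤ g x
  have hS : δ / 4 * Fintype.card G ≤ #S := by
    have h1 : ∀ x, g x ≤ δ / 2 + 2 * (if x ∈ S then 1 else 0) := by
      intro x
      by_cases hx : x ∈ S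
      · simp only [hx, if_true]
        linarith [hg2 x]
      · simp only [hx, if_false]
        simp only [S, mem_filter, mem_univ, true_and, not_le] at hx
        linarith
    have h2 := Finset.sum_le_sum fun x (_ : x ∈ univ) => h1 x
    rw [Finset.sum_add_distrib, ← Finset.mul_sum] at h2
    simp only [sum_const, card_univ, nsmul_eq_mul, sum_ite_mem, univ_inter, mul_one] at h2
    linarith
  have h := roth_count_set S hS
  rw [mul_assoc]
  refine (mul_le_mul_of_nonneg_left h (by positivity)).trans ?_
  rw [← Fintype.sum_prod_type' (f := fun x d => g x * g (x + d) * g (x + d + d)),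
    Finset.card_filter, Nat.cast_sum, Finset.mul_sum]
  refine Finset.sum_le_sum ?_
  rintro ⟨x, d⟩ _
  have n1 := hg0 x
  have n2 := hg0 (x + d)
  have n3 := hg0 (x + d + d)
  by_cases hc : x ∈ S ∧ x + d ∈ S ∧ x + d + d ∈ S
  · simp only [hc, and_self, if_true, Nat.cast_one, mul_one]
    simp only [S, mem_filter, mem_univ, true_and] at hc
    calc (δ / 2) ^ 3 = δ / 2 * (δ / 2) * (δ / 2) := by ring
      _ ≤ g x * g (x + d) * g (x + d + d) := by
        gcongr
        · exact hc.1
        · exact hc.2.1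
        · exact hc.2.2
  · simp only [hc, if_false, Nat.cast_zero, mul_zero]
    positivity

end Roth

section Fourier

open Finset ZMod

variable {M : ℕ} [NeZero M]

/-- Normalised Fourier coefficient of a real function on `ZMod M`. -/
noncomputable def zfourier (f : ZMod M → ℝ) (ξ : ZMod M) : ℂ :=
  (∑ x, (f x : ℂ) * stdAddChar (ξ * x)) / M

lemma natCast_ne_zero_complex : (M : ℂ) ≠ 0 := Nat.cast_ne_zero.2 (NeZero.ne M)

lemma sum_stdAddChar_mul (x : ZMod M) :
    ∑ ξ, (stdAddChar (ξ * x) : ℂ) = if x = 0 then (M : ℂ) else 0 := by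
  rw [AddChar.sum_mulShift x (isPrimitive_stdAddChar M)]
  split_ifs <;> simp

lemma conj_stdAddChar (x : ZMod M) :
    (starRingEnd ℂ) (stdAddChar x : ℂ) = stdAddChar (-x) :=
  (AddChar.map_neg_eq_conj _ _).symm

lemma norm_stdAddChar (x : ZMod M) : ‖(stdAddChar x : ℂ)‖ = 1 := AddChar.norm_apply _ _

lemma conj_zfourier (f : ZMod M → ℝ) (ξ : ZMod M) :
    (starRingEnd ℂ) (zfourier f ξ) = (∑ x, (f x : ℂ) * stdAddChar (-(ξ * x))) / M := by
  simp [zfourier, conj_stdAddChar]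

lemma zfourier_zero (f : ZMod M → ℝ) : zfourier f 0 = (((∑ x, f x) / M : ℝ) : ℂ) := by
  simp [zfourier]

lemma norm_zfourier_le (f : ZMod M → ℝ) (hf : ∀ x, 0 ≤ f x) (ξ : ZMod M) :
    ‖zfourier f ξ‖ ≤ (∑ x, f x) / M := by
  rw [zfourier, norm_div, Complex.norm_natCast]
  gcongr
  refine (norm_sum_le _ _).trans (Finset.sum_le_sum fun x _ => ?_)
  rw [norm_mul, norm_stdAddChar, mul_one, Complex.norm_real, Real.norm_of_nonneg (hf x)]

/-- Parseval's identity. -/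
lemma sum_norm_sq_zfourier (f : ZMod M → ℝ) :
    ∑ ξ, ‖zfourier f ξ‖ ^ 2 = (∑ x, f x ^ 2) / M := by
  have hM : (M : ℂ) ≠ 0 := natCast_ne_zero_complex
  have h : ((∑ ξ, ‖zfourier f ξ‖ ^ 2 : ℝ) : ℂ) = (((∑ x, f x ^ 2) / M : ℝ) : ℂ) := by
    push_cast
    calc ∑ ξ, ((‖zfourier f ξ‖ : ℂ)) ^ 2
        = ∑ ξ, ∑ x, ∑ y, (f x : ℂ) * f y * stdAddChar (ξ * (x - y)) / M ^ 2 := by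
          refine Finset.sum_congr rfl fun ξ _ => ?_
          rw [← Complex.mul_conj', conj_zfourier, zfourier, div_mul_div_comm, Finset.sum_mul_sum,
            Finset.sum_div]
          refine Finset.sum_congr rfl fun x _ => ?_
          rw [Finset.sum_div]
          refine Finset.sum_congr rfl fun y _ => ?_
          rw [mul_sub, sub_eq_add_neg, AddChar.map_add_eq_mul]
          ring
      _ = ∑ x, ∑ y, (f x : ℂ) * f y / M ^ 2 * ∑ ξ, stdAddChar (ξ * (x - y)) := by
          rw [Finset.sum_comm]
          refine Finset.sum_congr rfl fun x _ => ?_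
          rw [Finset.sum_comm]
          refine Finset.sum_congr rfl fun y _ => ?_
          rw [Finset.mul_sum]
          refine Finset.sum_congr rfl fun ξ _ => ?_
          ring
      _ = ∑ x, (f x : ℂ) ^ 2 / M := by
          refine Finset.sum_congr rfl fun x _ => ?_
          simp_rw [sum_stdAddChar_mul, sub_eq_zero, mul_ite, mul_zero]
          rw [Finset.sum_ite_eq]
          simp only [mem_univ, if_true]
          field_simp
      _ = _ := by rw [Finset.sum_div]
  exact_mod_cast h

/-- The count of three-term progressions in Fourier space. -/
lemma sum_zfourier_triple (f : ZMod M → ℝ) :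
    ∑ ξ, zfourier f ξ * zfourier f ξ * zfourier f (-2 * ξ) =
      (((∑ x, ∑ d, f x * f (x + d) * f (x + d + d)) / M ^ 2 : ℝ) : ℂ) := by
  have hM : (M : ℂ) ≠ 0 := natCast_ne_zero_complex
  push_cast
  calc ∑ ξ, zfourier f ξ * zfourier f ξ * zfourier f (-2 * ξ)
      = ∑ ξ, ∑ x, ∑ y, ∑ z, (f x : ℂ) * f y * f z * stdAddChar (ξ * (y - (z + z - x))) / M ^ 3 := by
        refine Finset.sum_congr rfl fun ξ _ => ?_
        rw [zfourier, zfourier, div_mul_div_comm, div_mul_div_comm, Finset.sum_mul_sum,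
          Finset.sum_mul, Finset.sum_div]
        refine Finset.sum_congr rfl fun x _ => ?_
        rw [Finset.sum_mul_sum, Finset.sum_div]
        refine Finset.sum_congr rfl fun y _ => ?_
        rw [Finset.sum_div]
        refine Finset.sum_congr rfl fun z _ => ?_
        have : ξ * (y - (z + z - x)) = ξ * x + ξ * y + -2 * ξ * z := by ring
        rw [this, AddChar.map_add_eq_mul, AddChar.map_add_eq_mul]
        ring
    _ = ∑ x, ∑ z, ∑ y, (f x : ℂ) * f y * f z / M ^ 3 * ∑ ξ, stdAddChar (ξ * (y - (z + z - x))) := by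
        rw [Finset.sum_comm]
        refine Finset.sum_congr rfl fun x _ => ?_
        simp_rw [Finset.mul_sum]
        rw [Finset.sum_comm, Finset.sum_comm (s := (univ : Finset (ZMod M))) (γ := ZMod M)]
        conv_rhs => rw [Finset.sum_comm]
        conv_lhs => rw [Finset.sum_comm]
        refine Finset.sum_congr rfl fun y _ => ?_
        rw [Finset.sum_comm]
        refine Finset.sum_congr rfl fun z _ => Finset.sum_congr rfl fun ξ _ => ?_
        ring
    _ = ∑ x, ∑ z, (f x : ℂ) * f z * f (z + z - x) / M ^ 2 := by
        refine Finset.sum_congr rfl fun x _ => Finset.sum_congr rfl fun z _ => ?_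
        simp_rw [sum_stdAddChar_mul, sub_eq_zero, mul_ite, mul_zero]
        rw [Finset.sum_ite_eq']
        simp only [mem_univ, if_true]
        field_simp
    _ = ∑ x, ∑ d, (f x : ℂ) * f (x + d) * f (x + d + d) / M ^ 2 := by
        refine Finset.sum_congr rfl fun x _ => ?_
        rw [← Equiv.sum_comp (Equiv.addLeft x)]
        refine Finset.sum_congr rfl fun d _ => ?_
        simp only [Equiv.coe_addLeft]
        rw [show x + d + (x + d) - x = x + d + d by ring]
    _ = _ := by simp_rw [Finset.sum_div]

end Fourier

section Spectrum

open Finset ZMod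

variable {M : ℕ} [NeZero M]

/-- Large spectrum bound for functions with a pseudorandom majorant. -/
lemma card_large_spectrum {f ν : ZMod M → ℝ} {η ρ : ℝ} (hf0 : ∀ x, 0 ≤ f x)
    (hfν : ∀ x, f x ≤ ν x) (hη1 : η ≤ 1) (hν0 : ‖zfourier ν 0 - 1‖ ≤ η)
    (hν : ∀ ξ, ξ ≠ 0 → ‖zfourier ν ξ‖ ≤ η) (hρ : 0 < ρ) (hηρ : η ≤ ρ ^ 2 / 8)
    (Λ : Finset (ZMod M)) (hΛ : ∀ ξ ∈ Λ, ρ ≤ ‖zfourier f ξ‖) : (#Λ : ℝ) ≤ 6 / ρ ^ 2 := by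
  have hM : (0 : ℝ) < M := Nat.cast_pos.2 (NeZero.pos M)
  have hMC : (M : ℂ) ≠ 0 := natCast_ne_zero_complex
  have hη0 : 0 ≤ η := (norm_nonneg _).trans hν0
  have hν00 : ∀ x, 0 ≤ ν x := fun x => (hf0 x).trans (hfν x)
  have hmean : (∑ x, ν x) / M ≤ 1 + η := by
    rw [zfourier_zero, ← Complex.ofReal_one, ← Complex.ofReal_sub, Complex.norm_real,
      Real.norm_eq_abs] at hν0
    linarith [(abs_le.1 hν0).2]
  -- unimodular weights
  let c : ZMod M → ℂ := fun ξ => (starRingEnd ℂ) (zfourier f ξ) / ‖zfourier f ξ‖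
  have hc1 : ∀ ξ ∈ Λ, ‖c ξ‖ = 1 := by
    intro ξ hξ
    have : ‖zfourier f ξ‖ ≠ 0 := (hρ.trans_le (hΛ ξ hξ)).ne'
    simp only [c, norm_div, RCLike.norm_conj, Complex.norm_real, norm_norm]
    exact div_self this
  have hc2 : ∀ ξ ∈ Λ, c ξ * zfourier f ξ = ‖zfourier f ξ‖ := by
    intro ξ hξ
    have : (‖zfourier f ξ‖ : ℂ) ≠ 0 := by
      exact_mod_cast (hρ.trans_le (hΛ ξ hξ)).ne'
    simp only [c]
    rw [div_mul_eq_mul_div, div_eq_iff this, mul_comm, Complex.mul_conj']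
    ring
  let T : ZMod M → ℂ := fun x => ∑ ξ ∈ Λ, c ξ * stdAddChar (ξ * x)
  set R : ℝ := (#Λ : ℝ) with hR
  have hlow : ρ * R ≤ (∑ x, ν x * ‖T x‖) / M := by
    have h1 : ((∑ ξ ∈ Λ, ‖zfourier f ξ‖ : ℝ) : ℂ) = (∑ x, (f x : ℂ) * T x) / M := by
      push_cast
      rw [← Finset.sum_congr rfl hc2]
      simp only [T, zfourier, Finset.mul_sum, Finset.sum_div]
      rw [Finset.sum_comm]
      refine Finset.sum_congr rfl fun x _ => Finset.sum_congr rfl fun ξ _ => ?_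
      ring
    calc ρ * R = ∑ ξ ∈ Λ, ρ := by rw [Finset.sum_const, nsmul_eq_mul, mul_comm]
      _ ≤ ∑ ξ ∈ Λ, ‖zfourier f ξ‖ := Finset.sum_le_sum hΛ
      _ = ‖(∑ x, (f x : ℂ) * T x) / M‖ := by
        rw [← h1, Complex.norm_real, Real.norm_of_nonneg (by positivity)]
      _ ≤ _ := by
        rw [norm_div, Complex.norm_natCast]
        gcongr
        refine (norm_sum_le _ _).trans (Finset.sum_le_sum fun x _ => ?_)
        rw [norm_mul, Complex.norm_real, Real.norm_of_nonneg (hf0 x)]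
        gcongr
        exact hfν x
  have hsq : (∑ x, ν x * ‖T x‖ ^ 2) / M ≤ (1 + η) * R + η * R ^ 2 := by
    have h1 : (((∑ x, ν x * ‖T x‖ ^ 2) / M : ℝ) : ℂ) =
        ∑ ξ ∈ Λ, ∑ ξ' ∈ Λ, c ξ * (starRingEnd ℂ) (c ξ') * zfourier ν (ξ - ξ') := by
      push_cast
      simp_rw [← Complex.mul_conj', T, map_sum, Finset.sum_mul_sum, map_mul, conj_stdAddChar,
        zfourier, Finset.mul_sum, Finset.sum_div, Finset.mul_sum]
      rw [Finset.sum_comm]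
      refine Finset.sum_congr rfl fun ξ _ => ?_
      rw [Finset.sum_comm]
      refine Finset.sum_congr rfl fun ξ' _ => Finset.sum_congr rfl fun x _ => ?_
      rw [sub_mul, sub_eq_add_neg, AddChar.map_add_eq_mul]
      ring
    have h2 : ∀ ξ ∈ Λ, ∀ ξ' ∈ Λ, ‖c ξ * (starRingEnd ℂ) (c ξ') * zfourier ν (ξ - ξ')‖ ≤
        (if ξ = ξ' then (1 : ℝ) else 0) + η := by
      intro ξ hξ ξ' hξ'
      rw [norm_mul, norm_mul, RCLike.norm_conj, hc1 ξ hξ, hc1 ξ' hξ', one_mul, one_mul]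
      split_ifs with h
      · subst h
        rw [sub_self]
        calc ‖zfourier ν 0‖ = ‖1 + (zfourier ν 0 - 1)‖ := by ring_nf
          _ ≤ ‖(1 : ℂ)‖ + ‖zfourier ν 0 - 1‖ := norm_add_le _ _
          _ ≤ 1 + η := by rw [norm_one]; gcongr
      · rw [zero_add]
        exact hν _ (sub_ne_zero.2 h)
    have hnn : 0 ≤ (∑ x, ν x * ‖T x‖ ^ 2) / M :=
      div_nonneg (Finset.sum_nonneg fun x _ => mul_nonneg (hν00 x) (by positivity)) hM.le
    calc (∑ x, ν x * ‖T x‖ ^ 2) / M = ‖(((∑ x, ν x * ‖T x‖ ^ 2) / M : ℝ) : ℂ)‖ := by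
          rw [Complex.norm_real, Real.norm_of_nonneg hnn]
      _ ≤ ∑ ξ ∈ Λ, ∑ ξ' ∈ Λ, ((if ξ = ξ' then (1 : ℝ) else 0) + η) := by
          rw [h1]
          refine (norm_sum_le _ _).trans (Finset.sum_le_sum fun ξ hξ => ?_)
          exact (norm_sum_le _ _).trans (Finset.sum_le_sum fun ξ' hξ' => h2 ξ hξ ξ' hξ')
      _ = R + η * R ^ 2 := by
          simp_rw [Finset.sum_add_distrib, Finset.sum_ite_eq]
          simp
          ring
      _ ≤ _ := by nlinarith [show 0 ≤ R from Nat.cast_nonneg _]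
  have hCS : (∑ x, ν x * ‖T x‖) ^ 2 ≤ (∑ x, ν x) * ∑ x, ν x * ‖T x‖ ^ 2 := by
    have := Finset.sum_mul_sq_le_sq_mul_sq univ (fun x => √(ν x)) (fun x => √(ν x) * ‖T x‖)
    simp_rw [mul_pow, ← mul_assoc, Real.mul_self_sqrt (hν00 _), Real.sq_sqrt (hν00 _)] at this
    exact this
  have hR0 : 0 ≤ R := Nat.cast_nonneg _
  have hmain : (ρ * R) ^ 2 ≤ (1 + η) * ((1 + η) * R + η * R ^ 2) := by
    calc (ρ * R) ^ 2 ≤ ((∑ x, ν x * ‖T x‖) / M) ^ 2 := by gcongr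
      _ = (∑ x, ν x * ‖T x‖) ^ 2 / M ^ 2 := by rw [div_pow]
      _ ≤ ((∑ x, ν x) * ∑ x, ν x * ‖T x‖ ^ 2) / M ^ 2 := by gcongr
      _ = ((∑ x, ν x) / M) * ((∑ x, ν x * ‖T x‖ ^ 2) / M) := by field_simp
      _ ≤ _ := mul_le_mul hmean hsq
          (div_nonneg (Finset.sum_nonneg fun x _ => mul_nonneg (hν00 x) (by positivity)) hM.le)
          (by positivity)
  rcases hR0.eq_or_lt with h0 | hpos
  · rw [← h0]
    positivity
  rw [le_div_iff₀ (by positivity)]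
  have h5 : ρ ^ 2 * R ≤ (1 + η) * ((1 + η) + η * R) := by
    refine le_of_mul_le_mul_right ?_ hpos
    nlinarith
  nlinarith [mul_nonneg hη0 hR0, mul_le_mul_of_nonneg_right hηρ hR0]

/-- The contribution of small Fourier coefficients to the third moment. -/
lemma sum_small_cube_le {f ν : ZMod M → ℝ} {η L : ℝ} (hf0 : ∀ x, 0 ≤ f x)
    (hfν : ∀ x, f x ≤ ν x) (hη1 : η ≤ 1) (hν0 : ‖zfourier ν 0 - 1‖ ≤ η)
    (hν : ∀ ξ, ξ ≠ 0 → ‖zfourier ν ξ‖ ≤ η) (hL : (∑ x, f x ^ 2) / M ≤ L) (j : ℕ) :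
    ∀ ε : ℝ, 0 < ε → η ≤ (ε / 2 ^ j) ^ 2 / 8 →
    ∑ ξ with ‖zfourier f ξ‖ ≤ ε, ‖zfourier f ξ‖ ^ 3 ≤ 48 * ε + ε / 2 ^ j * L := by
  induction j with
  | zero =>
    intro ε hε _
    calc ∑ ξ with ‖zfourier f ξ‖ ≤ ε, ‖zfourier f ξ‖ ^ 3
        ≤ ∑ ξ with ‖zfourier f ξ‖ ≤ ε, ε * ‖zfourier f ξ‖ ^ 2 := by
          refine Finset.sum_le_sum fun ξ hξ => ?_
          rw [Finset.mem_filter] at hξ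
          nlinarith [sq_nonneg ‖zfourier f ξ‖, hξ.2]
      _ ≤ ∑ ξ, ε * ‖zfourier f ξ‖ ^ 2 := Finset.sum_le_sum_of_subset_of_nonneg
          (Finset.filter_subset _ _) fun _ _ _ => by positivity
      _ = ε * ((∑ x, f x ^ 2) / M) := by rw [← Finset.mul_sum, sum_norm_sq_zfourier]
      _ ≤ ε * L := by gcongr
      _ ≤ _ := by simp; positivity
  | succ j ih =>
    intro ε hε hη
    have hη' : η ≤ ((ε / 2) / 2 ^ j) ^ 2 / 8 := by
      rwa [div_div, ← pow_succ']
    have h1 := ih (ε / 2) (by positivity) hη'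
    have hsplit : ∑ ξ with ‖zfourier f ξ‖ ≤ ε, ‖zfourier f ξ‖ ^ 3 ≤
        ∑ ξ with ‖zfourier f ξ‖ ≤ ε / 2, ‖zfourier f ξ‖ ^ 3 +
        ∑ ξ with ε / 2 ≤ ‖zfourier f ξ‖ ∧ ‖zfourier f ξ‖ ≤ ε, ‖zfourier f ξ‖ ^ 3 := by
      simp_rw [Finset.sum_filter, ← Finset.sum_add_distrib]
      refine Finset.sum_le_sum fun ξ _ => ?_
      have : 0 ≤ ‖zfourier f ξ‖ ^ 3 := by positivity
      split_ifs <;> grind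
    have hcard : (#{ξ | ε / 2 ≤ ‖zfourier f ξ‖ ∧ ‖zfourier f ξ‖ ≤ ε} : ℝ) ≤ 6 / (ε / 2) ^ 2 := by
      refine card_large_spectrum hf0 hfν hη1 hν0 hν (by positivity) ?_ _ fun ξ hξ => ?_
      · refine hη.trans ?_
        have : ε / 2 ^ (j + 1) ≤ ε / 2 := by
          gcongr
          exact le_self_pow₀ one_le_two (by omega)
        gcongr
      · exact (Finset.mem_filter.1 hξ).2.1
    have h2 : ∑ ξ with ε / 2 ≤ ‖zfourier f ξ‖ ∧ ‖zfourier f ξ‖ ≤ ε, ‖zfourier f ξ‖ ^ 3 ≤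
        24 * ε := by
      calc ∑ ξ with ε / 2 ≤ ‖zfourier f ξ‖ ∧ ‖zfourier f ξ‖ ≤ ε, ‖zfourier f ξ‖ ^ 3
          ≤ ∑ ξ with ε / 2 ≤ ‖zfourier f ξ‖ ∧ ‖zfourier f ξ‖ ≤ ε, ε ^ 3 := by
            refine Finset.sum_le_sum fun ξ hξ => ?_
            have := (Finset.mem_filter.1 hξ).2.2
            gcongr
        _ = #{ξ | ε / 2 ≤ ‖zfourier f ξ‖ ∧ ‖zfourier f ξ‖ ≤ ε} * ε ^ 3 := by
            rw [Finset.sum_const, nsmul_eq_mul]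
        _ ≤ 6 / (ε / 2) ^ 2 * ε ^ 3 := by gcongr
        _ = 24 * ε := by field_simp; ring
    have h3 : ε / 2 / 2 ^ j = ε / 2 ^ (j + 1) := by rw [div_div, ← pow_succ']
    rw [h3] at h1
    linarith

end Spectrum

section Transference

open Finset ZMod

variable {M : ℕ} [NeZero M]

lemma zfourier_inversion (f : ZMod M → ℝ) (x : ZMod M) :
    (f x : ℂ) = ∑ ξ, zfourier f ξ * stdAddChar (-(ξ * x)) := by
  have hM : (M : ℂ) ≠ 0 := natCast_ne_zero_complex
  symm
  calc ∑ ξ, zfourier f ξ * stdAddChar (-(ξ * x))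
      = ∑ y, (f y : ℂ) / M * ∑ ξ, stdAddChar (ξ * (y - x)) := by
        simp_rw [zfourier, Finset.sum_div, Finset.sum_mul, Finset.mul_sum]
        rw [Finset.sum_comm]
        refine Finset.sum_congr rfl fun y _ => Finset.sum_congr rfl fun ξ _ => ?_
        rw [mul_sub, sub_eq_add_neg, AddChar.map_add_eq_mul]
        ring
    _ = f x := by
        simp_rw [sum_stdAddChar_mul, sub_eq_zero, mul_ite, mul_zero]
        rw [Finset.sum_ite_eq']
        simp only [mem_univ, if_true]
        field_simp

lemma norm_stdAddChar_intCast_sub_one_le (n : ℤ) :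
    ‖(stdAddChar (n : ZMod M) : ℂ) - 1‖ ≤ 2 * Real.pi * |(n : ℝ)| / M := by
  have h : (2 * Real.pi * Complex.I * n / M : ℂ) = Complex.I * ((2 * Real.pi * n / M : ℝ) : ℂ) := by
    push_cast
    ring
  rw [stdAddChar_coe, h]
  refine Real.norm_exp_I_mul_ofReal_sub_one_le.trans_eq ?_
  rw [Real.norm_eq_abs, abs_div, abs_mul, abs_of_pos Real.two_pi_pos, Nat.abs_cast]

/-- Pigeonhole: a large set on which all characters from `S` are nearly constant. -/
lemma exists_almost_constant_set (S : Finset (ZMod M)) {k : ℕ} (hk : 0 < k) :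
    ∃ C : Finset (ZMod M), C.Nonempty ∧ (M : ℝ) ≤ (k : ℝ) ^ #S * #C ∧
      ∀ ξ ∈ S, ∀ c ∈ C, ∀ c' ∈ C,
        ‖(stdAddChar (ξ * (c' - c)) : ℂ) - 1‖ ≤ 2 * Real.pi / k := by
  classical
  have hM : 0 < M := NeZero.pos M
  have hMR : (0 : ℝ) < M := Nat.cast_pos.2 hM
  have hkR : (0 : ℝ) < k := Nat.cast_pos.2 hk
  let φ : ZMod M → (S → Fin k) := fun x ξ => ⟨((ξ : ZMod M) * x).val * k / M, by
    rw [Nat.div_lt_iff_lt_mul hM, mul_comm k]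
    exact Nat.mul_lt_mul_of_pos_right (ZMod.val_lt _) hk⟩
  obtain ⟨y, -, hy⟩ := Finset.exists_le_card_fiber_of_nsmul_le_card_of_maps_to
    (s := (univ : Finset (ZMod M))) (t := (univ : Finset (S → Fin k))) (f := φ)
    (b := (M : ℝ) / (k : ℝ) ^ #S) (fun _ _ => mem_univ _) ⟨fun _ => ⟨0, hk⟩, mem_univ _⟩ (by
      rw [Finset.card_univ, Finset.card_univ, ZMod.card, Fintype.card_fun, Fintype.card_fin,
        Fintype.card_coe, nsmul_eq_mul]
      push_cast
      rw [mul_div_cancel₀]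
      positivity)
  rw [div_le_iff₀ (by positivity), mul_comm] at hy
  refine ⟨univ.filter fun x => φ x = y, ?_, hy, ?_⟩
  · rw [← Finset.card_pos]
    have : (0 : ℝ) < (k : ℝ) ^ #S * #{x | φ x = y} := hMR.trans_le hy
    exact_mod_cast pos_of_mul_pos_right this (by positivity)
  · intro ξ hξ c hc c' hc'
    rw [Finset.mem_filter] at hc hc'
    have h : (ξ * c).val * k / M = (ξ * c').val * k / M := by
      have := congrFun (hc.2.trans hc'.2.symm) ⟨ξ, hξ⟩
      simpa [φ] using this
    set v := (ξ * c).val with hv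
    set v' := (ξ * c').val with hv'
    have e : ξ * (c' - c) = (((v' : ℤ) - (v : ℤ) : ℤ) : ZMod M) := by
      push_cast
      rw [hv, hv', ZMod.natCast_zmod_val, ZMod.natCast_zmod_val]
      ring
    rw [e]
    refine (norm_stdAddChar_intCast_sub_one_le _).trans ?_
    rw [div_le_div_iff₀ hMR hkR, mul_assoc]
    gcongr
    have h1 := Nat.div_mul_le_self (v * k) M
    have h2 := Nat.lt_div_mul_add hM (a := v * k)
    have h3 := Nat.div_mul_le_self (v' * k) M
    have h4 := Nat.lt_div_mul_add hM (a := v' * k)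
    rw [h] at h1 h2
    have h1' : ((v' * k / M * M : ℕ) : ℝ) ≤ v * k := by exact_mod_cast h1
    have h2' : (v * k : ℝ) < ((v' * k / M * M : ℕ) : ℝ) + M := by exact_mod_cast h2
    have h3' : ((v' * k / M * M : ℕ) : ℝ) ≤ v' * k := by exact_mod_cast h3
    have h4' : (v' * k : ℝ) < ((v' * k / M * M : ℕ) : ℝ) + M := by exact_mod_cast h4
    have e : |((((v' : ℤ) - (v : ℤ) : ℤ)) : ℝ)| * k = |(((v' : ℤ) - (v : ℤ) : ℤ) : ℝ) * k| := by
      rw [abs_mul, abs_of_pos hkR]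
    rw [e, abs_le]
    push_cast
    constructor <;> linarith

/-- Average of `f` over the translates by differences of elements of `C`. -/
noncomputable def smoothing (C : Finset (ZMod M)) (f : ZMod M → ℝ) (x : ZMod M) : ℝ :=
  (∑ c ∈ C, ∑ c' ∈ C, f (x + (c - c'))) / (#C : ℝ) ^ 2

/-- Fourier multiplier of `smoothing`. -/
noncomputable def smoothingMul (C : Finset (ZMod M)) (ξ : ZMod M) : ℂ :=
  (∑ c ∈ C, ∑ c' ∈ C, (stdAddChar (ξ * (c' - c)) : ℂ)) / (#C : ℂ) ^ 2

lemma zfourier_smoothing (C : Finset (ZMod M)) (f : ZMod M → ℝ) (ξ : ZMod M) :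
    zfourier (smoothing C f) ξ = zfourier f ξ * smoothingMul C ξ := by
  have h : ∀ c c' : ZMod M, ∑ x, (f (x + (c - c')) : ℂ) * stdAddChar (ξ * x) =
      (∑ x, (f x : ℂ) * stdAddChar (ξ * x)) * stdAddChar (ξ * (c' - c)) := by
    intro c c'
    rw [← Equiv.sum_comp (Equiv.addRight (c' - c)), Finset.sum_mul]
    refine Finset.sum_congr rfl fun x _ => ?_
    simp only [Equiv.coe_addRight]
    rw [mul_assoc, ← AddChar.map_add_eq_mul]
    congr 3 <;> ring_nf
  rw [zfourier, zfourier, smoothingMul, div_mul_div_comm, Finset.mul_sum]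
  simp_rw [Finset.mul_sum, ← h, smoothing]
  push_cast
  simp_rw [div_mul_eq_mul_div, Finset.sum_mul]
  rw [← Finset.sum_div, div_div, mul_comm (M : ℂ)]
  congr 1
  rw [Finset.sum_comm]
  refine Finset.sum_congr rfl fun c _ => ?_
  rw [Finset.sum_comm]

lemma smoothingMul_eq (C : Finset (ZMod M)) (ξ : ZMod M) :
    smoothingMul C ξ = ((‖(∑ c ∈ C, (stdAddChar (ξ * c) : ℂ)) / #C‖ ^ 2 : ℝ) : ℂ) := by
  rw [Complex.ofReal_pow, ← Complex.conj_mul', map_div₀, map_sum, smoothingMul, Complex.conj_natCast,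
    div_mul_div_comm, Finset.sum_mul_sum, sq]
  simp_rw [conj_stdAddChar, ← AddChar.map_add_eq_mul]
  congr 1
  refine Finset.sum_congr rfl fun c _ => Finset.sum_congr rfl fun c' _ => ?_
  congr 1
  ring

lemma norm_smoothingMul (C : Finset (ZMod M)) (ξ : ZMod M) :
    (‖smoothingMul C ξ‖ : ℂ) = smoothingMul C ξ := by
  rw [smoothingMul_eq, Complex.norm_real, Real.norm_of_nonneg (by positivity)]

lemma norm_smoothingMul_le_one (C : Finset (ZMod M)) (ξ : ZMod M) : ‖smoothingMul C ξ‖ ≤ 1 := by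
  rw [smoothingMul_eq, Complex.norm_real, Real.norm_of_nonneg (by positivity)]
  refine pow_le_one₀ (norm_nonneg _) ?_
  rw [norm_div, Complex.norm_natCast]
  refine div_le_one_of_le₀ ?_ (Nat.cast_nonneg _)
  refine (norm_sum_le _ _).trans ?_
  simp

lemma sum_norm_smoothingMul {C : Finset (ZMod M)} (hC : C.Nonempty) :
    ∑ ξ, ‖smoothingMul C ξ‖ = M / #C := by
  have hC0 : (#C : ℂ) ≠ 0 := Nat.cast_ne_zero.2 (Finset.card_ne_zero.2 hC)
  have h : ((∑ ξ, ‖smoothingMul C ξ‖ : ℝ) : ℂ) = ((M / #C : ℝ) : ℂ) := by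
    push_cast
    simp_rw [norm_smoothingMul, smoothingMul]
    rw [← Finset.sum_div, Finset.sum_comm]
    have : ∀ c ∈ C, ∑ ξ, ∑ c' ∈ C, (stdAddChar (ξ * (c' - c)) : ℂ) = M := by
      intro c hc
      rw [Finset.sum_comm]
      simp_rw [sum_stdAddChar_mul, sub_eq_zero]
      rw [Finset.sum_ite_eq']
      simp [hc]
    rw [Finset.sum_congr rfl this, Finset.sum_const, nsmul_eq_mul]
    field_simp
  exact_mod_cast h

lemma norm_one_sub_smoothingMul_le {C : Finset (ZMod M)} (hC : C.Nonempty) {ξ : ZMod M} {κ : ℝ}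
    (h : ∀ c ∈ C, ∀ c' ∈ C, ‖(stdAddChar (ξ * (c' - c)) : ℂ) - 1‖ ≤ κ) :
    ‖1 - smoothingMul C ξ‖ ≤ κ := by
  have hC0 : (0 : ℝ) < #C := Nat.cast_pos.2 (Finset.card_pos.2 hC)
  have hC1 : (#C : ℂ) ≠ 0 := Nat.cast_ne_zero.2 (Finset.card_ne_zero.2 hC)
  have e : smoothingMul C ξ - 1 =
      (∑ c ∈ C, ∑ c' ∈ C, ((stdAddChar (ξ * (c' - c)) : ℂ) - 1)) / (#C : ℂ) ^ 2 := by
    simp_rw [Finset.sum_sub_distrib, sub_div]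
    rw [smoothingMul]
    congr 1
    simp
    field_simp
  rw [norm_sub_rev, e, norm_div, norm_pow, Complex.norm_natCast, div_le_iff₀ (by positivity)]
  calc _ ≤ ∑ c ∈ C, ∑ c' ∈ C, κ := by
        refine (norm_sum_le _ _).trans (Finset.sum_le_sum fun c hc => ?_)
        exact (norm_sum_le _ _).trans (Finset.sum_le_sum fun c' hc' => h c hc c' hc')
    _ = κ * #C ^ 2 := by
        simp
        ring

lemma smoothing_le {C : Finset (ZMod M)} (hC : C.Nonempty) {f ν : ZMod M → ℝ} {η : ℝ}
    (hfν : ∀ x, f x ≤ ν x) (hν0 : ‖zfourier ν 0 - 1‖ ≤ η)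
    (hν : ∀ ξ, ξ ≠ 0 → ‖zfourier ν ξ‖ ≤ η) (x : ZMod M) :
    smoothing C f x ≤ 1 + η + η * (M / #C) := by
  have hη0 : 0 ≤ η := (norm_nonneg _).trans hν0
  have h1 : smoothing C f x ≤ smoothing C ν x := by
    unfold smoothing
    gcongr
    exact hfν _
  refine h1.trans ((le_abs_self _).trans ?_)
  rw [← Real.norm_eq_abs, ← Complex.norm_real, zfourier_inversion]
  calc _ ≤ ∑ ξ, ((if ξ = 0 then 1 + η else 0) + η * ‖smoothingMul C ξ‖) := by
        refine (norm_sum_le _ _).trans (Finset.sum_le_sum fun ξ _ => ?_)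
        rw [norm_mul, norm_stdAddChar, mul_one, zfourier_smoothing, norm_mul]
        split_ifs with h
        · subst h
          have : ‖zfourier ν 0‖ ≤ 1 + η := by
            calc ‖zfourier ν 0‖ = ‖1 + (zfourier ν 0 - 1)‖ := by ring_nf
              _ ≤ ‖(1 : ℂ)‖ + ‖zfourier ν 0 - 1‖ := norm_add_le _ _
              _ ≤ 1 + η := by rw [norm_one]; gcongr
          nlinarith [norm_smoothingMul_le_one C 0, norm_nonneg (smoothingMul C 0),
            norm_nonneg (zfourier ν 0)]
        · rw [zero_add]
          gcongr
          exact hν ξ h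
    _ = _ := by
        rw [Finset.sum_add_distrib, Finset.sum_ite_eq', ← Finset.mul_sum, sum_norm_smoothingMul hC]
        simp

end Transference

section Transference

open Finset ZMod

lemma norm_one_sub_mul_le {a b : ℂ} {κ κ' : ℝ} (ha : ‖a‖ ≤ 1) (h1 : ‖1 - a‖ ≤ κ)
    (h2 : ‖1 - b‖ ≤ κ') : ‖1 - a * a * b‖ ≤ κ + κ + κ' := by
  have e : 1 - a * a * b = (1 - a) + a * (1 - a) + a * a * (1 - b) := by ring
  rw [e]
  have n1 : ‖a * (1 - a)‖ ≤ κ := by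
    rw [norm_mul]
    nlinarith [norm_nonneg a, norm_nonneg (1 - a)]
  have n2 : ‖a * a * (1 - b)‖ ≤ κ' := by
    rw [norm_mul, norm_mul]
    have : ‖a‖ * ‖a‖ ≤ 1 := by nlinarith [norm_nonneg a]
    nlinarith [norm_nonneg a, norm_nonneg (1 - b)]
  calc _ ≤ ‖1 - a‖ + ‖a * (1 - a)‖ + ‖a * a * (1 - b)‖ := norm_add₃_le
    _ ≤ _ := by gcongr

lemma sq_mul_le_cube_add_cube {a b : ℝ} (ha : 0 ≤ a) (hb : 0 ≤ b) :
    a * a * b ≤ a ^ 3 + b ^ 3 := by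
  rcases le_total a b with h | h
  · nlinarith [pow_nonneg ha 3, mul_le_mul h h ha hb, mul_nonneg hb hb]
  · nlinarith [pow_nonneg hb 3, mul_le_mul h h hb ha, mul_nonneg ha ha]

variable {M : ℕ} [NeZero M]

lemma neg_two_mul_bijective (hM : Odd M) : Function.Bijective (fun ξ : ZMod M => -2 * ξ) := by
  refine Function.Injective.bijective_of_finite fun a b h => ?_
  obtain ⟨k, hk⟩ := hM
  have h0 : (2 * (k : ZMod M) + 1) = 0 := by
    have := ZMod.natCast_self M
    rw [hk] at this ⊢
    push_cast at this
    exact this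
  linear_combination (a - b) * h0 + k * h

/-- Comparison of progression counts before and after smoothing. -/
lemma norm_sum_triple_sub_le {f : ZMod M → ℝ} {ε κ F B : ℝ} (hM : Odd M)
    (hfB : ∀ ξ, ‖zfourier f ξ‖ ≤ 2)
    (hF : ∑ ξ with ‖zfourier f ξ‖ ≤ ε, ‖zfourier f ξ‖ ^ 3 ≤ F)
    (Λ : Finset (ZMod M)) (hΛ : ∀ ξ, ε < ‖zfourier f ξ‖ → ξ ∈ Λ) (hB : (#Λ : ℝ) ≤ B)
    (w : ZMod M → ℂ) (hw1 : ∀ ξ, ‖w ξ‖ ≤ 1) (hκ : 0 ≤ κ)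
    (hw : ∀ ξ, ξ ∈ Λ ∨ -2 * ξ ∈ Λ → ‖1 - w ξ‖ ≤ κ ∧ ‖1 - w (-2 * ξ)‖ ≤ 2 * κ) :
    ‖∑ ξ, zfourier f ξ * zfourier f ξ * zfourier f (-2 * ξ) -
      ∑ ξ, (zfourier f ξ * w ξ) * (zfourier f ξ * w ξ) * (zfourier f (-2 * ξ) * w (-2 * ξ))‖ ≤
      64 * κ * B + 4 * F := by
  classical
  have hbij := neg_two_mul_bijective hM
  rw [← Finset.sum_sub_distrib]
  have hterm : ∀ ξ, ‖zfourier f ξ * zfourier f ξ * zfourier f (-2 * ξ) -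
      (zfourier f ξ * w ξ) * (zfourier f ξ * w ξ) * (zfourier f (-2 * ξ) * w (-2 * ξ))‖ ≤
      32 * κ * ((if ξ ∈ Λ then 1 else 0) + (if -2 * ξ ∈ Λ then 1 else 0)) +
      2 * ((if ‖zfourier f ξ‖ ≤ ε then ‖zfourier f ξ‖ ^ 3 else 0) +
        (if ‖zfourier f (-2 * ξ)‖ ≤ ε then ‖zfourier f (-2 * ξ)‖ ^ 3 else 0)) := by
    intro ξ
    have e : zfourier f ξ * zfourier f ξ * zfourier f (-2 * ξ) -
      (zfourier f ξ * w ξ) * (zfourier f ξ * w ξ) * (zfourier f (-2 * ξ) * w (-2 * ξ)) =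
      (zfourier f ξ * zfourier f ξ * zfourier f (-2 * ξ)) * (1 - w ξ * w ξ * w (-2 * ξ)) := by ring
    rw [e, norm_mul, norm_mul, norm_mul]
    set a := ‖zfourier f ξ‖ with ha
    set b := ‖zfourier f (-2 * ξ)‖ with hb
    have ha0 : 0 ≤ a := norm_nonneg _
    have hb0 : 0 ≤ b := norm_nonneg _
    by_cases h : ξ ∈ Λ ∨ -2 * ξ ∈ Λ
    · have h1 := norm_one_sub_mul_le (hw1 ξ) (hw ξ h).1 (hw ξ h).2
      have h2 : a * a * b ≤ 8 := by
        calc a * a * b ≤ 2 * 2 * 2 := by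
              gcongr
              · exact hfB _
              · exact hfB _
              · exact hfB _
          _ = 8 := by norm_num
      have h3 : a * a * b * ‖1 - w ξ * w ξ * w (-2 * ξ)‖ ≤ 32 * κ := by
        calc _ ≤ 8 * (κ + κ + 2 * κ) := by gcongr
          _ = 32 * κ := by ring
      have h4 : (1 : ℝ) ≤ (if ξ ∈ Λ then 1 else 0) + (if -2 * ξ ∈ Λ then 1 else 0) := by
        rcases h with h | h <;> simp only [h, if_true] <;> split_ifs <;> norm_num
      have h5 : 0 ≤ (if a ≤ ε then a ^ 3 else 0) + (if b ≤ ε then b ^ 3 else 0) := by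
        positivity
      nlinarith
    · push Not at h
      have h1 : a ≤ ε := le_of_not_gt fun hh => h.1 (hΛ _ hh)
      have h2 : b ≤ ε := le_of_not_gt fun hh => h.2 (hΛ _ hh)
      simp only [h.1, h.2, h1, h2, if_true, if_false, add_zero, mul_zero, zero_add]
      have h3 := sq_mul_le_cube_add_cube ha0 hb0
      have h4 : ‖1 - w ξ * w ξ * w (-2 * ξ)‖ ≤ 2 := by
        refine (norm_sub_le _ _).trans ?_
        rw [norm_one, norm_mul, norm_mul]
        have := hw1 ξ
        have := hw1 (-2 * ξ)
        have : ‖w ξ‖ * ‖w ξ‖ * ‖w (-2 * ξ)‖ ≤ 1 * 1 * 1 := by gcongr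
        linarith
      have h5 : 0 ≤ a * a * b := by positivity
      nlinarith [norm_nonneg (1 - w ξ * w ξ * w (-2 * ξ))]
  have hs1 : ∑ ξ : ZMod M, (if -2 * ξ ∈ Λ then (1 : ℝ) else 0) = #Λ := by
    rw [hbij.sum_comp (fun ξ => if ξ ∈ Λ then (1 : ℝ) else 0)]
    simp
  have hs2 : ∑ ξ : ZMod M, (if ‖zfourier f (-2 * ξ)‖ ≤ ε then ‖zfourier f (-2 * ξ)‖ ^ 3 else 0) ≤
      F := by
    rw [hbij.sum_comp (fun ξ => if ‖zfourier f ξ‖ ≤ ε then ‖zfourier f ξ‖ ^ 3 else 0),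
      ← Finset.sum_filter]
    exact hF
  have hs3 : ∑ ξ : ZMod M, (if ξ ∈ Λ then (1 : ℝ) else 0) = #Λ := by simp
  rw [Finset.sum_filter] at hF
  refine (norm_sum_le _ _).trans ((Finset.sum_le_sum fun ξ _ => hterm ξ).trans ?_)
  rw [Finset.sum_add_distrib, ← Finset.mul_sum, ← Finset.mul_sum, Finset.sum_add_distrib,
    Finset.sum_add_distrib, hs1, hs3]
  nlinarith

/-- Roth's theorem with multiplicity for functions with a pseudorandom majorant. -/
lemma roth_transference {δ : ℝ} (hδ : 0 < δ) : ∃ c η₀ : ℝ, 0 < c ∧ 0 < η₀ ∧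
    ∀ (M : ℕ) [NeZero M] (f ν : ZMod M → ℝ) (η L : ℝ), Odd M → (∀ x, 0 ≤ f x) →
      (∀ x, f x ≤ ν x) → ‖zfourier ν 0 - 1‖ ≤ η → (∀ ξ, ξ ≠ 0 → ‖zfourier ν ξ‖ ≤ η) →
      1 ≤ L → η * L ^ 2 ≤ η₀ → (∑ x, f x ^ 2) / M ≤ L → δ * M ≤ ∑ x, f x →
      c * (M : ℝ) ^ 2 ≤ ∑ x, ∑ d, f x * f (x + d) * f (x + d + d) := by
  obtain ⟨c, hc, hroth⟩ := roth_count hδ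
  set ε : ℝ := c / 1000 with hε_def
  have hε : 0 < ε := by positivity
  obtain ⟨k, hk⟩ := exists_nat_ge (1 + 64 * (2 * Real.pi) * (6 / ε ^ 2) * 4 / c)
  have hkpos : 0 < k := by
    have : (0 : ℝ) < k := lt_of_lt_of_le (by positivity) hk
    exact_mod_cast this
  have hkR : (0 : ℝ) < k := Nat.cast_pos.2 hkpos
  set N : ℕ := 2 * ⌈6 / ε ^ 2⌉₊ with hN
  refine ⟨c / 2, min (1 / 4) (min (1 / (4 * (k : ℝ) ^ N)) (ε ^ 2 / 32)), by positivity,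
    by positivity, ?_⟩
  intro M _ f ν η L hM hf0 hfν hν0 hν hL hηL hf2 hfδ
  classical
  have hM0 : (0 : ℝ) < M := Nat.cast_pos.2 (NeZero.pos M)
  have hη0 : 0 ≤ η := (norm_nonneg _).trans hν0
  have hηL' : η ≤ η * L ^ 2 := le_mul_of_one_le_right hη0 (one_le_pow₀ hL)
  have hη1 : η ≤ 1 / 4 := hηL'.trans (hηL.trans (min_le_left _ _))
  have hη2 : η ≤ 1 / (4 * (k : ℝ) ^ N) :=
    hηL'.trans (hηL.trans ((min_le_right _ _).trans (min_le_left _ _)))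
  have hη3 : η * L ^ 2 ≤ ε ^ 2 / 32 := hηL.trans ((min_le_right _ _).trans (min_le_right _ _))
  -- choice of the dyadic level
  obtain ⟨n, hn1, hn2⟩ := exists_nat_pow_near hL (one_lt_two (α := ℝ))
  have hηj : η ≤ (ε / 2 ^ (n + 1)) ^ 2 / 8 := by
    have h1 : (2 : ℝ) ^ (n + 1) ≤ 2 * L := by rw [pow_succ]; linarith
    calc η ≤ ε ^ 2 / 32 / L ^ 2 := by rwa [le_div_iff₀ (by positivity)]
      _ = (ε / (2 * L)) ^ 2 / 8 := by field_simp; norm_num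
      _ ≤ _ := by gcongr
  have hF := sum_small_cube_le hf0 hfν (hη1.trans (by norm_num)) hν0 hν hf2 (n + 1) ε hε hηj
  have hF' : 48 * ε + ε / 2 ^ (n + 1) * L ≤ 49 * ε := by
    have : ε / 2 ^ (n + 1) * L ≤ ε := by
      rw [div_mul_eq_mul_div, div_le_iff₀ (by positivity)]
      gcongr
    linarith
  let Λ : Finset (ZMod M) := {ξ | ε < ‖zfourier f ξ‖}
  have hΛ : (#Λ : ℝ) ≤ 6 / ε ^ 2 := by
    refine card_large_spectrum hf0 hfν (hη1.trans (by norm_num)) hν0 hν hε ?_ Λ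
      fun ξ hξ => (Finset.mem_filter.1 hξ).2.le
    refine hηj.trans ?_
    have : ε / 2 ^ (n + 1) ≤ ε := div_le_self hε.le (one_le_pow₀ one_le_two)
    gcongr
  let S : Finset (ZMod M) := Λ ∪ univ.filter fun ξ => -2 * ξ ∈ Λ
  have hS : #S ≤ N := by
    have h2 : #(univ.filter fun ξ : ZMod M => -2 * ξ ∈ Λ) ≤ #Λ := by
      refine Finset.card_le_card_of_injOn (fun ξ => -2 * ξ) (fun ξ hξ => ?_)
        ((neg_two_mul_bijective hM).injective.injOn)
      exact (Finset.mem_filter.1 hξ).2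
    have h3 : #Λ ≤ ⌈6 / ε ^ 2⌉₊ := by
      have := hΛ.trans (Nat.le_ceil _)
      exact_mod_cast this
    have h4 : #S ≤ #Λ + #(univ.filter fun ξ : ZMod M => -2 * ξ ∈ Λ) := Finset.card_union_le _ _
    omega
  obtain ⟨C, hC, hCcard, hCS⟩ := exists_almost_constant_set S hkpos
  have hC0 : (0 : ℝ) < #C := Nat.cast_pos.2 (Finset.card_pos.2 hC)
  have hk1 : (1 : ℝ) ≤ k := by exact_mod_cast hkpos
  have hMC : (M : ℝ) / #C ≤ (k : ℝ) ^ N := by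
    rw [div_le_iff₀ hC0]
    refine hCcard.trans ?_
    gcongr
  have hg2 : ∀ x, smoothing C f x ≤ 2 := by
    intro x
    refine (smoothing_le hC hfν hν0 hν x).trans ?_
    have : η * (M / #C) ≤ 1 / 4 := by
      calc η * (M / #C) ≤ 1 / (4 * (k : ℝ) ^ N) * (k : ℝ) ^ N := by gcongr
        _ = 1 / 4 := by field_simp
    linarith
  have hg0 : ∀ x, 0 ≤ smoothing C f x := fun x =>
    div_nonneg (Finset.sum_nonneg fun _ _ => Finset.sum_nonneg fun _ _ => hf0 _) (by positivity)
  have hg : ∑ x, smoothing C f x = ∑ x, f x := by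
    unfold smoothing
    rw [← Finset.sum_div, Finset.sum_comm, div_eq_iff (by positivity)]
    have : ∀ c ∈ C, ∑ x, ∑ c' ∈ C, f (x + (c - c')) = #C * ∑ x, f x := by
      intro c _
      rw [Finset.sum_comm]
      have : ∀ c' ∈ C, ∑ x, f (x + (c - c')) = ∑ x, f x := fun c' _ =>
        Equiv.sum_comp (Equiv.addRight (c - c')) f
      rw [Finset.sum_congr rfl this]
      simp
    rw [Finset.sum_congr rfl this]
    simp only [Finset.sum_const, nsmul_eq_mul]
    ring
  have hrothg := hroth (ZMod M) (smoothing C f) hg0 hg2 (by rw [hg, ZMod.card]; exact hfδ)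
  rw [ZMod.card] at hrothg
  have hκ1 : ∀ ξ ∈ S, ‖1 - smoothingMul C ξ‖ ≤ 2 * Real.pi / k := fun ξ hξ =>
    norm_one_sub_smoothingMul_le hC (hCS ξ hξ)
  have hκ2 : ∀ ξ ∈ S, ‖1 - smoothingMul C (-2 * ξ)‖ ≤ 2 * (2 * Real.pi / k) := by
    intro ξ hξ
    refine norm_one_sub_smoothingMul_le hC fun c hc c' hc' => ?_
    have e : -2 * ξ * (c' - c) = ξ * (c - c') + ξ * (c - c') := by ring
    have e2 : ∀ z : ℂ, z * z - 1 = (z + 1) * (z - 1) := fun z => by ring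
    rw [e, AddChar.map_add_eq_mul, e2, norm_mul]
    gcongr
    · refine (norm_add_le _ _).trans ?_
      rw [norm_stdAddChar, norm_one]
      norm_num
    · exact hCS ξ hξ c' hc' c hc
  have hmean : (∑ x, f x) / M ≤ 2 := by
    have h1 : (∑ x, f x) / M ≤ (∑ x, ν x) / M := by
      gcongr
      exact hfν _
    have h2 : |(∑ x, ν x) / M - 1| ≤ η := by
      rw [zfourier_zero] at hν0
      rw [← Real.norm_eq_abs, ← Complex.norm_real]
      push_cast at hν0 ⊢
      exact hν0
    have := (abs_le.1 h2).2
    linarith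
  have hcomp := norm_sum_triple_sub_le hM
    (fun ξ => (norm_zfourier_le f hf0 ξ).trans hmean) (hF.trans hF') Λ
    (fun ξ hξ => Finset.mem_filter.2 ⟨Finset.mem_univ _, hξ⟩) hΛ (smoothingMul C)
    (norm_smoothingMul_le_one C) (κ := 2 * Real.pi / k) (by positivity)
    (fun ξ hξ => by
      have hξS : ξ ∈ S := by
        rcases hξ with h | h
        · exact Finset.mem_union_left _ h
        · exact Finset.mem_union_right _ (Finset.mem_filter.2 ⟨Finset.mem_univ _, h⟩)
      exact ⟨hκ1 ξ hξS, hκ2 ξ hξS⟩)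
  simp_rw [← zfourier_smoothing] at hcomp
  rw [sum_zfourier_triple, sum_zfourier_triple, ← Complex.ofReal_sub, Complex.norm_real,
    Real.norm_eq_abs, ← sub_div, abs_le] at hcomp
  have herr : 64 * (2 * Real.pi / k) * (6 / ε ^ 2) + 4 * (49 * ε) ≤ c / 2 := by
    have h1 : 64 * (2 * Real.pi / k) * (6 / ε ^ 2) ≤ c / 4 := by
      have h2 : 64 * (2 * Real.pi) * (6 / ε ^ 2) * 4 / c ≤ k := by linarith
      rw [div_le_iff₀ hc] at h2
      rw [show 64 * (2 * Real.pi / k) * (6 / ε ^ 2) = 64 * (2 * Real.pi) * (6 / ε ^ 2) / k by ring,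
        div_le_iff₀ hkR]
      linarith
    have h3 : 4 * (49 * ε) ≤ c / 4 := by
      rw [hε_def]
      linarith
    linarith
  have hM2 : (0 : ℝ) < (M : ℝ) ^ 2 := by positivity
  have h1 := hcomp.1.trans' (neg_le_neg herr)
  rw [le_div_iff₀ hM2] at h1
  linarith

end Transference

section SelbergWeights

open Finset ArithmeticFunction ArithmeticFunction.Moebius
open scoped Nat

/-- The sum of `1 / φ d` over `D`. -/
noncomputable def selbergSum (D : Finset ℕ) : ℝ := ∑ d ∈ D, (φ d : ℝ)⁻¹

/-- Selberg's optimal weights for the sieve with levels in `D`. -/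
noncomputable def selbergWeight (D : Finset ℕ) (d : ℕ) : ℝ :=
  μ d * d * (∑ r ∈ D with d ∣ r, (φ r : ℝ)⁻¹) / selbergSum D

variable {D : Finset ℕ} (hsq : ∀ d ∈ D, Squarefree d) (hdiv : ∀ d ∈ D, ∀ e, e ∣ d → e ∈ D)

include hsq hdiv in
lemma sum_inv_totient_dvd_le (k : ℕ) :
    ∑ r ∈ D with k ∣ r, (φ r : ℝ)⁻¹ ≤ (φ k : ℝ)⁻¹ * selbergSum D := by
  have h1 : ∀ r ∈ D.filter (k ∣ ·), (φ r : ℝ)⁻¹ = (φ k : ℝ)⁻¹ * (φ (r / k) : ℝ)⁻¹ := by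
    intro r hr
    obtain ⟨hr, m, rfl⟩ := Finset.mem_filter.1 hr
    have hk : 0 < k := Nat.pos_of_ne_zero fun h => (hsq _ hr).ne_zero (by simp [h])
    rw [Nat.mul_div_cancel_left _ hk, Nat.totient_mul (Nat.coprime_of_squarefree_mul (hsq _ hr)),
      Nat.cast_mul, mul_inv]
  rw [Finset.sum_congr rfl h1, ← Finset.mul_sum]
  have h2 : Set.InjOn (· / k) (D.filter (k ∣ ·) : Set ℕ) := by
    intro a ha b hb hab
    obtain ⟨ha, m, rfl⟩ := Finset.mem_filter.1 ha
    obtain ⟨hb, n, rfl⟩ := Finset.mem_filter.1 hb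
    have hk : 0 < k := Nat.pos_of_ne_zero fun h => (hsq _ ha).ne_zero (by simp [h])
    simp only [Nat.mul_div_cancel_left _ hk] at hab
    rw [hab]
  rw [← Finset.sum_image (f := fun r : ℕ => (φ r : ℝ)⁻¹) h2, selbergSum]
  gcongr ?_ * ?_
  refine Finset.sum_le_sum_of_subset_of_nonneg ?_ fun _ _ _ => by positivity
  intro m hm
  obtain ⟨r, hr, rfl⟩ := Finset.mem_image.1 hm
  obtain ⟨hr, m, rfl⟩ := Finset.mem_filter.1 hr
  exact hdiv _ hr _ (Nat.div_dvd_of_dvd (dvd_mul_right _ _))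

lemma one_le_selbergSum (h1 : 1 ∈ D) : 1 ≤ selbergSum D := by
  have := Finset.single_le_sum (f := fun d : ℕ => (φ d : ℝ)⁻¹) (fun d _ => by positivity) h1
  simpa [selbergSum] using this

lemma selbergWeight_one (h1 : 1 ∈ D) : selbergWeight D 1 = 1 := by
  have h := one_le_selbergSum h1
  have : (∑ r ∈ D with 1 ∣ r, (φ r : ℝ)⁻¹) = selbergSum D := by
    simp [selbergSum]
  rw [selbergWeight, this]
  have : selbergSum D ≠ 0 := by linarith
  simp [this]

include hsq hdiv in
lemma abs_selbergWeight_div_le (h1 : 1 ∈ D) {d : ℕ} (hd : d ∈ D) :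
    |selbergWeight D d| / d ≤ (φ d : ℝ)⁻¹ := by
  have h := one_le_selbergSum h1
  have hd0 : 0 < d := Nat.pos_of_ne_zero (hsq d hd).ne_zero
  have hd1 : (0 : ℝ) < d := Nat.cast_pos.2 hd0
  have h0 : 0 ≤ ∑ r ∈ D with d ∣ r, (φ r : ℝ)⁻¹ := by positivity
  have hμ : |(μ d : ℝ)| = 1 := by
    have := abs_moebius_eq_one_of_squarefree (hsq d hd)
    exact_mod_cast this
  rw [selbergWeight, abs_div, abs_mul, abs_mul, hμ, abs_of_pos hd1, abs_of_nonneg h0,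
    abs_of_pos (by linarith : 0 < selbergSum D), div_div, div_le_iff₀ (by positivity), one_mul]
  have := sum_inv_totient_dvd_le hsq hdiv d
  nlinarith

include hdiv in
lemma sum_mul_div_lcm (hpos : ∀ d ∈ D, 0 < d) (f g : ℕ → ℝ) :
    ∑ d ∈ D, ∑ e ∈ D, f d * g e / (Nat.lcm d e) =
      ∑ k ∈ D, (φ k : ℝ) * (∑ d ∈ D with k ∣ d, f d / d) * (∑ e ∈ D with k ∣ e, g e / e) := by
  have h1 : ∀ d ∈ D, ∀ e ∈ D, f d * g e / (Nat.lcm d e) =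
      ∑ k ∈ D, (φ k : ℝ) * (if k ∣ d then f d / d else 0) * (if k ∣ e then g e / e else 0) := by
    intro d hd e he
    have hd0 : (d : ℝ) ≠ 0 := Nat.cast_ne_zero.2 (hpos d hd).ne'
    have he0 : (e : ℝ) ≠ 0 := Nat.cast_ne_zero.2 (hpos e he).ne'
    have h2 : ((Nat.gcd d e : ℕ) : ℝ) = ∑ k ∈ D, if k ∣ d ∧ k ∣ e then (φ k : ℝ) else 0 := by
      rw [← Finset.sum_filter, ← Nat.sum_totient (Nat.gcd d e), Nat.cast_sum]
      refine Finset.sum_congr ?_ fun _ _ => rfl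
      ext k
      simp only [Nat.mem_divisors, Finset.mem_filter, Nat.dvd_gcd_iff]
      have : Nat.gcd d e ≠ 0 := Nat.gcd_ne_zero_left (hpos d hd).ne'
      exact ⟨fun h => ⟨hdiv d hd k h.1.1, h.1⟩, fun h => ⟨h.2, this⟩⟩
    have h3 : ((Nat.lcm d e : ℕ) : ℝ) * (Nat.gcd d e : ℕ) = d * e := by
      rw [mul_comm]
      exact_mod_cast Nat.gcd_mul_lcm d e
    have h4 : ((Nat.lcm d e : ℕ) : ℝ) ≠ 0 :=
      Nat.cast_ne_zero.2 (Nat.lcm_ne_zero (hpos d hd).ne' (hpos e he).ne')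
    calc f d * g e / (Nat.lcm d e) = (Nat.gcd d e : ℕ) * ((f d / d) * (g e / e)) := by
          field_simp
          linear_combination -f d * g e * h3
      _ = _ := by
          rw [h2, Finset.sum_mul]
          refine Finset.sum_congr rfl fun k _ => ?_
          by_cases a : k ∣ d <;> by_cases b : k ∣ e <;> simp [a, b, mul_assoc]
  rw [Finset.sum_congr rfl fun d hd => Finset.sum_congr rfl (h1 d hd)]
  have h5 : ∀ d ∈ D, ∑ e ∈ D, ∑ k ∈ D, (φ k : ℝ) * (if k ∣ d then f d / d else 0) *
      (if k ∣ e then g e / e else 0) = ∑ k ∈ D, ∑ e ∈ D,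
      (φ k : ℝ) * (if k ∣ d then f d / d else 0) * (if k ∣ e then g e / e else 0) :=
    fun d _ => Finset.sum_comm
  rw [Finset.sum_congr rfl h5, Finset.sum_comm]
  refine Finset.sum_congr rfl fun k _ => ?_
  rw [Finset.sum_filter, Finset.sum_filter, mul_assoc, Finset.sum_mul_sum, Finset.mul_sum]
  refine Finset.sum_congr rfl fun d _ => ?_
  rw [Finset.mul_sum]
  exact Finset.sum_congr rfl fun e _ => by ring

include hsq hdiv in
lemma sum_selbergWeight_div {k : ℕ} (hk : k ∈ D) :
    ∑ d ∈ D with k ∣ d, selbergWeight D d / d = μ k * (φ k : ℝ)⁻¹ / selbergSum D := by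
  have h1 : ∀ d ∈ D.filter (k ∣ ·), selbergWeight D d / d =
      (∑ r ∈ D, if d ∣ r then (μ d : ℝ) * (φ r : ℝ)⁻¹ else 0) / selbergSum D := by
    intro d hd
    have hd0 : (d : ℝ) ≠ 0 := Nat.cast_ne_zero.2 (hsq d (Finset.mem_filter.1 hd).1).ne_zero
    rw [← Finset.sum_filter, ← Finset.mul_sum, selbergWeight]
    field_simp
  rw [Finset.sum_congr rfl h1, ← Finset.sum_div, Finset.sum_comm]
  congr 1
  have h2 : ∀ r ∈ D, ∑ d ∈ D with k ∣ d, (if d ∣ r then (μ d : ℝ) * (φ r : ℝ)⁻¹ else 0) =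
      if r = k then (μ k : ℝ) * (φ k : ℝ)⁻¹ else 0 := by
    intro r hr
    by_cases hkr : k ∣ r
    swap
    · have : r ≠ k := fun h => hkr (h ▸ dvd_rfl)
      rw [if_neg this]
      refine Finset.sum_eq_zero fun d hd => if_neg fun h => hkr ?_
      exact (Finset.mem_filter.1 hd).2.trans h
    obtain ⟨m, rfl⟩ := hkr
    have hkm := hsq _ hr
    have hk0 : 0 < k := Nat.pos_of_ne_zero fun h => hkm.ne_zero (by simp [h])
    have hm0 : m ≠ 0 := fun h => hkm.ne_zero (by simp [h])
    rw [← Finset.sum_filter, ← Finset.sum_mul, Finset.filter_filter]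
    have h3 : D.filter (fun d => k ∣ d ∧ d ∣ k * m) = m.divisors.image (k * ·) := by
      ext d
      simp only [Finset.mem_filter, Finset.mem_image, Nat.mem_divisors]
      constructor
      · rintro ⟨-, ⟨n, rfl⟩, h⟩
        exact ⟨n, ⟨Nat.dvd_of_mul_dvd_mul_left hk0 h, hm0⟩, rfl⟩
      · rintro ⟨n, ⟨h, -⟩, rfl⟩
        have := Nat.mul_dvd_mul_left k h
        exact ⟨hdiv _ hr _ this, dvd_mul_right _ _, this⟩
    have h4 : ∑ d ∈ m.divisors.image (k * ·), (μ d : ℝ) =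
        μ k * ((∑ n ∈ m.divisors, μ n : ℤ) : ℝ) := by
      rw [Finset.sum_image fun a _ b _ h => Nat.eq_of_mul_eq_mul_left hk0 h]
      push_cast
      rw [Finset.mul_sum]
      refine Finset.sum_congr rfl fun n hn => ?_
      rw [isMultiplicative_moebius.map_mul_of_coprime, Int.cast_mul]
      exact (Nat.coprime_of_squarefree_mul hkm).coprime_dvd_right (Nat.dvd_of_mem_divisors hn)
    rw [h3, h4, ← coe_mul_zeta_apply, moebius_mul_coe_zeta, one_apply]
    by_cases hm : m = 1
    · simp [hm]
    · have : k * m ≠ k := fun h => hm (by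
        have h' : k * m = k * 1 := by rw [h, mul_one]
        exact Nat.eq_of_mul_eq_mul_left hk0 h')
      simp [hm, this]
  rw [Finset.sum_congr rfl h2, Finset.sum_ite_eq' D k, if_pos hk]

include hsq hdiv in
lemma sum_selbergWeight_mul_div_lcm (h1 : 1 ∈ D) :
    ∑ d ∈ D, ∑ e ∈ D, selbergWeight D d * selbergWeight D e / (Nat.lcm d e) =
      (selbergSum D)⁻¹ := by
  have hG := one_le_selbergSum h1
  have hpos : ∀ d ∈ D, 0 < d := fun d hd => Nat.pos_of_ne_zero (hsq d hd).ne_zero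
  rw [sum_mul_div_lcm hdiv hpos]
  have : ∀ k ∈ D, (φ k : ℝ) * (∑ d ∈ D with k ∣ d, selbergWeight D d / d) *
      (∑ d ∈ D with k ∣ d, selbergWeight D d / d) = (φ k : ℝ)⁻¹ / selbergSum D ^ 2 := by
    intro k hk
    have h2 : (φ k : ℝ) ≠ 0 := Nat.cast_ne_zero.2 (Nat.totient_pos.2 (hpos k hk)).ne'
    have h3 : (μ k : ℝ) ^ 2 = 1 := by
      exact_mod_cast moebius_sq_eq_one_of_squarefree (hsq k hk)
    rw [sum_selbergWeight_div hsq hdiv hk]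
    field_simp
    exact h3
  rw [Finset.sum_congr rfl this, ← Finset.sum_div, ← selbergSum, sq, div_mul_cancel_left₀ (by linarith)]

include hsq hdiv in
lemma sum_inv_totient_prime_dvd_le (h1 : 1 ∈ D) {p : ℕ} (hp : p.Prime) :
    ∑ k ∈ D, ∑ d ∈ D with k ∣ d ∧ p ∣ d, (φ d : ℝ)⁻¹ ≤ 2 * selbergSum D ^ 2 / (p - 1) := by
  have hp1 : (0 : ℝ) < p - 1 := sub_pos.2 (by exact_mod_cast hp.one_lt)
  have hG := one_le_selbergSum h1
  have hφp : (φ p : ℝ) = p - 1 := by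
    rw [Nat.totient_prime hp, Nat.cast_sub hp.one_le, Nat.cast_one]
  have h2 : ∀ k ∈ D, ∑ d ∈ D with k ∣ d ∧ p ∣ d, (φ d : ℝ)⁻¹ ≤
      (φ k : ℝ)⁻¹ * (selbergSum D / (p - 1)) +
        (if p ∣ k then (φ k : ℝ)⁻¹ else 0) * selbergSum D := by
    intro k hk
    split_ifs with h
    · have h3 : ∑ d ∈ D with k ∣ d ∧ p ∣ d, (φ d : ℝ)⁻¹ ≤ ∑ d ∈ D with k ∣ d, (φ d : ℝ)⁻¹ := by
        refine Finset.sum_le_sum_of_subset_of_nonneg ?_ fun _ _ _ => by positivity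
        exact Finset.monotone_filter_right _ fun _ _ h => h.1
      have h4 := sum_inv_totient_dvd_le hsq hdiv k
      have : 0 ≤ (φ k : ℝ)⁻¹ * (selbergSum D / (p - 1)) := by positivity
      linarith
    · have hc : Nat.Coprime k p := ((Nat.Prime.coprime_iff_not_dvd hp).2 h).symm
      have h3 : D.filter (fun d => k ∣ d ∧ p ∣ d) ⊆ D.filter (k * p ∣ ·) :=
        Finset.monotone_filter_right _ fun _ _ h => hc.mul_dvd_of_dvd_of_dvd h.1 h.2
      have h4 := Finset.sum_le_sum_of_subset_of_nonneg (f := fun d : ℕ => (φ d : ℝ)⁻¹) h3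
        fun _ _ _ => by positivity
      have h5 := sum_inv_totient_dvd_le hsq hdiv (k * p)
      rw [Nat.totient_mul hc, Nat.cast_mul, hφp, mul_inv] at h5
      rw [zero_mul, add_zero]
      refine (h4.trans h5).trans_eq ?_
      rw [div_eq_mul_inv]
      ring
  refine (Finset.sum_le_sum h2).trans ?_
  rw [Finset.sum_add_distrib, ← Finset.sum_mul, ← Finset.sum_mul, ← Finset.sum_filter, ← selbergSum]
  have h6 := sum_inv_totient_dvd_le hsq hdiv p
  rw [hφp] at h6
  calc _ ≤ selbergSum D * (selbergSum D / (p - 1)) + (((p : ℝ) - 1)⁻¹ * selbergSum D) * selbergSum D := by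
        gcongr
    _ = _ := by rw [div_eq_mul_inv, div_eq_mul_inv]; ring

include hsq hdiv in
/-- Contribution of the levels divisible by a fixed prime to the sum of the weights. -/
lemma sum_abs_selbergWeight_prime_dvd_le (h1 : 1 ∈ D) {p : ℕ} (hp : p.Prime) :
    ∑ d ∈ D, ∑ e ∈ D, (if p ∣ Nat.lcm d e then
      |selbergWeight D d| * |selbergWeight D e| / (Nat.lcm d e) else 0) ≤
      4 * selbergSum D ^ 3 / (p - 1) := by
  have hG := one_le_selbergSum h1
  have hpos : ∀ d ∈ D, 0 < d := fun d hd => Nat.pos_of_ne_zero (hsq d hd).ne_zero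
  set F : ℕ → ℝ := fun d => if p ∣ d then |selbergWeight D d| else 0 with hF
  set H : ℕ → ℝ := fun d => |selbergWeight D d| with hH
  have key : ∑ d ∈ D, ∑ e ∈ D, F d * H e / (Nat.lcm d e) ≤ 2 * selbergSum D ^ 3 / (p - 1) := by
    rw [sum_mul_div_lcm hdiv hpos]
    have h2 : ∀ k ∈ D, (φ k : ℝ) * (∑ d ∈ D with k ∣ d, F d / d) * (∑ e ∈ D with k ∣ e, H e / e) ≤
        (∑ d ∈ D with k ∣ d ∧ p ∣ d, (φ d : ℝ)⁻¹) * selbergSum D := by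
      intro k hk
      have h3 : ∑ e ∈ D with k ∣ e, H e / e ≤ (φ k : ℝ)⁻¹ * selbergSum D :=
        (Finset.sum_le_sum fun e he => abs_selbergWeight_div_le hsq hdiv h1
          (Finset.mem_filter.1 he).1).trans (sum_inv_totient_dvd_le hsq hdiv k)
      have h4 : ∑ d ∈ D with k ∣ d, F d / d ≤ ∑ d ∈ D with k ∣ d ∧ p ∣ d, (φ d : ℝ)⁻¹ := by
        rw [← Finset.filter_filter, Finset.sum_filter (fun d => p ∣ d)]
        refine Finset.sum_le_sum fun d hd => ?_
        simp only [hF]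
        split_ifs
        · exact abs_selbergWeight_div_le hsq hdiv h1 (Finset.mem_filter.1 hd).1
        · simp
      have h5 : (φ k : ℝ) ≠ 0 := Nat.cast_ne_zero.2 (Nat.totient_pos.2 (hpos k hk)).ne'
      calc _ ≤ (φ k : ℝ) * (∑ d ∈ D with k ∣ d ∧ p ∣ d, (φ d : ℝ)⁻¹) *
            ((φ k : ℝ)⁻¹ * selbergSum D) := by
            gcongr
        _ = _ := by field_simp
    refine (Finset.sum_le_sum h2).trans ?_
    rw [← Finset.sum_mul]
    have := sum_inv_totient_prime_dvd_le hsq hdiv h1 hp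
    calc _ ≤ 2 * selbergSum D ^ 2 / (p - 1) * selbergSum D := by gcongr
      _ = _ := by ring
  have hsymm : ∑ d ∈ D, ∑ e ∈ D, H d * F e / (Nat.lcm d e) =
      ∑ d ∈ D, ∑ e ∈ D, F d * H e / (Nat.lcm d e) := by
    rw [Finset.sum_comm]
    exact Finset.sum_congr rfl fun d _ => Finset.sum_congr rfl fun e _ => by
      rw [Nat.lcm_comm, mul_comm]
  have hle : ∀ d ∈ D, ∀ e ∈ D, (if p ∣ Nat.lcm d e then
      |selbergWeight D d| * |selbergWeight D e| / (Nat.lcm d e) else 0) ≤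
      F d * H e / (Nat.lcm d e) + H d * F e / (Nat.lcm d e) := by
    intro d _ e _
    have h0 : 0 ≤ |selbergWeight D d| * |selbergWeight D e| / (Nat.lcm d e) := by positivity
    simp only [hF, hH]
    by_cases a : p ∣ d <;> by_cases b : p ∣ e <;> simp [a, b, hp.dvd_lcm]
    positivity
  refine (Finset.sum_le_sum fun d hd => Finset.sum_le_sum (hle d hd)).trans ?_
  simp_rw [Finset.sum_add_distrib]
  rw [hsymm]
  calc _ ≤ 2 * selbergSum D ^ 3 / (p - 1) + 2 * selbergSum D ^ 3 / (p - 1) := add_le_add key key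
    _ = _ := by ring

end SelbergWeights

section ProgressionSums

open Finset ZMod

lemma exists_dvd_add_mul_iff_mod_eq (a : ℕ) {W e : ℕ} (he : 0 < e) (hW : Nat.Coprime W e) :
    ∃ n₀ < e, ∀ n, e ∣ a + W * n ↔ n % e = n₀ := by
  have : NeZero e := ⟨he.ne'⟩
  have hu : (W : ZMod e) * (W : ZMod e)⁻¹ = 1 := ZMod.coe_mul_inv_eq_one W hW
  refine ⟨(-(a : ZMod e) * (W : ZMod e)⁻¹).val, ZMod.val_lt _, fun n => ?_⟩
  rw [← ZMod.natCast_eq_zero_iff, ← ZMod.val_natCast, (ZMod.val_injective e).eq_iff]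
  push_cast
  constructor
  · intro h
    linear_combination (W : ZMod e)⁻¹ * h - n * hu
  · intro h
    linear_combination (W : ZMod e) * h - a * hu

lemma exists_sum_pow_filter_mod_eq (M : ℕ) {e n₀ : ℕ} (h : n₀ < e) :
    ∃ J, e * J ≤ M + e ∧ M ≤ e * J + e ∧ ∀ z : ℂ,
      ∑ n ∈ range M with n % e = n₀, z ^ n = z ^ n₀ * ∑ j ∈ range J, (z ^ e) ^ j := by
  have he : 0 < e := by omega
  have h1 := Nat.div_mul_le_self (M + (e - 1 - n₀)) e
  have h2 := Nat.lt_div_mul_add he (a := M + (e - 1 - n₀))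
  refine ⟨(M + (e - 1 - n₀)) / e, ?_, ?_, fun z => ?_⟩
  · rw [mul_comm]
    omega
  · rw [mul_comm]
    omega
  have h3 : (range M).filter (fun n => n % e = n₀) =
      (range ((M + (e - 1 - n₀)) / e)).image (fun j => n₀ + e * j) := by
    ext n
    simp only [Finset.mem_filter, Finset.mem_range, Finset.mem_image]
    constructor
    · rintro ⟨hn, hm⟩
      refine ⟨n / e, ?_, by rw [← hm, Nat.mod_add_div]⟩
      rw [Nat.lt_iff_add_one_le, Nat.le_div_iff_mul_le he]
      have := Nat.mod_add_div n e
      rw [hm] at this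
      rw [add_mul, mul_comm]
      omega
    · rintro ⟨j, hj, rfl⟩
      rw [Nat.lt_iff_add_one_le, Nat.le_div_iff_mul_le he, add_mul, mul_comm] at hj
      refine ⟨by omega, ?_⟩
      rw [Nat.add_mul_mod_self_left, Nat.mod_eq_of_lt h]
  rw [h3, Finset.sum_image, Finset.mul_sum]
  · exact Finset.sum_congr rfl fun j _ => by rw [pow_add, pow_mul]
  · intro i _ j _ hij
    exact Nat.eq_of_mul_eq_mul_left he (by simpa using hij)

variable {M : ℕ} [NeZero M]

/-- The exponential sum over the `x` with `e ∣ a + W * x`. -/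
noncomputable def progSum (a W e : ℕ) (ξ : ZMod M) : ℂ :=
  ∑ x : ZMod M with e ∣ a + W * x.val, (stdAddChar (ξ * x) : ℂ)

lemma exists_progSum_eq (M : ℕ) [NeZero M] (a : ℕ) {W e : ℕ} (he : 0 < e)
    (hW : Nat.Coprime W e) :
    ∃ n₀ J, e * J ≤ M + e ∧ M ≤ e * J + e ∧ ∀ ξ : ZMod M, progSum a W e ξ =
      (stdAddChar ξ : ℂ) ^ n₀ * ∑ j ∈ range J, ((stdAddChar ξ : ℂ) ^ e) ^ j := by
  obtain ⟨n₀, hn₀, h⟩ := exists_dvd_add_mul_iff_mod_eq a he hW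
  obtain ⟨J, h1, h2, h3⟩ := exists_sum_pow_filter_mod_eq M hn₀
  refine ⟨n₀, J, h1, h2, fun ξ => ?_⟩
  rw [← h3, progSum]
  refine Finset.sum_bij' (fun x _ => x.val) (fun n _ => (n : ZMod M)) ?_ ?_ ?_ ?_ ?_
  · intro x hx
    rw [Finset.mem_filter] at hx ⊢
    exact ⟨Finset.mem_range.2 (ZMod.val_lt x), (h _).1 hx.2⟩
  · intro n hn
    rw [Finset.mem_filter, Finset.mem_range] at hn
    rw [Finset.mem_filter, ZMod.val_cast_of_lt hn.1]
    exact ⟨Finset.mem_univ _, (h _).2 hn.2⟩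
  · intro x _
    exact ZMod.natCast_zmod_val x
  · intro n hn
    rw [Finset.mem_filter, Finset.mem_range] at hn
    exact ZMod.val_cast_of_lt hn.1
  · intro x _
    rw [← AddChar.map_nsmul_eq_pow, nsmul_eq_mul, ZMod.natCast_zmod_val, mul_comm]

lemma norm_progSum_le (a : ℕ) {W e : ℕ} (he : 0 < e) (hW : Nat.Coprime W e) (ξ : ZMod M) :
    ‖progSum a W e ξ‖ ≤ M / e + 1 := by
  obtain ⟨n₀, J, h1, -, h3⟩ := exists_progSum_eq M a he hW
  have heR : (0 : ℝ) < e := Nat.cast_pos.2 he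
  rw [h3, norm_mul, norm_pow, norm_stdAddChar, one_pow, one_mul]
  refine (norm_sum_le _ _).trans ?_
  simp only [norm_pow, norm_stdAddChar, one_pow, Finset.sum_const, Finset.card_range, nsmul_eq_mul,
    mul_one]
  rw [← sub_le_iff_le_add, le_div_iff₀ heR]
  have : (e : ℝ) * J ≤ M + e := by exact_mod_cast h1
  linarith

lemma norm_progSum_zero_sub_le (a : ℕ) {W e : ℕ} (he : 0 < e) (hW : Nat.Coprime W e) :
    ‖progSum a W e (0 : ZMod M) - M / e‖ ≤ 1 := by
  obtain ⟨n₀, J, h1, h2, h3⟩ := exists_progSum_eq M a he hW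
  have heR : (0 : ℝ) < e := Nat.cast_pos.2 he
  have h4 : progSum a W e (0 : ZMod M) - M / e = ((J - M / e : ℝ) : ℂ) := by
    rw [h3]
    simp
  have h1' : (e : ℝ) * J ≤ M + e := by exact_mod_cast h1
  have h2' : (M : ℝ) ≤ e * J + e := by exact_mod_cast h2
  have e1 : (M : ℝ) = M / e * e := by field_simp
  rw [h4, Complex.norm_real, Real.norm_eq_abs, abs_le]
  constructor <;> nlinarith

lemma le_norm_exp_sub_one {x δ : ℝ} (h : ∀ m : ℤ, δ ≤ |x - m|) :
    4 * δ ≤ ‖Complex.exp (Complex.I * ((2 * Real.pi * x : ℝ) : ℂ)) - 1‖ := by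
  set y : ℝ := x - round x with hy
  have h1 : Complex.exp (Complex.I * ((2 * Real.pi * x : ℝ) : ℂ)) =
      Complex.exp (Complex.I * ((2 * Real.pi * y : ℝ) : ℂ)) := by
    rw [Complex.exp_eq_exp_iff_exists_int]
    refine ⟨round x, ?_⟩
    rw [hy]
    push_cast
    ring
  rw [h1, Complex.norm_exp_I_mul_ofReal_sub_one]
  have h2 : |y| ≤ 1 / 2 := abs_sub_round x
  have h3 : 2 * Real.pi * y / 2 = Real.pi * y := by ring
  have h4 : |Real.pi * y| = Real.pi * |y| := by rw [abs_mul, abs_of_pos Real.pi_pos]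
  have h5 : 2 / Real.pi * |Real.pi * y| ≤ |Real.sin (Real.pi * y)| :=
    Real.mul_abs_le_abs_sin (by rw [h4]; nlinarith [Real.pi_pos])
  have h6 : 2 / Real.pi * |Real.pi * y| = 2 * |y| := by
    rw [h4]
    field_simp
  rw [h3, norm_mul, Real.norm_ofNat, Real.norm_eq_abs]
  have := h (round x)
  linarith

lemma norm_exp_sub_one_le (x : ℝ) (m : ℤ) :
    ‖Complex.exp (Complex.I * ((2 * Real.pi * x : ℝ) : ℂ)) - 1‖ ≤ 2 * Real.pi * |x - m| := by
  have h1 : Complex.exp (Complex.I * ((2 * Real.pi * x : ℝ) : ℂ)) =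
      Complex.exp (Complex.I * ((2 * Real.pi * (x - m) : ℝ) : ℂ)) := by
    rw [Complex.exp_eq_exp_iff_exists_int]
    refine ⟨m, ?_⟩
    push_cast
    ring
  rw [h1]
  refine Real.norm_exp_I_mul_ofReal_sub_one_le.trans_eq ?_
  rw [Real.norm_eq_abs, abs_mul, abs_of_pos Real.two_pi_pos]

lemma norm_pow_sub_pow_le {z : ℂ} (hz : ‖z‖ = 1) {m n : ℕ} (h : m ≤ n) :
    ‖z ^ n - z ^ m‖ ≤ (n - m : ℕ) * ‖z - 1‖ := by
  obtain ⟨k, rfl⟩ := Nat.exists_eq_add_of_le h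
  have e : z ^ (m + k) - z ^ m = z ^ m * ((∑ i ∈ range k, z ^ i) * (z - 1)) := by
    rw [geom_sum_mul, pow_add]
    ring
  rw [e, norm_mul, norm_pow, hz, one_pow, one_mul, norm_mul, Nat.add_sub_cancel_left]
  gcongr
  refine (norm_sum_le _ _).trans ?_
  simp [hz]

/-- Bounds for the exponential sums over progressions with moduli up to `B` away from a
single denominator `q`. -/
lemma exists_denominator_progSum_le {B : ℕ} (hB : 0 < B) {ξ : ZMod M} (hξ : ξ ≠ 0) :
    ∃ q : ℕ, 0 < q ∧ ∀ a W e : ℕ, 0 < e → e ≤ B → Nat.Coprime W e → (¬ q ∣ e ∨ q = 1) →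
      ‖progSum a W e ξ‖ ≤ 2 * B := by
  have hMR : (0 : ℝ) < M := Nat.cast_pos.2 (NeZero.pos M)
  have hBR : (1 : ℝ) ≤ B := by exact_mod_cast hB
  set θ : ℝ := ξ.val / M with hθ
  obtain ⟨r, hr1, hr2⟩ := Real.exists_rat_abs_sub_le_and_den_le θ (n := 2 * B) (by omega)
  have hz : ∀ n : ℕ, (stdAddChar ξ : ℂ) ^ n =
      Complex.exp (Complex.I * ((2 * Real.pi * (n * θ) : ℝ) : ℂ)) := by
    intro n
    conv_lhs => rw [← ZMod.natCast_zmod_val ξ]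
    have := stdAddChar_coe (N := M) (ξ.val : ℤ)
    rw [Int.cast_natCast] at this
    rw [this, ← Complex.exp_nat_mul]
    congr 1
    rw [hθ]
    push_cast
    ring
  have hq : (0 : ℝ) < r.den := Nat.cast_pos.2 r.pos
  have hq1 : (1 : ℝ) ≤ r.den := by exact_mod_cast r.pos
  refine ⟨r.den, r.pos, fun a W e he heB hW hqe => ?_⟩
  have heR : (0 : ℝ) < e := Nat.cast_pos.2 he
  have heBR : (e : ℝ) ≤ B := Nat.cast_le.2 heB
  have hβ : |e * θ - e * (r : ℝ)| ≤ 1 / (2 * r.den) := by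
    rw [← mul_sub, abs_mul, abs_of_pos heR]
    calc (e : ℝ) * |θ - r| ≤ B * (1 / (((2 * B : ℕ) + 1) * r.den)) := by gcongr
      _ ≤ _ := by
        rw [mul_one_div, div_le_div_iff₀ (by positivity) (by positivity)]
        push_cast
        nlinarith
  obtain ⟨n₀, J, h1, h2, h3⟩ := exists_progSum_eq M a he hW
  set z : ℂ := stdAddChar ξ with hz_def
  have hz1 : ‖z‖ = 1 := norm_stdAddChar ξ
  have hS : ‖progSum a W e ξ‖ * ‖z ^ e - 1‖ = ‖z ^ (e * J) - 1‖ := by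
    rw [h3, norm_mul, norm_pow, hz1, one_pow, one_mul, ← norm_mul, geom_sum_mul, ← pow_mul]
  by_cases hd : r.den ∣ e
  · have hq1 : r.den = 1 := hqe.resolve_left fun h => h hd
    have hrn : (r : ℝ) = (r.num : ℝ) := by
      conv_lhs => rw [← Rat.num_div_den r, hq1]
      simp
    rw [hq1, hrn] at hβ
    have hne : 0 < |θ - r.num| := by
      rw [abs_pos, sub_ne_zero]
      intro h
      have hv : (0 : ℝ) < ξ.val := Nat.cast_pos.2 (Nat.pos_of_ne_zero fun h0 =>
        hξ ((ZMod.val_eq_zero ξ).1 h0))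
      have hv1 : (ξ.val : ℝ) < M := Nat.cast_lt.2 (ZMod.val_lt ξ)
      have t0 : 0 < θ := div_pos hv hMR
      have t1 : θ < 1 := (div_lt_one hMR).2 hv1
      rw [h] at t0 t1
      have t0' : 0 < r.num := by exact_mod_cast t0
      have t1' : r.num < 1 := by exact_mod_cast t1
      omega
    have hlow : 4 * (e * |θ - r.num|) ≤ ‖z ^ e - 1‖ := by
      rw [hz]
      refine le_norm_exp_sub_one fun m => ?_
      have e1 : e * |θ - r.num| = |e * θ - e * (r.num : ℝ)| := by
        rw [← mul_sub, abs_mul, abs_of_pos heR]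
      rw [e1]
      by_cases hm : m = e * r.num
      · rw [hm]
        push_cast
        exact le_rfl
      · have h5 : (1 : ℝ) ≤ |(e * r.num - m : ℝ)| := by
          have : (1 : ℤ) ≤ |(e * r.num - m : ℤ)| := Int.one_le_abs (sub_ne_zero.2 (Ne.symm hm))
          exact_mod_cast this
        have h6 : |(e * r.num - m : ℝ)| ≤ |e * θ - e * (r.num : ℝ)| + |e * θ - m| := by
          rw [abs_sub_comm (e * θ) (e * (r.num : ℝ))]
          exact abs_sub_le _ _ _
        norm_num at hβ
        linarith
    have hup : ‖z ^ (e * J) - 1‖ ≤ e * (2 * Real.pi * |θ - r.num|) := by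
      have hzM : z ^ M = 1 := by
        rw [hz_def, ← AddChar.map_nsmul_eq_pow, nsmul_eq_mul, ZMod.natCast_self, zero_mul,
          AddChar.map_zero_eq_one]
      have hz' : ‖z - 1‖ ≤ 2 * Real.pi * |θ - r.num| := by
        have := norm_exp_sub_one_le θ r.num
        have h7 := hz 1
        rw [pow_one, Nat.cast_one, one_mul] at h7
        rwa [h7]
      rw [← hzM]
      rcases le_total M (e * J) with h | h
      · refine (norm_pow_sub_pow_le hz1 h).trans ?_
        have : ((e * J - M : ℕ) : ℝ) ≤ e := Nat.cast_le.2 (by omega)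
        gcongr
      · rw [norm_sub_rev]
        refine (norm_pow_sub_pow_le hz1 h).trans ?_
        have : ((M - e * J : ℕ) : ℝ) ≤ e := Nat.cast_le.2 (by omega)
        gcongr
    have h8 : ‖progSum a W e ξ‖ * (4 * (e * |θ - r.num|)) ≤ e * (2 * Real.pi * |θ - r.num|) := by
      calc _ ≤ ‖progSum a W e ξ‖ * ‖z ^ e - 1‖ := by gcongr
        _ ≤ _ := hS ▸ hup
    have h9 : ‖progSum a W e ξ‖ * 4 ≤ 2 * Real.pi := by
      have : 0 < (e : ℝ) * |θ - r.num| := by positivity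
      refine le_of_mul_le_mul_right ?_ this
      linarith
    have := Real.pi_lt_four
    linarith
  · have hlow : 4 * (1 / (2 * (r.den : ℝ))) ≤ ‖z ^ e - 1‖ := by
      rw [hz]
      refine le_norm_exp_sub_one fun m => ?_
      have h5 : 1 / (r.den : ℝ) ≤ |e * (r : ℝ) - m| := by
        have h6 : e * (r : ℝ) - m = ((e * r.num - m * r.den : ℤ) : ℝ) / r.den := by
          conv_lhs => rw [← Rat.num_div_den r]
          push_cast
          field_simp
        rw [h6, abs_div, abs_of_pos hq]
        gcongr
        have h7 : (e * r.num - m * r.den : ℤ) ≠ 0 := by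
          intro h
          apply hd
          have h8 : (r.den : ℤ) ∣ e * r.num := ⟨m, by linear_combination h⟩
          have h9 : IsCoprime (r.den : ℤ) r.num := by
            rw [Int.isCoprime_iff_gcd_eq_one, Int.gcd_comm]
            exact r.reduced
          exact_mod_cast h9.dvd_of_dvd_mul_right h8
        have : (1 : ℤ) ≤ |(e * r.num - m * r.den : ℤ)| := Int.one_le_abs h7
        exact_mod_cast this
      have h6 : |e * (r : ℝ) - m| ≤ |e * θ - e * (r : ℝ)| + |e * θ - m| := by
        rw [abs_sub_comm (e * θ) (e * (r : ℝ))]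
        exact abs_sub_le _ _ _
      have h7 : 1 / (r.den : ℝ) = 1 / (2 * r.den) + 1 / (2 * r.den) := by
        field_simp
        norm_num
      linarith
    have hup : ‖z ^ (e * J) - 1‖ ≤ 2 := by
      refine (norm_sub_le _ _).trans ?_
      rw [norm_pow, hz1, one_pow, norm_one]
      norm_num
    have h8 : ‖progSum a W e ξ‖ * (4 * (1 / (2 * (r.den : ℝ)))) ≤ 2 := by
      calc _ ≤ ‖progSum a W e ξ‖ * ‖z ^ e - 1‖ := by gcongr
        _ ≤ _ := hS ▸ hup
    have h9 : 4 * (1 / (2 * (r.den : ℝ))) = 2 / r.den := by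
      field_simp
      norm_num
    rw [h9, mul_div_assoc', div_le_iff₀ hq] at h8
    have h10 : (r.den : ℝ) ≤ (2 * B : ℕ) := Nat.cast_le.2 hr2
    push_cast at h10
    linarith

end ProgressionSums

section Majorant

open Finset ZMod
open scoped Nat

variable {M : ℕ}

/-- Selberg's majorant of the primes in the progression `a + W * n`. -/
noncomputable def selbergMajorant (D : Finset ℕ) (W a : ℕ) (x : ZMod M) : ℝ :=
  selbergSum D * (∑ d ∈ D with d ∣ a + W * x.val, selbergWeight D d) ^ 2

lemma selbergMajorant_nonneg {D : Finset ℕ} (h1 : 1 ∈ D) (W a : ℕ) (x : ZMod M) :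
    0 ≤ selbergMajorant D W a x :=
  mul_nonneg (by linarith [one_le_selbergSum h1]) (sq_nonneg _)

lemma selbergMajorant_of_prime {D : Finset ℕ} (h1 : 1 ∈ D) {R W a : ℕ} (hR : ∀ d ∈ D, d ≤ R) {x : ZMod M}
    (hp : (a + W * x.val).Prime) (hx : R < a + W * x.val) :
    selbergMajorant D W a x = selbergSum D := by
  have : D.filter (· ∣ a + W * x.val) = {1} := by
    ext d
    rw [Finset.mem_filter, Finset.mem_singleton]
    constructor
    · rintro ⟨hd, h⟩
      refine (hp.eq_one_or_self_of_dvd d h).resolve_right fun h => ?_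
      have := hR d hd
      omega
    · rintro rfl
      exact ⟨h1, one_dvd _⟩
  rw [selbergMajorant, this, Finset.sum_singleton, selbergWeight_one h1, one_pow, mul_one]

variable [NeZero M]

lemma zfourier_selbergMajorant (D : Finset ℕ) (W a : ℕ) (ξ : ZMod M) :
    zfourier (selbergMajorant D W a) ξ = ∑ d ∈ D, ∑ e ∈ D, (selbergSum D : ℂ) *
      ((selbergWeight D d : ℂ) * selbergWeight D e * (progSum a W (Nat.lcm d e) ξ / M)) := by
  have h : ∀ x : ZMod M, (selbergMajorant D W a x : ℂ) * stdAddChar (ξ * x) =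
      ∑ d ∈ D, ∑ e ∈ D, (selbergSum D : ℂ) * ((selbergWeight D d : ℂ) * selbergWeight D e *
        (if Nat.lcm d e ∣ a + W * x.val then stdAddChar (ξ * x) else 0)) := by
    intro x
    rw [selbergMajorant, Finset.sum_filter, sq, Finset.sum_mul_sum]
    push_cast
    rw [mul_assoc, Finset.sum_mul, Finset.mul_sum]
    refine Finset.sum_congr rfl fun d _ => ?_
    rw [Finset.sum_mul, Finset.mul_sum]
    refine Finset.sum_congr rfl fun e _ => ?_
    simp only [Nat.lcm_dvd_iff]
    by_cases h1 : d ∣ a + W * x.val <;> by_cases h2 : e ∣ a + W * x.val <;> simp [h1, h2]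
  rw [zfourier, Finset.sum_congr rfl fun x _ => h x, Finset.sum_comm, Finset.sum_div]
  refine Finset.sum_congr rfl fun d _ => ?_
  rw [Finset.sum_comm, Finset.sum_div]
  refine Finset.sum_congr rfl fun e _ => ?_
  rw [← Finset.mul_sum, ← Finset.mul_sum, ← Finset.sum_filter, ← progSum]
  ring

variable {D : Finset ℕ} (hsq : ∀ d ∈ D, Squarefree d) (hdiv : ∀ d ∈ D, ∀ e, e ∣ d → e ∈ D)

include hsq hdiv in
lemma sum_abs_selbergWeight_le (h1 : 1 ∈ D) {R : ℕ} (hR : ∀ d ∈ D, d ≤ R) :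
    ∑ d ∈ D, ∑ e ∈ D, |selbergWeight D d| * |selbergWeight D e| ≤ (R : ℝ) ^ 4 := by
  have hpos : ∀ d ∈ D, 0 < d := fun d hd => Nat.pos_of_ne_zero (hsq d hd).ne_zero
  have h2 : ∀ d ∈ D, |selbergWeight D d| ≤ R := by
    intro d hd
    have hd0 : (0 : ℝ) < d := Nat.cast_pos.2 (hpos d hd)
    have h3 := abs_selbergWeight_div_le hsq hdiv h1 hd
    have h4 : (φ d : ℝ)⁻¹ ≤ 1 :=
      inv_le_one_of_one_le₀ (by exact_mod_cast Nat.totient_pos.2 (hpos d hd))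
    have h5 := h3.trans h4
    rw [div_le_one hd0] at h5
    exact h5.trans (Nat.cast_le.2 (hR d hd))
  have h3 : (#D : ℝ) ≤ R := by
    have : D ⊆ Finset.Icc 1 R := fun d hd => Finset.mem_Icc.2 ⟨hpos d hd, hR d hd⟩
    have := Finset.card_le_card this
    rw [Nat.card_Icc, Nat.add_sub_cancel] at this
    exact_mod_cast this
  rw [← Finset.sum_mul_sum]
  have h4 : ∑ d ∈ D, |selbergWeight D d| ≤ (R : ℝ) ^ 2 := by
    refine (Finset.sum_le_sum h2).trans ?_
    rw [Finset.sum_const, nsmul_eq_mul, sq]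
    gcongr
  calc _ ≤ (R : ℝ) ^ 2 * (R : ℝ) ^ 2 := by gcongr
    _ = _ := by ring

include hsq hdiv in
lemma norm_zfourier_selbergMajorant_zero_sub_one_le (h1 : 1 ∈ D) {R W : ℕ} (hR : ∀ d ∈ D, d ≤ R)
    (hW : ∀ d ∈ D, Nat.Coprime W d) (a : ℕ) :
    ‖zfourier (selbergMajorant D W a) (0 : ZMod M) - 1‖ ≤ selbergSum D * (R : ℝ) ^ 4 / M := by
  have hMR : (0 : ℝ) < M := Nat.cast_pos.2 (NeZero.pos M)
  have hMC : (M : ℂ) ≠ 0 := Nat.cast_ne_zero.2 (NeZero.ne M)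
  have hpos : ∀ d ∈ D, 0 < d := fun d hd => Nat.pos_of_ne_zero (hsq d hd).ne_zero
  have hG := one_le_selbergSum h1
  have hone : (1 : ℂ) = ∑ d ∈ D, ∑ e ∈ D, (selbergSum D : ℂ) *
      ((selbergWeight D d : ℂ) * selbergWeight D e * (1 / (Nat.lcm d e : ℕ))) := by
    have h2 : selbergSum D * ∑ d ∈ D, ∑ e ∈ D, selbergWeight D d * selbergWeight D e /
        (Nat.lcm d e) = 1 := by
      rw [sum_selbergWeight_mul_div_lcm hsq hdiv h1, mul_inv_cancel₀ (by linarith)]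
    have h3 := congrArg (fun r : ℝ => (r : ℂ)) h2
    simp only [Complex.ofReal_one] at h3
    refine h3.symm.trans ?_
    push_cast
    simp_rw [Finset.mul_sum]
    exact Finset.sum_congr rfl fun d _ => Finset.sum_congr rfl fun e _ => by ring
  rw [hone, zfourier_selbergMajorant, ← Finset.sum_sub_distrib]
  simp_rw [← Finset.sum_sub_distrib]
  have hterm : ∀ d ∈ D, ∀ e ∈ D, ‖(selbergSum D : ℂ) * ((selbergWeight D d : ℂ) *
      selbergWeight D e * (progSum a W (Nat.lcm d e) (0 : ZMod M) / M)) - (selbergSum D : ℂ) *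
      ((selbergWeight D d : ℂ) * selbergWeight D e * (1 / (Nat.lcm d e : ℕ)))‖ ≤
      |selbergWeight D d| * |selbergWeight D e| * (selbergSum D / M) := by
    intro d hd e he
    have hl : 0 < Nat.lcm d e := Nat.lcm_pos (hpos d hd) (hpos e he)
    have hlC : ((Nat.lcm d e : ℕ) : ℂ) ≠ 0 := Nat.cast_ne_zero.2 hl.ne'
    have hcop : Nat.Coprime W (Nat.lcm d e) :=
      ((hW d hd).mul_right (hW e he)).coprime_dvd_right (Nat.lcm_dvd_mul d e)
    have h3 := norm_progSum_zero_sub_le (M := M) a hl hcop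
    have e1 : (selbergSum D : ℂ) * ((selbergWeight D d : ℂ) *
      selbergWeight D e * (progSum a W (Nat.lcm d e) (0 : ZMod M) / M)) - (selbergSum D : ℂ) *
      ((selbergWeight D d : ℂ) * selbergWeight D e * (1 / (Nat.lcm d e : ℕ))) =
      (selbergWeight D d : ℂ) * selbergWeight D e * ((selbergSum D : ℂ) / M) *
        (progSum a W (Nat.lcm d e) (0 : ZMod M) - M / (Nat.lcm d e : ℕ)) := by
      field_simp
    rw [e1, norm_mul, norm_mul, norm_mul, norm_div, Complex.norm_natCast]
    simp only [Complex.norm_real, Real.norm_eq_abs]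
    rw [abs_of_nonneg (by linarith : 0 ≤ selbergSum D)]
    exact mul_le_of_le_one_right (by positivity) h3
  refine (norm_sum_le _ _).trans ((Finset.sum_le_sum fun d hd => (norm_sum_le _ _).trans
    (Finset.sum_le_sum (hterm d hd))).trans ?_)
  simp_rw [← Finset.sum_mul]
  have := sum_abs_selbergWeight_le hsq hdiv h1 hR
  calc _ ≤ (R : ℝ) ^ 4 * (selbergSum D / M) := by gcongr
    _ = _ := by ring

include hsq hdiv in
lemma norm_zfourier_selbergMajorant_le (h1 : 1 ∈ D) {R W Q : ℕ} (hR : ∀ d ∈ D, d ≤ R)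
    (hW : ∀ d ∈ D, Nat.Coprime W d) (hQ : ∀ d ∈ D, ∀ p, p.Prime → p ∣ d → Q < p) (hQ0 : 0 < Q)
    (a : ℕ) {ξ : ZMod M} (hξ : ξ ≠ 0) :
    ‖zfourier (selbergMajorant D W a) ξ‖ ≤
      4 * selbergSum D ^ 4 / Q + 3 * selbergSum D * (R : ℝ) ^ 6 / M := by
  have hMR : (0 : ℝ) < M := Nat.cast_pos.2 (NeZero.pos M)
  have hpos : ∀ d ∈ D, 0 < d := fun d hd => Nat.pos_of_ne_zero (hsq d hd).ne_zero
  have hG := one_le_selbergSum h1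
  have hR0 : 0 < R := hR 1 h1
  have hR1 : (1 : ℝ) ≤ R := by exact_mod_cast hR0
  have hQR : (0 : ℝ) < Q := Nat.cast_pos.2 hQ0
  obtain ⟨q, -, hq⟩ := exists_denominator_progSum_le (B := R ^ 2) (by positivity) hξ
  have hterm : ∀ d ∈ D, ∀ e ∈ D, ‖(selbergSum D : ℂ) * ((selbergWeight D d : ℂ) *
      selbergWeight D e * (progSum a W (Nat.lcm d e) ξ / M))‖ ≤
      |selbergWeight D d| * |selbergWeight D e| * (selbergSum D * (3 * (R : ℝ) ^ 2 / M)) +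
      (if q.minFac ∣ Nat.lcm d e ∧ q ≠ 1 then
        |selbergWeight D d| * |selbergWeight D e| / (Nat.lcm d e) else 0) * selbergSum D := by
    intro d hd e he
    have hl : 0 < Nat.lcm d e := Nat.lcm_pos (hpos d hd) (hpos e he)
    have hlR : (0 : ℝ) < (Nat.lcm d e : ℕ) := Nat.cast_pos.2 hl
    have hcop : Nat.Coprime W (Nat.lcm d e) :=
      ((hW d hd).mul_right (hW e he)).coprime_dvd_right (Nat.lcm_dvd_mul d e)
    rw [norm_mul, norm_mul, norm_mul, norm_div, Complex.norm_natCast]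
    simp only [Complex.norm_real, Real.norm_eq_abs]
    rw [abs_of_nonneg (by linarith : 0 ≤ selbergSum D)]
    have hP : 0 ≤ |selbergWeight D d| * |selbergWeight D e| := by positivity
    have hR2 : (1 : ℝ) ≤ (R : ℝ) ^ 2 := one_le_pow₀ hR1
    by_cases hc : ¬ q ∣ Nat.lcm d e ∨ q = 1
    · have h2 := hq a W _ hl (by
        rw [sq]
        exact (Nat.le_of_dvd (Nat.mul_pos (hpos d hd) (hpos e he)) (Nat.lcm_dvd_mul d e)).trans
          (Nat.mul_le_mul (hR d hd) (hR e he))) hcop hc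
      push_cast at h2
      have h3 : 0 ≤ (if q.minFac ∣ Nat.lcm d e ∧ q ≠ 1 then
        |selbergWeight D d| * |selbergWeight D e| / (Nat.lcm d e) else 0) * selbergSum D := by
        positivity
      have h4 : ‖progSum a W (Nat.lcm d e) ξ‖ / M ≤ 3 * (R : ℝ) ^ 2 / M := by
        gcongr
        linarith
      calc _ ≤ selbergSum D * (|selbergWeight D d| * |selbergWeight D e| *
            (3 * (R : ℝ) ^ 2 / M)) := by gcongr
        _ = |selbergWeight D d| * |selbergWeight D e| * (selbergSum D * (3 * (R : ℝ) ^ 2 / M)) := by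
          ring
        _ ≤ _ := le_add_of_nonneg_right h3
    · push Not at hc
      rw [if_pos ⟨(Nat.minFac_dvd q).trans hc.1, hc.2⟩]
      have h2 := norm_progSum_le a hl hcop ξ
      have h3 : ‖progSum a W (Nat.lcm d e) ξ‖ / M ≤
          1 / (Nat.lcm d e : ℕ) + 3 * (R : ℝ) ^ 2 / M := by
        calc _ ≤ ((M : ℝ) / (Nat.lcm d e : ℕ) + 1) / M := by gcongr
          _ = 1 / (Nat.lcm d e : ℕ) + 1 / M := by field_simp
          _ ≤ _ := by
            gcongr
            linarith
      calc _ ≤ selbergSum D * (|selbergWeight D d| * |selbergWeight D e| *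
            (1 / (Nat.lcm d e : ℕ) + 3 * (R : ℝ) ^ 2 / M)) := by gcongr
        _ = _ := by ring
  have hprime : (∑ d ∈ D, ∑ e ∈ D, if q.minFac ∣ Nat.lcm d e ∧ q ≠ 1 then
        |selbergWeight D d| * |selbergWeight D e| / (Nat.lcm d e) else 0) ≤
        4 * selbergSum D ^ 3 / Q := by
    by_cases hex : q ≠ 1 ∧ ∃ d ∈ D, q.minFac ∣ d
    · obtain ⟨hq1, d₀, hd₀, hpd⟩ := hex
      have hp := Nat.minFac_prime hq1
      have h2 := hQ d₀ hd₀ _ hp hpd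
      have h3 : (Q : ℝ) ≤ q.minFac - 1 := by
        rw [le_sub_iff_add_le]
        exact_mod_cast h2
      simp only [hq1, ne_eq, not_false_eq_true, and_true]
      refine (sum_abs_selbergWeight_prime_dvd_le hsq hdiv h1 hp).trans ?_
      gcongr
    · have h2 : ∀ d ∈ D, ∀ e ∈ D, ¬ (q.minFac ∣ Nat.lcm d e ∧ q ≠ 1) := by
        rintro d hd e he ⟨h3, h4⟩
        rcases (Nat.minFac_prime h4).dvd_lcm.1 h3 with h | h
        · exact hex ⟨h4, d, hd, h⟩
        · exact hex ⟨h4, e, he, h⟩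
      rw [Finset.sum_eq_zero fun d hd => Finset.sum_eq_zero fun e he => if_neg (h2 d hd e he)]
      positivity
  rw [zfourier_selbergMajorant]
  refine (norm_sum_le _ _).trans ((Finset.sum_le_sum fun d hd => (norm_sum_le _ _).trans
    (Finset.sum_le_sum (hterm d hd))).trans ?_)
  simp_rw [Finset.sum_add_distrib, ← Finset.sum_mul]
  have h5 := sum_abs_selbergWeight_le hsq hdiv h1 hR
  calc _ ≤ (R : ℝ) ^ 4 * (selbergSum D * (3 * (R : ℝ) ^ 2 / M)) +
        4 * selbergSum D ^ 3 / Q * selbergSum D := by gcongr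
    _ = _ := by ring

end Majorant

section RoughNumbers

open Finset
open scoped Nat

/-- The squarefree integers in `[1, R]` all of whose prime factors exceed `Q`. -/
noncomputable def roughLevels (R Q : ℕ) : Finset ℕ := by
  classical
  exact {d ∈ Finset.Icc 1 R | Squarefree d ∧ ∀ p, p.Prime → p ∣ d → Q < p}

lemma mem_roughLevels {R Q d : ℕ} : d ∈ roughLevels R Q ↔
    (1 ≤ d ∧ d ≤ R) ∧ Squarefree d ∧ ∀ p, p.Prime → p ∣ d → Q < p := by
  simp [roughLevels]

lemma one_mem_roughLevels {R : ℕ} (hR : 1 ≤ R) (Q : ℕ) : 1 ∈ roughLevels R Q :=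
  mem_roughLevels.2 ⟨⟨le_rfl, hR⟩, squarefree_one,
    fun _ hp h => absurd (Nat.dvd_one.1 h) hp.ne_one⟩

lemma mem_roughLevels_of_dvd {R Q d e : ℕ} (hd : d ∈ roughLevels R Q) (he : e ∣ d) :
    e ∈ roughLevels R Q := by
  obtain ⟨⟨h1, h2⟩, h3, h4⟩ := mem_roughLevels.1 hd
  exact mem_roughLevels.2 ⟨⟨Nat.pos_of_dvd_of_pos he h1, (Nat.le_of_dvd h1 he).trans h2⟩,
    h3.squarefree_of_dvd he, fun p hp h => h4 p hp (h.trans he)⟩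

lemma sum_inv_Icc_eq_harmonic (n : ℕ) : ∑ i ∈ Finset.Icc 1 n, (i : ℝ)⁻¹ = (harmonic n : ℝ) := by
  rw [harmonic_eq_sum_Icc]
  push_cast
  rfl

lemma sum_le_sum_of_exists {κ ι : Type*} [DecidableEq ι] {s : Finset κ} {t : Finset ι}
    {g : κ → ι} {f : ι → ℝ} {h : κ → ℝ} (hh : ∀ x, 0 ≤ h x)
    (hf : ∀ i ∈ t, ∃ x ∈ s, g x = i ∧ f i ≤ h x) : ∑ i ∈ t, f i ≤ ∑ x ∈ s, h x := by
  refine le_trans ?_ (Finset.sum_fiberwise_le_sum_of_sum_fiber_nonneg (t := t) (g := g)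
    fun _ _ => Finset.sum_nonneg fun x _ => hh x)
  refine Finset.sum_le_sum fun i hi => ?_
  obtain ⟨x, hx, rfl, hfx⟩ := hf i hi
  exact hfx.trans (Finset.single_le_sum (f := h) (fun y _ => hh y)
    (Finset.mem_filter.2 ⟨hx, rfl⟩))

lemma inv_totient_le {d : ℕ} (hd : 0 < d) : (φ d : ℝ)⁻¹ ≤ ∑ _e ∈ d.divisors, (d : ℝ)⁻¹ := by
  have h1 : d ≤ #d.divisors * φ d := by
    conv_lhs => rw [← Nat.sum_totient d]
    rw [← smul_eq_mul]
    exact Finset.sum_le_card_nsmul _ _ _ fun e he =>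
      Nat.le_of_dvd (Nat.totient_pos.2 hd) (Nat.totient_dvd_of_dvd (Nat.dvd_of_mem_divisors he))
  have h2 : (0 : ℝ) < φ d := Nat.cast_pos.2 (Nat.totient_pos.2 hd)
  have h3 : (0 : ℝ) < d := Nat.cast_pos.2 hd
  have h4 : (d : ℝ) ≤ #d.divisors * φ d := by exact_mod_cast h1
  rw [Finset.sum_const, nsmul_eq_mul, ← div_eq_mul_inv, inv_le_iff_one_le_mul₀ h2,
    div_mul_eq_mul_div, one_le_div h3]
  exact h4

lemma selbergSum_roughLevels_le (R Q : ℕ) :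
    selbergSum (roughLevels R Q) ≤ (1 + Real.log R) ^ 2 := by
  have h1 : ∀ d ∈ roughLevels R Q, (φ d : ℝ)⁻¹ ≤
      ∑ x ∈ Finset.Icc 1 R ×ˢ Finset.Icc 1 R with x.1 * x.2 = d, (x.1 : ℝ)⁻¹ * (x.2 : ℝ)⁻¹ := by
    intro d hd
    obtain ⟨⟨hd1, hdR⟩, -⟩ := mem_roughLevels.1 hd
    refine (inv_totient_le hd1).trans ?_
    refine sum_le_sum_of_exists (g := Prod.fst) (fun _ => by positivity) fun e he => ?_
    obtain ⟨k, rfl⟩ := Nat.dvd_of_mem_divisors he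
    have he0 : 0 < e := Nat.pos_of_mul_pos_right hd1
    have hk0 : 0 < k := Nat.pos_of_mul_pos_left hd1
    refine ⟨(e, k), Finset.mem_filter.2 ⟨Finset.mem_product.2 ⟨Finset.mem_Icc.2 ⟨he0, ?_⟩,
      Finset.mem_Icc.2 ⟨hk0, ?_⟩⟩, rfl⟩, rfl, ?_⟩
    · exact (Nat.le_mul_of_pos_right e hk0).trans hdR
    · exact (Nat.le_mul_of_pos_left k he0).trans hdR
    · rw [Nat.cast_mul, mul_inv]
  calc selbergSum (roughLevels R Q)
      ≤ ∑ d ∈ roughLevels R Q, ∑ x ∈ Finset.Icc 1 R ×ˢ Finset.Icc 1 R with x.1 * x.2 = d,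
          (x.1 : ℝ)⁻¹ * (x.2 : ℝ)⁻¹ := Finset.sum_le_sum h1
    _ ≤ ∑ x ∈ Finset.Icc 1 R ×ˢ Finset.Icc 1 R, (x.1 : ℝ)⁻¹ * (x.2 : ℝ)⁻¹ :=
      Finset.sum_fiberwise_le_sum_of_sum_fiber_nonneg fun _ _ =>
        Finset.sum_nonneg fun _ _ => by positivity
    _ = (harmonic R : ℝ) ^ 2 := by
      rw [Finset.sum_product]
      dsimp only
      rw [← Finset.sum_mul_sum, sum_inv_Icc_eq_harmonic, sq]
    _ ≤ _ := by
      have h2 : (0 : ℝ) ≤ harmonic R := by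
        rw [← sum_inv_Icc_eq_harmonic]
        positivity
      gcongr
      exact harmonic_le_one_add_log R

lemma sum_inv_sq_Icc_le (n : ℕ) : ∑ i ∈ Finset.Icc 1 n, ((i : ℝ) ^ 2)⁻¹ ≤ 2 - 1 / n := by
  induction n with
  | zero => norm_num
  | succ n ih =>
    rw [Finset.sum_Icc_succ_top (by lia)]
    rcases Nat.eq_zero_or_pos n with rfl | hn
    · norm_num
    have h0 : (0 : ℝ) < n := Nat.cast_pos.2 hn
    have : (((n + 1 : ℕ) : ℝ) ^ 2)⁻¹ ≤ 1 / n - 1 / (n + 1 : ℕ) := by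
      push_cast
      rw [div_sub_div _ _ (by positivity) (by positivity), ← one_div,
        div_le_div_iff₀ (by positivity) (by positivity)]
      nlinarith
    linarith

open Classical in
lemma sum_inv_rough_le (R Q : ℕ) :
    ∑ n ∈ Finset.Icc 1 R with ∀ p ∈ Nat.primesLE Q, ¬ p ∣ n, (n : ℝ)⁻¹ ≤
      2 * selbergSum (roughLevels R Q) := by
  have h1 : ∑ n ∈ Finset.Icc 1 R with ∀ p ∈ Nat.primesLE Q, ¬ p ∣ n, (n : ℝ)⁻¹ ≤
      ∑ x ∈ roughLevels R Q ×ˢ Finset.Icc 1 R, (φ x.1 : ℝ)⁻¹ * ((x.2 : ℝ) ^ 2)⁻¹ := by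
    refine sum_le_sum_of_exists (g := fun x => x.2 ^ 2 * x.1) (fun _ => by positivity) ?_
    intro n hn
    obtain ⟨hn, hrough⟩ := Finset.mem_filter.1 hn
    obtain ⟨hn1, hnR⟩ := Finset.mem_Icc.1 hn
    obtain ⟨a, b, rfl, ha⟩ := Nat.sq_mul_squarefree n
    have ha0 : 0 < a := Nat.pos_of_ne_zero ha.ne_zero
    have hb0 : 0 < b := Nat.pos_of_ne_zero fun h => by simp [h] at hn1
    refine ⟨(a, b), Finset.mem_product.2 ⟨mem_roughLevels.2 ⟨⟨ha0, ?_⟩, ha, fun p hp h => ?_⟩,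
      Finset.mem_Icc.2 ⟨hb0, ?_⟩⟩, rfl, ?_⟩
    · exact (Nat.le_mul_of_pos_left a (pow_pos hb0 2)).trans hnR
    · by_contra! hpQ
      exact hrough p (Nat.mem_primesLE.2 ⟨hpQ, hp⟩) (h.mul_left _)
    · exact ((Nat.le_self_pow two_ne_zero b).trans (Nat.le_mul_of_pos_right _ ha0)).trans hnR
    · push_cast
      rw [mul_inv, mul_comm]
      gcongr
      exact_mod_cast Nat.totient_le a
  refine h1.trans ?_
  rw [Finset.sum_product]
  dsimp only
  rw [← Finset.sum_mul_sum, mul_comm, ← selbergSum]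
  have h2 := sum_inv_sq_Icc_le R
  have h3 : (0 : ℝ) ≤ 1 / R := by positivity
  have h4 : 0 ≤ selbergSum (roughLevels R Q) := Finset.sum_nonneg fun _ _ => by positivity
  gcongr
  linarith

open Classical in
lemma prod_one_sub_inv_mul_harmonic_le (R : ℕ) (P : Finset ℕ) (hP : ∀ p ∈ P, p.Prime) :
    (∏ p ∈ P, (1 - (p : ℝ)⁻¹)) * harmonic R ≤
      ∑ n ∈ Finset.Icc 1 R with ∀ p ∈ P, ¬ p ∣ n, (n : ℝ)⁻¹ := by
  induction P using Finset.induction_on with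
  | empty => simp [sum_inv_Icc_eq_harmonic]
  | insert q P hq ih =>
    have hqp := hP q (Finset.mem_insert_self q P)
    have hq1 : (1 : ℝ) ≤ q := by exact_mod_cast hqp.one_le
    have hq2 : (q : ℝ)⁻¹ ≤ 1 := inv_le_one_of_one_le₀ hq1
    have ih := ih fun p hp => hP p (Finset.mem_insert_of_mem hp)
    set S := ∑ n ∈ Finset.Icc 1 R with ∀ p ∈ P, ¬ p ∣ n, (n : ℝ)⁻¹ with hS
    have h1 : ∑ n ∈ Finset.Icc 1 R with (∀ p ∈ P, ¬ p ∣ n) ∧ q ∣ n, (n : ℝ)⁻¹ ≤ (q : ℝ)⁻¹ * S := by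
      rw [hS, Finset.mul_sum]
      refine sum_le_sum_of_exists (g := fun m => q * m) (fun _ => by positivity) fun n hn => ?_
      obtain ⟨hn, hfree, m, rfl⟩ := Finset.mem_filter.1 hn
      obtain ⟨hn1, hnR⟩ := Finset.mem_Icc.1 hn
      refine ⟨m, Finset.mem_filter.2 ⟨Finset.mem_Icc.2 ⟨Nat.pos_of_mul_pos_left hn1, ?_⟩,
        fun p hp h => hfree p hp (h.mul_left _)⟩, rfl, ?_⟩
      · exact (Nat.le_mul_of_pos_left m hqp.pos).trans hnR
      · rw [Nat.cast_mul, mul_inv]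
    have h2 : S = ∑ n ∈ Finset.Icc 1 R with (∀ p ∈ P, ¬ p ∣ n) ∧ q ∣ n, (n : ℝ)⁻¹ +
        ∑ n ∈ Finset.Icc 1 R with ∀ p ∈ insert q P, ¬ p ∣ n, (n : ℝ)⁻¹ := by
      rw [hS, ← Finset.sum_filter_add_sum_filter_not _ (q ∣ ·), Finset.filter_filter,
        Finset.filter_filter]
      congr 1
      refine Finset.sum_congr (Finset.filter_congr fun n _ => ?_) fun _ _ => rfl
      simp only [Finset.forall_mem_insert]
      tauto
    rw [Finset.prod_insert hq, mul_assoc]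
    calc _ ≤ (1 - (q : ℝ)⁻¹) * S := by gcongr
      _ ≤ _ := by linarith

/-- The Mertens product `∏ (1 - 1 / p)` over the primes `p ≤ n`. -/
noncomputable def mertensProd (n : ℕ) : ℝ := ∏ p ∈ Nat.primesLE n, (1 - (p : ℝ)⁻¹)

lemma mertensProd_pos (n : ℕ) : 0 < mertensProd n :=
  Finset.prod_pos fun p hp => sub_pos.2 <|
    inv_lt_one_of_one_lt₀ (by exact_mod_cast (Nat.prime_of_mem_primesLE hp).one_lt)

lemma mertensProd_mul_log_le (R Q : ℕ) :
    mertensProd Q * Real.log R ≤ 2 * selbergSum (roughLevels R Q) := by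
  classical
  refine le_trans ?_ ((prod_one_sub_inv_mul_harmonic_le R (Nat.primesLE Q)
    fun p hp => Nat.prime_of_mem_primesLE hp).trans ?_)
  · have h1 := log_add_one_le_harmonic R
    have h2 : Real.log R ≤ Real.log (R + 1 : ℕ) := by
      rcases Nat.eq_zero_or_pos R with rfl | h
      · simp
      · gcongr
        lia
    have := (mertensProd_pos Q).le
    exact mul_le_mul_of_nonneg_left (h2.trans h1) this
  · convert sum_inv_rough_le R Q

lemma totient_primorial (w : ℕ) : (φ (primorial w) : ℝ) = primorial w * mertensProd w := by
  have h := Nat.totient_eq_mul_prod_factors (primorial w)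
  rw [primeFactors_primorial] at h
  have := congrArg (fun q : ℚ => (q : ℝ)) h
  push_cast at this
  exact this

end RoughNumbers

section Mertens

open Finset
open scoped Nat

lemma sum_inv_primes_dyadic_le {k : ℕ} (hk : 0 < k) :
    ∑ p ∈ Nat.primesLE (2 ^ (k + 1)) with 2 ^ k < p, (p : ℝ)⁻¹ ≤ 4 / k := by
  have hlog2 : 0 < Real.log 2 := Real.log_pos one_lt_two
  have hk0 : (0 : ℝ) < k := Nat.cast_pos.2 hk
  have hterm : ∀ p ∈ (Nat.primesLE (2 ^ (k + 1))).filter (2 ^ k < ·),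
      (p : ℝ)⁻¹ ≤ Real.log p * (2 ^ k * (k * Real.log 2))⁻¹ := by
    intro p hp
    have hp := (Finset.mem_filter.1 hp).2
    have hp1 : (2 : ℝ) ^ k ≤ p := by exact_mod_cast hp.le
    have hp0 : (0 : ℝ) < p := lt_of_lt_of_le (by positivity) hp1
    have hlog : k * Real.log 2 ≤ Real.log p := by
      rw [← Real.log_pow]
      exact Real.log_le_log (by positivity) hp1
    rw [← div_eq_mul_inv, inv_le_iff_one_le_mul₀ hp0, div_mul_eq_mul_div, one_le_div (by positivity)]
    rw [mul_comm]
    gcongr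
  have htheta : ∑ p ∈ Nat.primesLE (2 ^ (k + 1)) with 2 ^ k < p, Real.log p ≤
      Real.log 4 * 2 ^ (k + 1) := by
    have h1 := Chebyshev.theta_le_log4_mul_x (x := 2 ^ (k + 1)) (by positivity)
    rw [Chebyshev.theta] at h1
    have h2 : ⌊(2 : ℝ) ^ (k + 1)⌋₊ = 2 ^ (k + 1) := by
      have : ((2 ^ (k + 1) : ℕ) : ℝ) = (2 : ℝ) ^ (k + 1) := by push_cast; rfl
      rw [← this, Nat.floor_natCast]
    rw [h2, ← Nat.primesLE_eq_filter_Ioc_zero] at h1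
    refine le_trans (Finset.sum_le_sum_of_subset_of_nonneg (Finset.filter_subset _ _) ?_) h1
    intro p hp _
    exact Real.log_nonneg (by exact_mod_cast (Nat.prime_of_mem_primesLE hp).one_le)
  refine (Finset.sum_le_sum hterm).trans ?_
  rw [← Finset.sum_mul, ← div_eq_mul_inv, div_le_div_iff₀ (by positivity) hk0]
  have h4 : Real.log 4 = 2 * Real.log 2 := by
    rw [show (4 : ℝ) = 2 ^ 2 by norm_num, Real.log_pow]
    norm_num
  calc _ ≤ Real.log 4 * 2 ^ (k + 1) * k := by gcongr
    _ = _ := by rw [h4, pow_succ]; ring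

lemma sum_inv_primes_le {s : ℕ} (hs : 0 < s) (j : ℕ) :
    ∑ p ∈ Nat.primesLE (2 ^ (s + j)) with 2 ^ s < p, (p : ℝ)⁻¹ ≤ 4 * j / s := by
  have hs0 : (0 : ℝ) < s := Nat.cast_pos.2 hs
  induction j with
  | zero =>
    rw [Finset.filter_eq_empty_iff.2 fun p hp => not_lt.2 (Nat.le_of_mem_primesLE hp)]
    simp
  | succ j ih =>
    have h1 := sum_inv_primes_dyadic_le (k := s + j) (by lia)
    have h2 : (Nat.primesLE (2 ^ (s + (j + 1)))).filter (2 ^ s < ·) ⊆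
        (Nat.primesLE (2 ^ (s + j))).filter (2 ^ s < ·) ∪
        (Nat.primesLE (2 ^ (s + j + 1))).filter (2 ^ (s + j) < ·) := by
      intro p hp
      simp only [Finset.mem_union, Finset.mem_filter, Nat.mem_primesLE, ← add_assoc] at hp ⊢
      rcases le_or_gt p (2 ^ (s + j)) with h | h
      · exact Or.inl ⟨⟨h, hp.1.2⟩, hp.2⟩
      · exact Or.inr ⟨hp.1, h⟩
    have h3 := Finset.sum_le_sum_of_subset_of_nonneg (f := fun p : ℕ => (p : ℝ)⁻¹) h2
      fun _ _ _ => by positivity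
    have h4 := Finset.sum_union_inter (s₁ := (Nat.primesLE (2 ^ (s + j))).filter (2 ^ s < ·))
      (s₂ := (Nat.primesLE (2 ^ (s + j + 1))).filter (2 ^ (s + j) < ·)) (f := fun p : ℕ => (p : ℝ)⁻¹)
    have h5 : 0 ≤ ∑ p ∈ (Nat.primesLE (2 ^ (s + j))).filter (2 ^ s < ·) ∩
      (Nat.primesLE (2 ^ (s + j + 1))).filter (2 ^ (s + j) < ·), (p : ℝ)⁻¹ := by positivity
    have h6 : (4 : ℝ) / (s + j : ℕ) ≤ 4 / s := by
      push_cast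
      gcongr
      linarith [(Nat.cast_nonneg j : (0 : ℝ) ≤ j)]
    have h7 : (4 : ℝ) * (j + 1 : ℕ) / s = 4 * j / s + 4 / s := by push_cast; ring
    rw [h7]
    linarith

lemma exp_neg_le_one_sub {x : ℝ} (h0 : 0 ≤ x) (h1 : x ≤ 1 / 2) : Real.exp (-(2 * x)) ≤ 1 - x := by
  have h2 : 0 < 1 - x := by linarith
  rw [Real.exp_neg, inv_le_comm₀ (Real.exp_pos _) h2]
  have h3 := Real.add_one_le_exp (2 * x)
  refine le_trans ?_ h3
  rw [inv_le_iff_one_le_mul₀ h2]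
  nlinarith

lemma exp_mul_mertensProd_le {s : ℕ} (hs : 0 < s) :
    Real.exp (-120) * mertensProd (2 ^ s) ≤ mertensProd (2 ^ (16 * s)) := by
  have hle : 2 ^ s ≤ 2 ^ (16 * s) := Nat.pow_le_pow_right two_pos (by lia)
  have h1 : mertensProd (2 ^ (16 * s)) = mertensProd (2 ^ s) *
      ∏ p ∈ Nat.primesLE (2 ^ (16 * s)) with 2 ^ s < p, (1 - (p : ℝ)⁻¹) := by
    rw [mertensProd, ← Finset.prod_filter_mul_prod_filter_not _ (· ≤ 2 ^ s), mertensProd]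
    congr 1
    · refine Finset.prod_congr ?_ fun _ _ => rfl
      ext p
      simp only [Finset.mem_filter, Nat.mem_primesLE]
      exact ⟨fun h => ⟨h.2, h.1.2⟩, fun h => ⟨⟨h.1.trans hle, h.2⟩, h.1⟩⟩
    · simp only [not_le]
  rw [h1, mul_comm]
  refine mul_le_mul_of_nonneg_left ?_ (mertensProd_pos _).le
  have h2 := sum_inv_primes_le hs (15 * s)
  rw [show s + 15 * s = 16 * s by ring] at h2
  have h3 : (4 : ℝ) * (15 * s : ℕ) / s = 60 := by
    have : (s : ℝ) ≠ 0 := Nat.cast_ne_zero.2 hs.ne'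
    push_cast
    field_simp
    norm_num
  rw [h3] at h2
  calc Real.exp (-120) ≤
        Real.exp (∑ p ∈ Nat.primesLE (2 ^ (16 * s)) with 2 ^ s < p, -(2 * (p : ℝ)⁻¹)) := by
        rw [Real.exp_le_exp, Finset.sum_neg_distrib, ← Finset.mul_sum]
        linarith
    _ ≤ _ := by
      rw [Real.exp_sum]
      refine Finset.prod_le_prod (fun _ _ => (Real.exp_pos _).le) fun p hp => ?_
      have h5 : (2 : ℝ) ≤ p := by
        exact_mod_cast (Nat.prime_of_mem_primesLE (Finset.mem_filter.1 hp).1).two_le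
      refine exp_neg_le_one_sub (by positivity) ?_
      rw [one_div]
      gcongr

end Mertens

section PrimesInProgressions

open Finset
open scoped Nat

lemma exists_residue_primes (W N R : ℕ) (hW : 1 < W) (hN : 1 < N)
    (hR : ∀ p, p.Prime → R < p → Nat.Coprime p W) :
    ∃ a, (Nat.primeCounting (W * N) : ℝ) - (R + 1) ≤
      φ W * #{n ∈ Finset.range N | (a + W * n).Prime ∧ R < a + W * n} := by
  set P := (Nat.primesLE (W * N)).filter (R < ·) with hP
  have hφ : (0 : ℝ) < φ W := Nat.cast_pos.2 (Nat.totient_pos.2 (by lia))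
  have hcard : (Nat.primeCounting (W * N) : ℝ) - (R + 1) ≤ #P := by
    have h1 := Finset.card_filter_add_card_filter_not (s := Nat.primesLE (W * N)) (R < ·)
    have h2 : #((Nat.primesLE (W * N)).filter (¬ R < ·)) ≤ R + 1 := by
      have : (Nat.primesLE (W * N)).filter (¬ R < ·) ⊆ Finset.range (R + 1) := by
        intro p hp
        have := (Finset.mem_filter.1 hp).2
        rw [Finset.mem_range]
        lia
      simpa using Finset.card_le_card this
    rw [Nat.primesLE_card_eq_primeCounting] at h1
    have : (Nat.primeCounting (W * N) : ℝ) ≤ #P + (R + 1) := by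
      rw [← h1]
      push_cast
      gcongr
      exact_mod_cast h2
    linarith
  obtain ⟨a, ha, h⟩ := Finset.exists_le_card_fiber_of_nsmul_le_card_of_maps_to (s := P)
    (t := (Finset.range W).filter (Nat.Coprime W)) (f := fun p => p % W) (b := (#P : ℝ) / φ W)
    (fun p hp => by
      obtain ⟨hp, hpR⟩ := Finset.mem_filter.1 hp
      refine Finset.mem_filter.2 ⟨Finset.mem_range.2 (Nat.mod_lt _ (by lia)), ?_⟩
      have := hR p (Nat.prime_of_mem_primesLE hp) hpR
      rw [Nat.Coprime, Nat.gcd_comm, ← Nat.gcd_rec]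
      exact this.symm)
    ⟨1, by simp [hW]⟩ (by
      rw [← Nat.totient_eq_card_coprime, nsmul_eq_mul, mul_div_cancel₀ _ hφ.ne'])
  refine ⟨a, hcard.trans ?_⟩
  rw [div_le_iff₀' hφ] at h
  refine h.trans (mul_le_mul_of_nonneg_left (Nat.cast_le.2 ?_) hφ.le)
  refine Finset.card_le_card_of_injOn (fun p => p / W) ?_ ?_
  · intro p hp
    obtain ⟨hp, hpa⟩ := Finset.mem_filter.1 hp
    obtain ⟨hp, hpR⟩ := Finset.mem_filter.1 hp
    obtain ⟨hpN, hpp⟩ := Nat.mem_primesLE.1 hp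
    have hne : p ≠ W * N := by
      rintro rfl
      exact Nat.not_prime_mul (by lia) (by lia) hpp
    have e : a + W * (p / W) = p := by rw [← hpa, Nat.mod_add_div]
    refine Finset.mem_coe.2 (Finset.mem_filter.2 ⟨Finset.mem_range.2 ?_, ?_⟩)
    · exact Nat.div_lt_of_lt_mul (lt_of_le_of_ne hpN hne)
    · rw [e]
      exact ⟨hpp, hpR⟩
  · intro p hp q hq hpq
    have hp := (Finset.mem_filter.1 hp).2
    have hq := (Finset.mem_filter.1 hq).2
    simp only at hp hq hpq
    rw [← Nat.mod_add_div p W, ← Nat.mod_add_div q W, hp, hq, hpq]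

end PrimesInProgressions

section PrimeDensity

open Finset ZMod
open scoped Nat

lemma one_lt_primorial {w : ℕ} (hw : 2 ≤ w) : 1 < primorial w :=
  (Nat.le_of_dvd (primorial_pos w) ((Nat.Prime.dvd_primorial_iff Nat.prime_two).2 hw))

lemma div_le_primeCounting {w N : ℕ} (hw : 2 ≤ w) (hN : N = 2 ^ (8 * w - 1)) :
    (primorial w * N : ℝ) / (20 * w) ≤ Nat.primeCounting (primorial w * N) - (2 ^ w + 1) := by
  set X := primorial w * N with hX
  have hlog2 : 0 < Real.log 2 := Real.log_pos one_lt_two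
  have hw0 : (0 : ℝ) < w := Nat.cast_pos.2 (by lia)
  have hXN : N ≤ X := Nat.le_mul_of_pos_left _ (primorial_pos w)
  have hX2 : 2 ≤ X := by
    refine le_trans ?_ hXN
    rw [hN]
    exact Nat.le_self_pow (by lia) 2
  have hX2R : (2 : ℝ) ≤ X := by exact_mod_cast hX2
  have hlogX : 0 < Real.log X := Real.log_pos (by linarith)
  have hXle : X ≤ 2 ^ (10 * w) := by
    calc X ≤ 4 ^ w * 2 ^ (8 * w - 1) := by rw [hX, hN]; gcongr; exact primorial_le_four_pow w
      _ = 2 ^ (2 * w + (8 * w - 1)) := by rw [pow_add, pow_mul]; rfl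
      _ ≤ 2 ^ (10 * w) := Nat.pow_le_pow_right two_pos (by lia)
  have hlogXle : Real.log X ≤ 10 * w * Real.log 2 := by
    calc Real.log X ≤ Real.log ((2 : ℝ) ^ (10 * w)) :=
        Real.log_le_log (by linarith) (by exact_mod_cast hXle)
      _ = _ := by rw [Real.log_pow]; push_cast; ring
  have hlog1 : Real.log (X + 1) ≤ 2 * Real.log X := by
    rw [← Nat.cast_ofNat, ← Real.log_pow]
    exact Real.log_le_log (by linarith) (by nlinarith)
  have h1 := Chebyshev.pi_ge X
  have h2 : (X : ℝ) / (10 * w) - 2 ≤ (X * Real.log 2 - Real.log (X + 1)) / Real.log X := by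
    rw [sub_div]
    gcongr ?_ - ?_
    · calc (X : ℝ) / (10 * w) = X * Real.log 2 / (10 * w * Real.log 2) := by field_simp
        _ ≤ _ := by gcongr
    · rw [div_le_iff₀ hlogX]
      exact hlog1
  have h3 : 20 * w * (2 ^ w + 3) ≤ X := by
    refine le_trans ?_ hXN
    have hw2 : w ≤ 2 ^ w := Nat.lt_two_pow_self.le
    have h1w : 1 ≤ 2 ^ w := Nat.one_le_two_pow
    calc 20 * w * (2 ^ w + 3) ≤ 2 ^ 7 * (2 ^ w * 2 ^ w) := by nlinarith
      _ = 2 ^ (7 + (w + w)) := by rw [pow_add, pow_add]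
      _ ≤ N := by rw [hN]; exact Nat.pow_le_pow_right two_pos (by lia)
  have h4 : (2 : ℝ) ^ w + 3 ≤ X / (20 * w) := by
    rw [le_div_iff₀ (by positivity), mul_comm]
    exact_mod_cast h3
  have h5 : (X : ℝ) / (10 * w) = X / (20 * w) + X / (20 * w) := by
    field_simp
    norm_num
  rw [show (primorial w : ℝ) * N = X by rw [hX]; push_cast; rfl]
  linarith

lemma exists_residue_density {s : ℕ} (hs : 0 < s) :
    ∃ a, Real.exp (-120) * Real.log 2 / 120 * (2 ^ (8 * 2 ^ s) + 1 : ℕ) ≤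
      selbergSum (roughLevels (2 ^ 2 ^ s) (2 ^ (16 * s))) *
      #{n ∈ Finset.range (2 ^ (8 * 2 ^ s - 1)) | (a + primorial (2 ^ s) * n).Prime ∧
        2 ^ 2 ^ s < a + primorial (2 ^ s) * n} := by
  set w := 2 ^ s with hw
  set N := 2 ^ (8 * w - 1) with hN
  set G := selbergSum (roughLevels (2 ^ w) (2 ^ (16 * s)))
  have hw2 : 2 ≤ w := Nat.le_self_pow hs.ne' 2
  have hw0 : (0 : ℝ) < w := Nat.cast_pos.2 (by lia)
  have hlog2 : 0 < Real.log 2 := Real.log_pos one_lt_two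
  obtain ⟨a, ha⟩ := exists_residue_primes (primorial w) N (2 ^ w) (one_lt_primorial hw2)
    (Nat.one_lt_two_pow (by lia)) fun p hp hpw => by
      rw [hp.coprime_iff_not_dvd, hp.dvd_primorial_iff]
      exact not_le.2 (Nat.lt_two_pow_self.trans hpw)
  refine ⟨a, ?_⟩
  set T := #{n ∈ Finset.range N | (a + primorial w * n).Prime ∧ 2 ^ w < a + primorial w * n}
  have h1 := div_le_primeCounting hw2 hN
  push_cast at ha
  have h2 := h1.trans ha
  have hP : (0 : ℝ) < primorial w := Nat.cast_pos.2 (primorial_pos w)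
  rw [totient_primorial, mul_assoc, mul_div_assoc, mul_le_mul_iff_right₀ hP] at h2
  have h3 := mertensProd_mul_log_le (2 ^ w) (2 ^ (16 * s))
  have h4 := exp_mul_mertensProd_le hs
  have h5 : Real.log (2 ^ w : ℕ) = w * Real.log 2 := by
    push_cast
    rw [Real.log_pow]
  rw [h5] at h3
  have h6 : Real.exp (-120) * mertensProd w * (w * Real.log 2) ≤ 2 * G :=
    le_trans (mul_le_mul_of_nonneg_right h4 (by positivity)) h3
  have h7 : ((2 ^ (8 * w) + 1 : ℕ) : ℝ) ≤ 3 * N := by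
    have : 2 ^ (8 * w) + 1 ≤ 3 * N := by
      have e : 2 ^ (8 * w) = 2 * N := by
        rw [hN, ← pow_succ']
        congr 1
        lia
      have : 1 ≤ N := Nat.one_le_two_pow
      lia
    exact_mod_cast this
  have hE := Real.exp_pos (-120)
  calc _ ≤ Real.exp (-120) * Real.log 2 / 120 * (3 * N) := by gcongr
    _ = Real.exp (-120) * (w * Real.log 2) / 2 * (N / (20 * w)) := by field_simp; ring
    _ ≤ Real.exp (-120) * (w * Real.log 2) / 2 * (mertensProd w * T) := by gcongr
    _ = (Real.exp (-120) * mertensProd w * (w * Real.log 2)) / 2 * T := by ring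
    _ ≤ 2 * G / 2 * T := by gcongr
    _ = _ := by ring

lemma selbergSum_roughLevels_two_pow_le {w : ℕ} (hw : 1 ≤ w) (Q : ℕ) :
    selbergSum (roughLevels (2 ^ w) Q) ≤ 4 * (w : ℝ) ^ 2 := by
  have hw1 : (1 : ℝ) ≤ w := by exact_mod_cast hw
  refine (selbergSum_roughLevels_le _ _).trans ?_
  have h1 : Real.log (2 ^ w : ℕ) ≤ w := by
    push_cast
    rw [Real.log_pow]
    have := Real.log_two_lt_d9
    nlinarith
  have h2 : 0 ≤ Real.log (2 ^ w : ℕ) := Real.log_natCast_nonneg _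
  calc _ ≤ (2 * (w : ℝ)) ^ 2 := by gcongr; linarith
    _ = _ := by ring

lemma add_eq_two_mul_of_val_lt {M N : ℕ} [NeZero M] (hNM : 2 * N < M) {x d : ZMod M}
    (h1 : x.val < N) (h2 : (x + d).val < N) (h3 : (x + d + d).val < N) :
    x.val + (x + d + d).val = 2 * (x + d).val := by
  have h : ((x.val + (x + d + d).val : ℕ) : ZMod M) = (2 * (x + d).val : ℕ) := by
    push_cast
    simp only [ZMod.natCast_zmod_val]
    ring
  rw [ZMod.natCast_eq_natCast_iff'] at h
  rwa [Nat.mod_eq_of_lt (by lia), Nat.mod_eq_of_lt (by lia)] at h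

lemma add_self_injective_of_odd {M : ℕ} (hM : Odd M) {d e : ZMod M} (h : d + d = e + e) : d = e := by
  have h2 : IsUnit ((2 : ℕ) : ZMod M) :=
    (ZMod.isUnit_iff_coprime 2 M).2 (Nat.coprime_two_left.2 hM)
  refine h2.mul_left_cancel ?_
  push_cast
  rw [two_mul, two_mul, h]

end PrimeDensity

section PrimePairs

open Finset ZMod
open scoped Nat

lemma five_mul_le_two_pow {s : ℕ} (hs : 5 ≤ s) : 5 * s ≤ 2 ^ s := by
  induction s, hs using Nat.le_induction with
  | base => norm_num
  | succ s hs ih => rw [pow_succ]; lia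

open Classical in
lemma sum_progressions_le_card {M N W a : ℕ} [NeZero M] (hM : Odd M) (hNM : 2 * N < M) {G : ℝ}
    (hG : 0 ≤ G) {f : ZMod M → ℝ} (hf0 : ∀ x, 0 ≤ f x) (hfG : ∀ x, f x ≤ G)
    (hsupp : ∀ {x}, f x ≠ 0 → x.val < N ∧ (a + W * x.val).Prime) :
    ∑ x, ∑ d, f x * f (x + d) * f (x + d + d) ≤ G ^ 3 *
      #{n ∈ Finset.range M ×ˢ Finset.range M | (a + W * n.1).Prime ∧
      (a + W * n.2).Prime ∧ ∃ r, r.Prime ∧ (a + W * n.1) + (a + W * n.2) = 2 * r} := by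
  set S := (Finset.univ : Finset (ZMod M × ZMod M)).filter
    fun q => f q.1 * f (q.1 + q.2) * f (q.1 + q.2 + q.2) ≠ 0 with hS
  have hle : ∑ x, ∑ d, f x * f (x + d) * f (x + d + d) ≤ G ^ 3 * #S := by
    rw [← Fintype.sum_prod_type' (f := fun x d => f x * f (x + d) * f (x + d + d)),
      ← Finset.sum_filter_ne_zero, ← hS, mul_comm, ← nsmul_eq_mul]
    refine Finset.sum_le_card_nsmul _ _ _ fun q _ => ?_
    calc _ ≤ G * G * G := by
          gcongr
          all_goals first | exact hf0 _ | exact hfG _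
      _ = G ^ 3 := by ring
  have hcard : #S ≤ #{n ∈ Finset.range M ×ˢ Finset.range M | (a + W * n.1).Prime ∧
      (a + W * n.2).Prime ∧ ∃ r, r.Prime ∧ (a + W * n.1) + (a + W * n.2) = 2 * r} := by
    refine Finset.card_le_card_of_injOn (fun q => (q.1.val, (q.1 + q.2 + q.2).val)) ?_ ?_
    · rintro ⟨x, d⟩ hq
      have hq := (Finset.mem_filter.1 hq).2
      dsimp only at hq ⊢
      obtain ⟨hx, hx'⟩ := hsupp (left_ne_zero_of_mul (left_ne_zero_of_mul hq))
      obtain ⟨hy, hy'⟩ := hsupp (right_ne_zero_of_mul (left_ne_zero_of_mul hq))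
      obtain ⟨hz, hz'⟩ := hsupp (right_ne_zero_of_mul hq)
      refine Finset.mem_coe.2 (Finset.mem_filter.2 ⟨Finset.mem_product.2
        ⟨Finset.mem_range.2 (ZMod.val_lt _), Finset.mem_range.2 (ZMod.val_lt _)⟩, hx', hz',
        _, hy', ?_⟩)
      have := add_eq_two_mul_of_val_lt hNM hx hy hz
      calc _ = 2 * a + W * (x.val + (x + d + d).val) := by ring
        _ = _ := by rw [this]; ring
    · rintro ⟨x, d⟩ - ⟨y, e⟩ - h
      have h2 := ZMod.val_injective M (Prod.ext_iff.1 h).1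
      have h3 := ZMod.val_injective M (Prod.ext_iff.1 h).2
      dsimp only at h2 h3
      subst h2
      rw [add_assoc, add_assoc, add_right_inj] at h3
      rw [add_self_injective_of_odd hM h3]
  exact hle.trans (mul_le_mul_of_nonneg_left (Nat.cast_le.2 hcard) (by positivity))

open Classical in
lemma exists_many_prime_progressions : ∃ κ : ℝ, 0 < κ ∧ ∀ w₀ : ℕ, ∃ w ≥ w₀, ∃ M W a : ℕ,
    2 ^ w ≤ M ∧ 2 ≤ W ∧ κ * (M : ℝ) ^ 2 ≤ (w : ℝ) ^ 6 *
      #{n ∈ Finset.range M ×ˢ Finset.range M | (a + W * n.1).Prime ∧ (a + W * n.2).Prime ∧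
        ∃ r, r.Prime ∧ (a + W * n.1) + (a + W * n.2) = 2 * r} := by
  have hlog2 : 0 < Real.log 2 := Real.log_pos one_lt_two
  have hE := Real.exp_pos (-120)
  obtain ⟨c, η₀, hc, hη₀, hroth⟩ := roth_transference
    (δ := Real.exp (-120) * Real.log 2 / 120) (by positivity)
  refine ⟨c / 64, by positivity, fun w₀ => ?_⟩
  obtain ⟨s, hs⟩ := exists_nat_ge (max (max w₀ 5 : ℝ) (81920 / η₀))
  have hs0 : w₀ ≤ s := by exact_mod_cast (le_max_left _ _).trans ((le_max_left _ _).trans hs)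
  have hs5 : 5 ≤ s := by exact_mod_cast (le_max_right _ _).trans ((le_max_left _ _).trans hs)
  have hsη : 81920 / η₀ ≤ s := (le_max_right _ _).trans hs
  set w := 2 ^ s with hw
  have hsw : s ≤ w := Nat.lt_two_pow_self.le
  have hw32 : 32 ≤ w := by
    calc 32 = 2 ^ 5 := by norm_num
      _ ≤ 2 ^ s := Nat.pow_le_pow_right two_pos hs5
  have hw32R : (32 : ℝ) ≤ w := by exact_mod_cast hw32
  have hw0 : (0 : ℝ) < w := by linarith
  obtain ⟨a, ha⟩ := exists_residue_density (s := s) (by lia)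
  rw [← hw] at ha
  set N := 2 ^ (8 * w - 1) with hN
  set M := 2 ^ (8 * w) + 1 with hM
  set D := roughLevels (2 ^ w) (2 ^ (16 * s)) with hD
  set W := primorial w with hW
  have : NeZero M := ⟨Nat.succ_ne_zero _⟩
  have hM0 : (0 : ℝ) < M := Nat.cast_pos.2 (NeZero.pos M)
  have hModd : Odd M := by
    rw [hM, Nat.odd_add_one, Nat.not_odd_iff_even, Nat.even_pow]
    exact ⟨even_two, by lia⟩
  have hNM : 2 * N < M := by
    have : 2 ^ (8 * w) = 2 * N := by
      rw [hN, ← pow_succ']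
      congr 1
      lia
    lia
  have hsq : ∀ d ∈ D, Squarefree d := fun d hd => (mem_roughLevels.1 hd).2.1
  have hdiv : ∀ d ∈ D, ∀ e, e ∣ d → e ∈ D := fun d hd e he => mem_roughLevels_of_dvd hd he
  have h1 : 1 ∈ D := one_mem_roughLevels Nat.one_le_two_pow _
  have hR : ∀ d ∈ D, d ≤ 2 ^ w := fun d hd => (mem_roughLevels.1 hd).1.2
  have hQ : ∀ d ∈ D, ∀ p, p.Prime → p ∣ d → 2 ^ (16 * s) < p :=
    fun d hd => (mem_roughLevels.1 hd).2.2
  have hWD : ∀ d ∈ D, Nat.Coprime W d := by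
    refine fun d hd => Nat.coprime_of_dvd fun p hp hpW hpd => ?_
    have h2 := (hp.dvd_primorial_iff).1 hpW
    have h3 := hQ d hd p hp hpd
    have h4 : w ≤ 2 ^ (16 * s) := Nat.pow_le_pow_right two_pos (by lia)
    lia
  set G := selbergSum D with hG
  have hG1 : 1 ≤ G := one_le_selbergSum h1
  have hGw : G ≤ 4 * (w : ℝ) ^ 2 := selbergSum_roughLevels_two_pow_le (by lia) _
  have hQw : ((2 ^ (16 * s) : ℕ) : ℝ) = (w : ℝ) ^ 16 := by
    rw [hw]
    push_cast
    rw [← pow_mul, mul_comm]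
  have hMw : (2 : ℝ) ^ (8 * w) ≤ M := by
    rw [hM]
    push_cast
    linarith
  have hw10 : (w : ℝ) ^ 10 ≤ 2 ^ (2 * w) := by
    have h2 := five_mul_le_two_pow hs5
    have : w ^ 10 ≤ 2 ^ (2 * w) := by
      rw [hw, ← pow_mul]
      exact Nat.pow_le_pow_right two_pos (by lia)
    exact_mod_cast this
  set ν : ZMod M → ℝ := selbergMajorant D W a with hν
  set η : ℝ := 1280 / (w : ℝ) ^ 8 with hη
  have hsmall : 3 * G * ((2 ^ w : ℕ) : ℝ) ^ 6 / M ≤ 256 / (w : ℝ) ^ 8 := by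
    rw [div_le_div_iff₀ hM0 (by positivity)]
    push_cast
    calc 3 * G * ((2 : ℝ) ^ w) ^ 6 * (w : ℝ) ^ 8
        ≤ 3 * (4 * (w : ℝ) ^ 2) * ((2 : ℝ) ^ w) ^ 6 * (w : ℝ) ^ 8 := by gcongr
      _ = 12 * ((2 : ℝ) ^ w) ^ 6 * (w : ℝ) ^ 10 := by ring
      _ ≤ 12 * ((2 : ℝ) ^ w) ^ 6 * 2 ^ (2 * w) := by gcongr
      _ = 12 * 2 ^ (8 * w) := by ring
      _ ≤ 256 * 2 ^ (8 * w) := by gcongr; norm_num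
      _ ≤ 256 * M := by gcongr
  have hν0 : ‖zfourier ν 0 - 1‖ ≤ η := by
    refine (norm_zfourier_selbergMajorant_zero_sub_one_le hsq hdiv h1 hR hWD a).trans ?_
    have h2 : (1 : ℝ) ≤ (2 ^ w : ℕ) := by exact_mod_cast Nat.one_le_two_pow
    calc G * ((2 ^ w : ℕ) : ℝ) ^ 4 / M ≤ 3 * G * ((2 ^ w : ℕ) : ℝ) ^ 6 / M := by
          gcongr
          · linarith
          · norm_num
      _ ≤ 256 / (w : ℝ) ^ 8 := hsmall
      _ ≤ η := by rw [hη]; gcongr; norm_num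
  have hνξ : ∀ ξ, ξ ≠ 0 → ‖zfourier ν ξ‖ ≤ η := by
    intro ξ hξ
    refine (norm_zfourier_selbergMajorant_le hsq hdiv h1 hR hWD hQ (by positivity) a hξ).trans ?_
    have h2 : 4 * G ^ 4 / (2 ^ (16 * s) : ℕ) ≤ 1024 / (w : ℝ) ^ 8 := by
      rw [hQw]
      calc 4 * G ^ 4 / (w : ℝ) ^ 16 ≤ 4 * (4 * (w : ℝ) ^ 2) ^ 4 / (w : ℝ) ^ 16 := by gcongr
        _ = _ := by field_simp; norm_num
    calc _ ≤ 1024 / (w : ℝ) ^ 8 + 256 / (w : ℝ) ^ 8 := add_le_add h2 hsmall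
      _ = η := by rw [hη]; ring
  set f : ZMod M → ℝ := fun x =>
    if x.val < N ∧ (a + W * x.val).Prime ∧ 2 ^ w < a + W * x.val then G else 0 with hf
  have hf0 : ∀ x, 0 ≤ f x := fun x => by
    simp only [hf]
    split_ifs <;> linarith
  have hfν : ∀ x, f x ≤ ν x := by
    intro x
    simp only [hf]
    split_ifs with h
    · exact (selbergMajorant_of_prime h1 hR h.2.1 h.2.2).ge
    · exact selbergMajorant_nonneg h1 W a x
  have hfG : ∀ x, f x ≤ G := fun x => by
    simp only [hf]
    split_ifs <;> linarith
  have hη1 : η ≤ 1 := by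
    rw [hη, div_le_one (by positivity)]
    calc (1280 : ℝ) ≤ 32 ^ 8 := by norm_num
      _ ≤ _ := by gcongr
  have hνsum : (∑ x, ν x) / M ≤ 2 := by
    have h2 : ‖(((∑ x, ν x) / M - 1 : ℝ) : ℂ)‖ ≤ η := by
      have := hν0
      rw [zfourier_zero] at this
      push_cast at this ⊢
      exact this
    rw [Complex.norm_real, Real.norm_eq_abs] at h2
    linarith [(abs_le.1 h2).2]
  have hf2 : (∑ x, f x ^ 2) / M ≤ 8 * (w : ℝ) ^ 2 := by
    calc (∑ x, f x ^ 2) / M ≤ (∑ x, G * ν x) / M := by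
          gcongr with x
          rw [sq]
          exact mul_le_mul (hfG x) (hfν x) (hf0 x) (by linarith)
      _ = G * ((∑ x, ν x) / M) := by rw [← Finset.mul_sum, mul_div_assoc]
      _ ≤ 4 * (w : ℝ) ^ 2 * 2 := mul_le_mul hGw hνsum (div_nonneg (Finset.sum_nonneg
          fun x _ => (hf0 x).trans (hfν x)) hM0.le) (by positivity)
      _ = _ := by ring
  have hfsum : Real.exp (-120) * Real.log 2 / 120 * M ≤ ∑ x, f x := by
    refine ha.trans ?_
    rw [hf, ← Finset.sum_filter, Finset.sum_const, nsmul_eq_mul, mul_comm]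
    refine mul_le_mul_of_nonneg_right (Nat.cast_le.2 ?_) (by linarith)
    refine Finset.card_le_card_of_injOn (fun n => (n : ZMod M)) ?_ ?_
    · intro n hn
      obtain ⟨hn, hn2⟩ := Finset.mem_filter.1 hn
      have hnN := Finset.mem_range.1 hn
      have : ((n : ZMod M)).val = n := ZMod.val_cast_of_lt (by lia)
      refine Finset.mem_coe.2 (Finset.mem_filter.2 ⟨Finset.mem_univ _, ?_⟩)
      rw [this]
      exact ⟨hnN, hn2⟩
    · intro m hm n hn hmn
      have hm := Finset.mem_range.1 (Finset.mem_filter.1 hm).1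
      have hn := Finset.mem_range.1 (Finset.mem_filter.1 hn).1
      have := congrArg ZMod.val hmn
      rwa [ZMod.val_cast_of_lt (by lia), ZMod.val_cast_of_lt (by lia)] at this
  have hηL : η * (8 * (w : ℝ) ^ 2) ^ 2 ≤ η₀ := by
    have h2 : η * (8 * (w : ℝ) ^ 2) ^ 2 = 81920 / (w : ℝ) ^ 4 := by
      rw [hη]
      field_simp
      norm_num
    rw [h2, div_le_iff₀ (by positivity)]
    have h3 : (s : ℝ) ≤ w := by exact_mod_cast hsw
    have h4 : (w : ℝ) ≤ (w : ℝ) ^ 4 := le_self_pow₀ (by linarith) (by norm_num)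
    rw [div_le_iff₀ hη₀] at hsη
    nlinarith
  have key := hroth M f ν η (8 * (w : ℝ) ^ 2) hModd hf0 hfν hν0 hνξ (by nlinarith) hηL hf2 hfsum
  refine ⟨w, hs0.trans hsw, M, W, a, ?_, one_lt_primorial (by lia), ?_⟩
  · exact (Nat.pow_le_pow_right two_pos (by lia)).trans (Nat.le_succ _)
  have hG3 : G ^ 3 ≤ 64 * (w : ℝ) ^ 6 := by
    calc G ^ 3 ≤ (4 * (w : ℝ) ^ 2) ^ 3 := by gcongr
      _ = _ := by ring
  have hcount := key.trans (sum_progressions_le_card (W := W) (a := a) hModd hNM (by linarith)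
    hf0 hfG fun {x} hx => by
      by_contra h
      exact hx (if_neg fun h2 => h ⟨h2.1, h2.2.1⟩))
  rw [div_mul_eq_mul_div, div_le_iff₀ (by norm_num)]
  refine hcount.trans ((mul_le_mul_of_nonneg_right hG3 (Nat.cast_nonneg _)).trans_eq ?_)
  ring

end PrimePairs

section Labelings

open Finset

lemma isPrimeProductGraph_of_labels {a b c k : ℕ} {A : Fin a → ℤ} {B : Fin b → ℤ} {C : Fin c → ℤ}
    (hA : ∀ i j, i ≠ j → 1 < |A i - A j|) (hB : ∀ i j, i ≠ j → 1 < |B i - B j|)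
    (hC : ∀ i j, i ≠ j → 1 < |C i - C j|)
    (hAB : ∀ i j, 1 < |A i - B j| ∧ (A i - B j).natAbs.primeFactorsList.length ≤ k)
    (hBC : ∀ i j, 1 < |B i - C j| ∧ (B i - C j).natAbs.primeFactorsList.length ≤ k)
    (hAC : ∀ i j, 1 < |A i - C j| ∧ (A i - C j).natAbs.primeFactorsList.length ≤ k) :
    IsPrimeProductGraph (K3p a b c) k := by
  have hBA : ∀ i j, 1 < |B i - A j| ∧ (B i - A j).natAbs.primeFactorsList.length ≤ k :=
    fun i j => by rw [abs_sub_comm, ← Int.natAbs_neg, neg_sub]; exact hAB j i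
  have hCB : ∀ i j, 1 < |C i - B j| ∧ (C i - B j).natAbs.primeFactorsList.length ≤ k :=
    fun i j => by rw [abs_sub_comm, ← Int.natAbs_neg, neg_sub]; exact hBC j i
  have hCA : ∀ i j, 1 < |C i - A j| ∧ (C i - A j).natAbs.primeFactorsList.length ≤ k :=
    fun i j => by rw [abs_sub_comm, ← Int.natAbs_neg, neg_sub]; exact hAC j i
  let L : ((i : Fin 3) × (![Fin a, Fin b, Fin c] i)) → ℤ := fun v =>
    match v with
    | ⟨0, i⟩ => A i
    | ⟨1, i⟩ => B i
    | ⟨2, i⟩ => C i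
  have hL : ∀ u v, u ≠ v → 1 < |L u - L v| := by
    rintro ⟨u, i⟩ ⟨v, j⟩ h
    fin_cases u <;> fin_cases v
    · exact hA i j fun e => h (by rw [e])
    · exact (hAB i j).1
    · exact (hAC i j).1
    · exact (hBA i j).1
    · exact hB i j fun e => h (by rw [e])
    · exact (hBC i j).1
    · exact (hCA i j).1
    · exact (hCB i j).1
    · exact hC i j fun e => h (by rw [e])
  refine ⟨L, fun u v huv => ?_, hL, ?_⟩
  · by_contra h
    have := hL u v h
    simp [huv] at this
  · rintro ⟨u, i⟩ ⟨v, j⟩ h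
    have huv : u ≠ v := h
    fin_cases u <;> fin_cases v
    · exact absurd rfl huv
    · exact (hAB i j).2
    · exact (hAC i j).2
    · exact (hBA i j).2
    · exact absurd rfl huv
    · exact (hBC i j).2
    · exact (hCA i j).2
    · exact (hCB i j).2
    · exact absurd rfl huv

lemma one_lt_abs_mul_sub {W m n : ℕ} (hW : 2 ≤ W) (h : m ≠ n) (s : ℤ) :
    1 < |((W : ℤ) * m - s) - (W * n - s)| := by
  have h1 : (1 : ℤ) ≤ |(m : ℤ) - n| := Int.one_le_abs (by lia)
  rw [sub_sub_sub_cancel_right, ← mul_sub, abs_mul, abs_of_nonneg (by lia : (0 : ℤ) ≤ W)]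
  nlinarith

lemma length_primeFactorsList_two_mul {r : ℕ} (hr : r.Prime) :
    (2 * r).primeFactorsList.length = 2 := by
  rw [← ArithmeticFunction.cardFactors_apply, ArithmeticFunction.cardFactors_mul two_ne_zero
    hr.ne_zero, ArithmeticFunction.cardFactors_apply_prime Nat.prime_two,
    ArithmeticFunction.cardFactors_apply_prime hr]

lemma exists_lt_pow_mul_two_pow {κ : ℝ} (hκ : 0 < κ) (t : ℕ) (B : ℝ) : ∃ w₀ : ℕ, ∀ w ≥ w₀,
    B < ((κ / (6 * (w : ℝ) ^ 6)) ^ t / 2) ^ t / 2 * 2 ^ w := by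
  set K := κ ^ (t * t) / (6 ^ (t * t) * 2 ^ (t + 1)) with hK
  have hK0 : 0 < K := by positivity
  have h1 := tendsto_pow_const_div_const_pow_of_one_lt (6 * (t * t)) (one_lt_two : (1 : ℝ) < 2)
  have h2 := h1.eventually (gt_mem_nhds (show 0 < K / (|B| + 1) by positivity))
  obtain ⟨w₀, hw₀⟩ := Filter.eventually_atTop.1 h2
  refine ⟨w₀ + 1, fun w hw => ?_⟩
  have h3 := hw₀ w (by lia)
  have hw0 : (0 : ℝ) < w := Nat.cast_pos.2 (by lia)
  rw [div_lt_div_iff₀ (by positivity) (by positivity)] at h3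
  have h4 : ((κ / (6 * (w : ℝ) ^ 6)) ^ t / 2) ^ t / 2 * 2 ^ w =
      K * 2 ^ w / (w : ℝ) ^ (6 * (t * t)) := by
    rw [hK]
    simp only [div_pow, mul_pow, ← pow_mul]
    field_simp
    ring
  rw [h4, lt_div_iff₀ (by positivity)]
  have h5 : B * (w : ℝ) ^ (6 * (t * t)) ≤ |B| * (w : ℝ) ^ (6 * (t * t)) := by
    gcongr
    exact le_abs_self B
  have h6 : (0 : ℝ) < (w : ℝ) ^ (6 * (t * t)) := by positivity
  linarith

end Labelings

section Tripartite

open Finset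

/-- The triples `(x, y, z)` for which the labels `W * x`, `W * y - a` and `W * z - 2 * a` form a
triangle with two prime edges and one edge twice a prime. -/
def IsPrimeTriangle (W a x y z : ℕ) : Prop :=
  z ≤ y ∧ y ≤ x ∧ (a + W * (x - y)).Prime ∧ (a + W * (y - z)).Prime ∧
    ∃ r, r.Prime ∧ (a + W * (x - y)) + (a + W * (y - z)) = 2 * r

open Classical in
lemma mul_card_le_card_isPrimeTriangle (M W a : ℕ) :
    M * #{n ∈ Finset.range M ×ˢ Finset.range M | (a + W * n.1).Prime ∧ (a + W * n.2).Prime ∧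
        ∃ r, r.Prime ∧ (a + W * n.1) + (a + W * n.2) = 2 * r} ≤
      #{p : Fin (3 * M) × (Fin (2 * M) × Fin M) | IsPrimeTriangle W a p.1 p.2.1 p.2.2} := by
  set T := {n ∈ Finset.range M ×ˢ Finset.range M | (a + W * n.1).Prime ∧ (a + W * n.2).Prime ∧
        ∃ r, r.Prime ∧ (a + W * n.1) + (a + W * n.2) = 2 * r} with hT
  have h1 : Finset.range M ×ˢ T ⊆ (Finset.univ.filter
      fun p : Fin (3 * M) × (Fin (2 * M) × Fin M) => IsPrimeTriangle W a p.1 p.2.1 p.2.2).image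
      fun p => ((p.2.2 : ℕ), ((p.1 : ℕ) - (p.2.1 : ℕ), (p.2.1 : ℕ) - (p.2.2 : ℕ))) := by
    rintro ⟨z, n₁, n₂⟩ h
    obtain ⟨hz, hn⟩ := Finset.mem_product.1 h
    obtain ⟨hn, hp₁, hp₂, hr⟩ := Finset.mem_filter.1 hn
    obtain ⟨hn₁, hn₂⟩ := Finset.mem_product.1 hn
    have hz := Finset.mem_range.1 hz
    have hn₁ := Finset.mem_range.1 hn₁
    have hn₂ := Finset.mem_range.1 hn₂
    dsimp only at hz hn₁ hn₂ hp₁ hp₂ hr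
    have e₁ : z + n₂ + n₁ - (z + n₂) = n₁ := by lia
    have e₂ : z + n₂ - z = n₂ := by lia
    refine Finset.mem_image.2 ⟨(⟨z + n₂ + n₁, by lia⟩, (⟨z + n₂, by lia⟩, ⟨z, hz⟩)),
      Finset.mem_filter.2 ⟨Finset.mem_univ _, ?_⟩, ?_⟩
    · dsimp only
      refine ⟨by lia, by lia, ?_, ?_, ?_⟩
      · rwa [e₁]
      · rwa [e₂]
      · rwa [e₁, e₂]
    · dsimp only
      rw [e₁, e₂]
  have h2 := (Finset.card_le_card h1).trans Finset.card_image_le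
  rwa [Finset.card_product, Finset.card_range] at h2

lemma exists_complete_prime_tripartite {t : ℕ} (ht : 0 < t) : ∃ (W a : ℕ) (x y z : Fin t → ℕ),
    2 ≤ W ∧ Function.Injective x ∧ Function.Injective y ∧ Function.Injective z ∧
    ∀ i j k, IsPrimeTriangle W a (x i) (y j) (z k) := by
  classical
  obtain ⟨κ, hκ, hprog⟩ := exists_many_prime_progressions
  obtain ⟨w₀, hw₀⟩ := exists_lt_pow_mul_two_pow hκ t (2 * (t : ℝ) ^ 2)
  obtain ⟨w, hw, M, W, a, hM, hW, hcount⟩ := hprog (max w₀ 1)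
  have hγ := hw₀ w ((le_max_left _ _).trans hw)
  have hw1 : 1 ≤ w := (le_max_right _ _).trans hw
  have hw0 : (0 : ℝ) < w := Nat.cast_pos.2 hw1
  have hMR : (2 : ℝ) ^ w ≤ M := by exact_mod_cast hM
  have hM0 : (0 : ℝ) < M := lt_of_lt_of_le (by positivity) hMR
  set T := #{n ∈ Finset.range M ×ˢ Finset.range M | (a + W * n.1).Prime ∧ (a + W * n.2).Prime ∧
        ∃ r, r.Prime ∧ (a + W * n.1) + (a + W * n.2) = 2 * r} with hT
  have hTM : (T : ℝ) ≤ (M : ℝ) ^ 2 := by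
    have : T ≤ M * M := by
      rw [hT]
      refine (Finset.card_filter_le _ _).trans ?_
      rw [Finset.card_product, Finset.card_range]
    rw [sq]
    exact_mod_cast this
  set α : ℝ := κ / (6 * (w : ℝ) ^ 6) with hα
  set β : ℝ := α ^ t / 2 with hβ
  set γ : ℝ := β ^ t / 2 with hγ'
  have hα0 : 0 < α := by positivity
  have hβ0 : 0 < β := by positivity
  have hγ0 : 0 < γ := by positivity
  have hα1 : α ≤ 1 := by
    rw [hα, div_le_one (by positivity)]
    have h1 : κ * (M : ℝ) ^ 2 ≤ (w : ℝ) ^ 6 * (M : ℝ) ^ 2 := hcount.trans (by gcongr)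
    have h2 := le_of_mul_le_mul_right h1 (by positivity)
    have h3 : (0 : ℝ) < (w : ℝ) ^ 6 := by positivity
    linarith
  have hαt : α ^ t ≤ 1 := pow_le_one₀ hα0.le hα1
  have hβt : β ^ t ≤ β := pow_le_of_le_one hβ0.le (by rw [hβ]; linarith) ht.ne'
  have hγM : 2 * (t : ℝ) ^ 2 < γ * M := hγ.trans_le (by gcongr)
  have ht1 : (1 : ℝ) ≤ t := by exact_mod_cast ht
  have hcard := mul_card_le_card_isPrimeTriangle M W a
  rw [← hT] at hcard
  obtain ⟨x, y, z, hx, hy, hz, h⟩ := exists_complete_tripartite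
    (X := Fin (3 * M)) (Y := Fin (2 * M)) (Z := Fin M)
    (fun x y z => IsPrimeTriangle W a x y z) ht hα0 hβ hγ' (by
      rw [Fintype.card_fin]
      push_cast
      nlinarith) (by
      rw [Fintype.card_fin]
      push_cast
      nlinarith) (by
      rw [Fintype.card_fin]
      nlinarith) (by
      rw [Fintype.card_prod, Fintype.card_fin, Fintype.card_fin, Fintype.card_fin]
      push_cast
      have h1 : ((M * T : ℕ) : ℝ) ≤ _ := Nat.cast_le.2 hcard
      refine le_trans ?_ h1
      push_cast
      calc α * (3 * M) * (2 * M * M) = M * (κ * (M : ℝ) ^ 2 / (w : ℝ) ^ 6) := by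
            rw [hα]
            field_simp
            ring
        _ ≤ M * T := by
            gcongr
            rw [div_le_iff₀ (by positivity)]
            exact hcount.trans_eq (mul_comm _ _))
  exact ⟨W, a, fun i => x i, fun i => y i, fun i => z i, hW, Fin.val_injective.comp hx,
    Fin.val_injective.comp hy, Fin.val_injective.comp hz, h⟩

lemma isPrimeProductGraph_two (a b c : ℕ) (ha : 0 < a) (hab : a ≤ b) (hbc : b ≤ c) :
    IsPrimeProductGraph (K3p a b c) 2 := by
  obtain ⟨W, s, x, y, z, hW, hx, hy, hz, h⟩ :=
    exists_complete_prime_tripartite (t := c) (by lia)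
  have hi : ∀ {m : ℕ} (hm : m ≤ c), Function.Injective (Fin.castLE hm) :=
    fun hm => Fin.castLE_injective hm
  have hac := hab.trans hbc
  refine isPrimeProductGraph_of_labels (A := fun i => W * x (i.castLE hac) - (0 : ℤ))
    (B := fun i => W * y (i.castLE hbc) - (s : ℤ)) (C := fun i => W * z i - (2 * s : ℤ))
    (fun i j hij => one_lt_abs_mul_sub hW ((hx.comp (hi hac)).ne hij) _)
    (fun i j hij => one_lt_abs_mul_sub hW ((hy.comp (hi hbc)).ne hij) _)
    (fun i j hij => one_lt_abs_mul_sub hW (hz.ne hij) _) ?_ ?_ ?_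
  · intro i j
    obtain ⟨-, hyx, hp, -⟩ := h (i.castLE hac) (j.castLE hbc) ⟨0, by lia⟩
    set p := s + W * (x (i.castLE hac) - y (j.castLE hbc)) with hpdef
    have e : (W * x (i.castLE hac) - (0 : ℤ)) - (W * y (j.castLE hbc) - (s : ℤ)) = p := by
      rw [hpdef]
      push_cast [Nat.cast_sub hyx]
      ring
    rw [e, Nat.abs_cast, Int.natAbs_natCast, Nat.primeFactorsList_prime hp]
    exact ⟨by exact_mod_cast hp.one_lt, by simp⟩
  · intro j k
    obtain ⟨hzy, -, -, hp, -⟩ := h ⟨0, by lia⟩ (j.castLE hbc) k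
    set p := s + W * (y (j.castLE hbc) - z k) with hpdef
    have e : (W * y (j.castLE hbc) - (s : ℤ)) - (W * z k - (2 * s : ℤ)) = p := by
      rw [hpdef]
      push_cast [Nat.cast_sub hzy]
      ring
    rw [e, Nat.abs_cast, Int.natAbs_natCast, Nat.primeFactorsList_prime hp]
    exact ⟨by exact_mod_cast hp.one_lt, by simp⟩
  · intro i k
    obtain ⟨hzy, hyx, -, -, r, hr, hsum⟩ := h (i.castLE hac) ⟨0, by lia⟩ k
    have e : (W * x (i.castLE hac) - (0 : ℤ)) - (W * z k - (2 * s : ℤ)) = (2 * r : ℕ) := by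
      rw [← hsum]
      push_cast [Nat.cast_sub hzy, Nat.cast_sub hyx]
      ring
    rw [e, Nat.abs_cast, Int.natAbs_natCast, length_primeFactorsList_two_mul hr]
    refine ⟨?_, le_rfl⟩
    have := hr.two_le
    lia

end Tripartite

/-- For positive integers `a ≤ b ≤ c` with not `a = b = 1` and not
`(a, b, c) = (1, 2, 2)`, we have `ppn (K_{a,b,c}) = 2`. -/
theorem ppn_K3p_eq_two (a b c : ℕ) (ha : 0 < a) (hab : a ≤ b) (hbc : b ≤ c)
    (h1 : ¬(a = 1 ∧ b = 1)) (h2 : ¬(a = 1 ∧ b = 2 ∧ c = 2)) :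
    ppn (K3p a b c) = 2 := by
  have hmem : 2 ∈ {k : ℕ | 0 < k ∧ IsPrimeProductGraph (K3p a b c) k} :=
    ⟨two_pos, isPrimeProductGraph_two a b c ha hab hbc⟩
  have hle : ppn (K3p a b c) ≤ 2 := Nat.sInf_le hmem
  obtain ⟨hpos, hppn⟩ : 0 < ppn (K3p a b c) ∧ IsPrimeProductGraph (K3p a b c) (ppn (K3p a b c)) :=
    Nat.sInf_mem ⟨2, hmem⟩
  have hne : ppn (K3p a b c) ≠ 1 := fun h =>
    not_isPrimeProductGraph_one a b c ha hab hbc h1 h2 (h ▸ hppn)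
  lia
end
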